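/- Let (ρ, u) be a weak solution of the stationary isentropic Navier–Stokes system on ℝ³ with exponent γ ≥ 3 and potential G ∈ D₀^{1, 6γ/(5γ−6)}(ℝ³). Let 1 ≤ β ≤ 2 and 0 ≤ α ≤ 5/(2γ). If sup_{R>1} R^{−α} ‖ρ‖_{L^γ(B(R))} < ∞ and liminf_{R→∞} R^{−g(α,β,γ)} ‖u‖_{L^β(B(2R)∖B(R))} < ∞, then u = 0 almost everywhere. -/

import Mathlib

noncomputable section

open MeasureTheory Metric Filter Topology Set

/-- Three-dimensional Euclidean space. -/
abbrev E3 : Type := EuclideanSpace ℝ (Fin 3)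

/-- Partial derivative of a scalar function in the `i`-th coordinate direction. -/
def pd (f : E3 → ℝ) (i : Fin 3) : E3 → ℝ :=
  fun x => fderiv ℝ f x (EuclideanSpace.single i 1)

/-- Classical gradient matrix of a vector field: `(tgrad φ x) i j = ∂_j φ_i (x)`. -/
def tgrad (φ : E3 → Fin 3 → ℝ) (x : E3) : Fin 3 → Fin 3 → ℝ :=
  fun i j => pd (fun y => φ y i) j x

/-- Smooth compactly supported scalar test function with support in `Ω`. -/
def IsTest (Ω : Set E3) (φ : E3 → ℝ) : Prop :=
  ContDiff ℝ ((⊤ : ℕ∞) : WithTop ℕ∞) φ ∧ HasCompactSupport φ ∧ tsupport φ ⊆ Ω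

/-- `C^n` compactly supported vector-valued test function with support in `Ω`. -/
def IsTestVec (n : WithTop ℕ∞) (Ω : Set E3) (φ : E3 → Fin 3 → ℝ) : Prop :=
  ContDiff ℝ n φ ∧ HasCompactSupport φ ∧ tsupport φ ⊆ Ω

/-- The Newtonian viscous stress tensor
`S(M) = μ (M + Mᵗ - (2/3) (tr M) I) + η (tr M) I`. -/
def Smat (μ η : ℝ) (M : Fin 3 → Fin 3 → ℝ) : Fin 3 → Fin 3 → ℝ :=
  fun i j =>
    μ * (M i j + M j i - (2 / 3) * (∑ k, M k k) * (if i = j then (1 : ℝ) else 0))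
      + η * (∑ k, M k k) * (if i = j then (1 : ℝ) else 0)

/-- `dG` is the weak gradient of the scalar function `G` on `Ω`. -/
def HasWeakGradOn (Ω : Set E3) (G : E3 → ℝ) (dG : E3 → Fin 3 → ℝ) : Prop :=
  ∀ φ : E3 → ℝ, IsTest Ω φ → ∀ i : Fin 3,
    ∫ x in Ω, G x * pd φ i x = - ∫ x in Ω, dG x i * φ x

/-- `du` is the weak gradient (Jacobian) of the vector field `u` on `Ω`. -/
def HasWeakGradVecOn (Ω : Set E3) (u : E3 → Fin 3 → ℝ) (du : E3 → Fin 3 → Fin 3 → ℝ) : Prop :=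
  ∀ φ : E3 → ℝ, IsTest Ω φ → ∀ i j : Fin 3,
    ∫ x in Ω, u x i * pd φ j x = - ∫ x in Ω, du x i j * φ x

/-- `u ∈ D₀^{1,2}(Ω; ℝ³)` with weak gradient `du`: `u` is locally integrable on `Ω`, its weak
gradient belongs to `L²(Ω)`, and `u` can be approximated by smooth compactly supported fields
`uₙ` with `∇uₙ → ∇u` in `L²(Ω)` and `uₙ → u` in `L⁶(Ω)`. -/
def MemD012 (Ω : Set E3) (u : E3 → Fin 3 → ℝ) (du : E3 → Fin 3 → Fin 3 → ℝ) : Prop :=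
  LocallyIntegrableOn u Ω volume ∧
  HasWeakGradVecOn Ω u du ∧
  MemLp du 2 (volume.restrict Ω) ∧
  ∃ un : ℕ → E3 → Fin 3 → ℝ,
    (∀ n, IsTestVec ((⊤ : ℕ∞) : WithTop ℕ∞) Ω (un n)) ∧
    Tendsto (fun n => eLpNorm (fun x => tgrad (un n) x - du x) 2 (volume.restrict Ω))
      atTop (𝓝 0) ∧
    Tendsto (fun n => eLpNorm (fun x => un n x - u x) 6 (volume.restrict Ω)) atTop (𝓝 0)

/-- `G ∈ D₀^{1,q}(Ω)` with weak gradient `dG`. -/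
def MemD01q (Ω : Set E3) (G : E3 → ℝ) (dG : E3 → Fin 3 → ℝ) (q : ℝ) : Prop :=
  HasWeakGradOn Ω G dG ∧
  MemLp dG (ENNReal.ofReal q) (volume.restrict Ω) ∧
  ∃ Gn : ℕ → E3 → ℝ,
    (∀ n, IsTest Ω (Gn n)) ∧
    Tendsto (fun n =>
        eLpNorm (fun x => (fun i => pd (Gn n) i x) - dG x) (ENNReal.ofReal q)
          (volume.restrict Ω)) atTop (𝓝 0) ∧
    ∀ K : Set E3, IsCompact K → K ⊆ Ω →
      Tendsto (fun n => ∫ x in K, |Gn n x - G x|) atTop (𝓝 0)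

/-- `G ∈ W^{1,∞}(Ω)` with weak gradient `dG`: both `G` and `∇G` are essentially bounded. -/
def MemW1inf (Ω : Set E3) (G : E3 → ℝ) (dG : E3 → Fin 3 → ℝ) : Prop :=
  HasWeakGradOn Ω G dG ∧
  MemLp G ⊤ (volume.restrict Ω) ∧ MemLp dG ⊤ (volume.restrict Ω)

/-- Weak solution `(ρ, u)` (with weak gradient `du` of `u` and weak gradient `dG` of `G`) of the
stationary barotropic Navier–Stokes system
`div(ρu) = 0`, `div(ρ u⊗u) + ∇p(ρ) − div S(∇u) = ρ∇G` on `Ω` with no-slip boundary condition. -/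
structure WeakSolution (Ω : Set E3) (μ η : ℝ) (p : ℝ → ℝ)
    (G : E3 → ℝ) (dG : E3 → Fin 3 → ℝ)
    (ρ : E3 → ℝ) (u : E3 → Fin 3 → ℝ) (du : E3 → Fin 3 → Fin 3 → ℝ) : Prop where
  aemeas_ρ : AEMeasurable ρ volume
  aemeas_u : AEMeasurable u volume
  weakGrad_G : HasWeakGradOn Ω G dG
  ρ_nonneg : ∀ᵐ x ∂(volume.restrict Ω), 0 ≤ ρ x
  ρu_locInt : LocallyIntegrableOn (fun x => fun i => ρ x * u x i) (closure Ω) volume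
  mass : ∀ φ : E3 → ℝ, ContDiff ℝ ((⊤ : ℕ∞) : WithTop ℕ∞) φ → HasCompactSupport φ →
    ∫ x in Ω, ρ x * (∑ i, u x i * pd φ i x) = 0
  ρ_locInt : LocallyIntegrableOn ρ Ω volume
  ρu2_locInt : LocallyIntegrableOn (fun x => ρ x * (∑ i, (u x i) ^ 2)) Ω volume
  pρ_locInt : LocallyIntegrableOn (fun x => p (ρ x)) Ω volume
  ρdG_locInt : LocallyIntegrableOn (fun x => fun i => ρ x * dG x i) Ω volume
  u_D012 : MemD012 Ω u du
  momentum : ∀ φ : E3 → Fin 3 → ℝ, IsTestVec 1 Ω φ →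
    ∫ x in Ω, ((∑ i, ∑ j, ρ x * u x i * u x j * tgrad φ x i j)
        + p (ρ x) * (∑ i, tgrad φ x i i))
      = (∫ x in Ω, ∑ i, ∑ j, Smat μ η (du x) i j * tgrad φ x i j)
        - ∫ x in Ω, ∑ i, ρ x * dG x i * φ x i

/-- Weak solution of the stationary isentropic Navier–Stokes system on `ℝ³`
with pressure `p(ρ) = ρ^γ`. -/
def IsentropicWeakSolution (μ η γ : ℝ) (G : E3 → ℝ) (dG : E3 → Fin 3 → ℝ)
    (ρ : E3 → ℝ) (u : E3 → Fin 3 → ℝ) (du : E3 → Fin 3 → Fin 3 → ℝ) : Prop :=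
  WeakSolution univ μ η (fun s => s ^ γ) G dG ρ u du

/-- The `L^r` norm of a scalar function on a set. -/
def lpNormOn (f : E3 → ℝ) (r : ℝ) (s : Set E3) : ℝ :=
  (∫ x in s, |f x| ^ r) ^ (1 / r)

/-- Euclidean norm of a vector in `ℝ³` (represented as `Fin 3 → ℝ`). -/
def vnorm (v : Fin 3 → ℝ) : ℝ := Real.sqrt (∑ i, (v i) ^ 2)

/-- The `L^r` norm of a vector field on a set. -/
def vecLpNormOn (u : E3 → Fin 3 → ℝ) (r : ℝ) (s : Set E3) : ℝ :=
  (∫ x in s, (vnorm (u x)) ^ r) ^ (1 / r)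

/-- The exponent `f(α, γ)` from the higher-integrability propositions. -/
def fExp (α γ : ℝ) : ℝ :=
  if 6 ≤ γ then
    (if (2 * γ - 3) / (γ * (γ - 1)) ≤ α then α - 3 / (2 * γ)
     else α / γ + 1 / (2 * γ) - 3 / γ ^ 2)
  else
    (if 3 / (2 * (γ - 1)) ≤ α then α - 3 / (2 * γ)
     else if 1 / (2 * (γ - 1)) ≤ α then α / γ
     else α / γ ^ 2 + 1 / (2 * γ ^ 2))

/-- The exponent `g(α, β, γ)`. -/
def gExp (α β γ : ℝ) : ℝ :=
  if fExp α γ ≤ (γ - 3) / (γ * (3 * γ - 5)) then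
    γ * (1 - fExp α γ) * (6 - β) / (3 * β * (γ - 1))
  else (1 - γ * fExp α γ) * (6 - β) / (2 * β)

noncomputable section

open MeasureTheory Metric Filter Topology Set
open scoped ENNReal NNReal

/-! ### Basic calculus -/

abbrev Sm (f : E3 → ℝ) : Prop := ContDiff ℝ ((⊤ : ℕ∞) : WithTop ℕ∞) f

lemma Sm.one {f : E3 → ℝ} (hf : Sm f) : ContDiff ℝ 1 f :=
  hf.of_le (by exact_mod_cast le_top)

lemma pd_mul {f g : E3 → ℝ} {x : E3} (hf : DifferentiableAt ℝ f x) (hg : DifferentiableAt ℝ g x)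
    (i : Fin 3) : pd (fun y => f y * g y) i x = pd f i x * g x + f x * pd g i x := by
  unfold pd
  rw [fderiv_fun_mul hf hg]
  simp [mul_comm]
  ring

lemma pd_add {f g : E3 → ℝ} {x : E3} (hf : DifferentiableAt ℝ f x) (hg : DifferentiableAt ℝ g x)
    (i : Fin 3) : pd (fun y => f y + g y) i x = pd f i x + pd g i x := by
  unfold pd
  rw [fderiv_fun_add hf hg]
  simp

lemma pd_sub {f g : E3 → ℝ} {x : E3} (hf : DifferentiableAt ℝ f x) (hg : DifferentiableAt ℝ g x)
    (i : Fin 3) : pd (fun y => f y - g y) i x = pd f i x - pd g i x := by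
  unfold pd
  rw [fderiv_fun_sub hf hg]
  simp

lemma pd_const_mul {f : E3 → ℝ} {x : E3} (c : ℝ) (hf : DifferentiableAt ℝ f x)
    (i : Fin 3) : pd (fun y => c * f y) i x = c * pd f i x := by
  unfold pd
  rw [fderiv_const_mul hf]
  simp

lemma pd_pow {f : E3 → ℝ} {x : E3} (hf : DifferentiableAt ℝ f x) (n : ℕ)
    (i : Fin 3) : pd (fun y => f y ^ n) i x = n * f x ^ (n - 1) * pd f i x := by
  unfold pd
  rw [fderiv_fun_pow n hf]
  simp

lemma contDiff_pd {f : E3 → ℝ} (hf : Sm f) (i : Fin 3) : Sm (pd f i) := by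
  unfold pd
  have h : ContDiff ℝ ((⊤ : ℕ∞) : WithTop ℕ∞) (fderiv ℝ f) := hf.fderiv_right (by norm_cast)
  exact h.clm_apply contDiff_const

lemma continuous_pd {f : E3 → ℝ} (hf : ContDiff ℝ 1 f) (i : Fin 3) : Continuous (pd f i) := by
  unfold pd
  exact (hf.continuous_fderiv one_ne_zero).clm_apply continuous_const

lemma hcs_pd {f : E3 → ℝ} (hf : HasCompactSupport f) (i : Fin 3) : HasCompactSupport (pd f i) := by
  unfold pd
  exact hf.fderiv_apply (𝕜 := ℝ) _

lemma pd_comm {f : E3 → ℝ} (hf : Sm f) (i j : Fin 3) : pd (pd f i) j = pd (pd f j) i := by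
  funext x
  have hd : DifferentiableAt ℝ (fderiv ℝ f) x := by
    have h : ContDiff ℝ 1 (fderiv ℝ f) := (hf.fderiv_right (m := ((⊤ : ℕ∞) : WithTop ℕ∞)) (by norm_cast)).of_le (by exact_mod_cast le_top)
    exact h.differentiable one_ne_zero x
  have key : ∀ a b : Fin 3, pd (pd f a) b x =
      fderiv ℝ (fderiv ℝ f) x (EuclideanSpace.single b 1) (EuclideanSpace.single a 1) := by
    intro a b
    unfold pd
    rw [fderiv_clm_apply hd (by fun_prop)]
    simp
  rw [key, key]
  have hs : IsSymmSndFDerivAt ℝ f x := by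
    apply (hf.contDiffAt).isSymmSndFDerivAt
    simp only [minSmoothness_of_isRCLikeNormedField]
    exact WithTop.coe_le_coe.2 (le_top : (2 : ℕ∞) ≤ ⊤)
  exact hs.eq _ _

lemma hcs_mul_left {f g : E3 → ℝ} (hf : HasCompactSupport f) :
    HasCompactSupport (fun x => f x * g x) := hf.mul_right

lemma hcs_mul_right {f g : E3 → ℝ} (hg : HasCompactSupport g) :
    HasCompactSupport (fun x => f x * g x) := hg.mul_left

lemma ibp {f g : E3 → ℝ} (hf : ContDiff ℝ 1 f) (hg : ContDiff ℝ 1 g)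
    (hc : HasCompactSupport g) (i : Fin 3) :
    ∫ x, f x * pd g i x = - ∫ x, pd f i x * g x := by
  unfold pd
  apply integral_mul_fderiv_eq_neg_fderiv_mul_of_integrable
  · exact ((continuous_pd hf i).mul hg.continuous).integrable_of_hasCompactSupport (hcs_mul_right hc)
  · exact (hf.continuous.mul (continuous_pd hg i)).integrable_of_hasCompactSupport
      (hcs_mul_right (hcs_pd hc i))
  · exact (hf.continuous.mul hg.continuous).integrable_of_hasCompactSupport (hcs_mul_right hc)
  · exact fun x _ => hf.differentiable one_ne_zero x
  · exact fun x _ => hg.differentiable one_ne_zero x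

/-- `∫ ∂ᵢf ∂ⱼg = ∫ ∂ⱼf ∂ᵢg`. -/
lemma ibp_swap {f g : E3 → ℝ} (hf : Sm f) (hg : Sm g)
    (hc : HasCompactSupport g) (i j : Fin 3) :
    ∫ x, pd f i x * pd g j x = ∫ x, pd f j x * pd g i x := by
  rw [ibp (contDiff_pd hf i).one hg.one hc j, ibp (contDiff_pd hf j).one hg.one hc i, pd_comm hf i j]

lemma norm_pd_le (f : E3 → ℝ) (i : Fin 3) (x : E3) : |pd f i x| ≤ ‖fderiv ℝ f x‖ := by
  unfold pd
  have := (fderiv ℝ f x).le_opNorm (EuclideanSpace.single i 1)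
  simpa using this

lemma norm_fderiv_le_sum (f : E3 → ℝ) (x : E3) : ‖fderiv ℝ f x‖ ≤ ∑ i, |pd f i x| := by
  apply ContinuousLinearMap.opNorm_le_bound _ (Finset.sum_nonneg fun i _ => abs_nonneg _)
  intro v
  have hv : v = ∑ i, v i • (EuclideanSpace.single i (1:ℝ)) := by
    ext j
    simp [Finset.sum_apply, Pi.single_apply]
  conv_lhs => rw [hv]
  rw [map_sum, Finset.sum_mul]
  refine (norm_sum_le _ _).trans (Finset.sum_le_sum fun i _ => ?_)
  rw [map_smul, norm_smul, mul_comm]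
  have : ‖v i‖ ≤ ‖v‖ := PiLp.norm_apply_le v i
  exact mul_le_mul_of_nonneg_left this (norm_nonneg _)

lemma fderiv_eq_zero_of_pd {f : E3 → ℝ} {x : E3} (h : ∀ i, pd f i x = 0) : fderiv ℝ f x = 0 := by
  have := norm_fderiv_le_sum f x
  simp only [h, abs_zero, Finset.sum_const_zero] at this
  exact norm_le_zero_iff.mp this

lemma pd_comp_smul {f : E3 → ℝ} (hf : Differentiable ℝ f) (c : ℝ) (i : Fin 3) (x : E3) :
    pd (fun y => f (c • y)) i x = c * pd f i (c • x) := by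
  unfold pd
  have h1 : HasFDerivAt (fun y : E3 => c • y) (c • ContinuousLinearMap.id ℝ E3) x :=
    (hasFDerivAt_id x).const_smul c
  have h2 := ((hf (c • x)).hasFDerivAt.comp x h1).fderiv
  have h3 : fderiv ℝ (fun y => f (c • y)) x = fderiv ℝ (f ∘ fun y => c • y) x := rfl
  rw [h3, h2]
  simp

lemma pd_comp_add (f : E3 → ℝ) (a : E3) (i : Fin 3) (x : E3) :
    pd (fun y => f (y + a)) i x = pd f i (x + a) := by
  unfold pd
  rw [fderiv_comp_add_right]

/-! ### Cutoffs -/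

def bump0 : ContDiffBump (0 : E3) := ⟨1, 3/2, by norm_num, by norm_num⟩

def cut (R : ℝ) (x : E3) : ℝ := bump0 (R⁻¹ • x)

lemma cut_smooth (R : ℝ) : Sm (cut R) := by
  unfold cut
  exact bump0.contDiff.comp (contDiff_const_smul _)

lemma cut_nonneg (R : ℝ) (x : E3) : 0 ≤ cut R x := bump0.nonneg
lemma cut_le_one (R : ℝ) (x : E3) : cut R x ≤ 1 := bump0.le_one

lemma cut_eq_one {R : ℝ} (hR : 0 < R) {x : E3} (hx : ‖x‖ ≤ R) : cut R x = 1 := by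
  unfold cut
  apply bump0.one_of_mem_closedBall
  have : ‖R⁻¹ • x‖ ≤ 1 := by
    rw [norm_smul, norm_inv, Real.norm_of_nonneg hR.le, inv_mul_le_iff₀ hR]; simpa using hx
  simpa [bump0] using this

lemma cut_eq_zero {R : ℝ} (hR : 0 < R) {x : E3} (hx : 3/2 * R ≤ ‖x‖) : cut R x = 0 := by
  unfold cut
  apply bump0.zero_of_le_dist
  have : 3/2 ≤ ‖R⁻¹ • x‖ := by
    rw [norm_smul, norm_inv, Real.norm_of_nonneg hR.le, le_inv_mul_iff₀ hR]; linarith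
  simpa [bump0] using this

lemma cut_tsupport {R : ℝ} (hR : 0 < R) : tsupport (cut R) ⊆ closedBall 0 (3/2*R) := by
  apply closure_minimal _ isClosed_closedBall
  intro x hx
  by_contra h
  simp only [mem_closedBall, dist_zero_right, not_le] at h
  exact hx (cut_eq_zero hR h.le)

lemma cut_hcs {R : ℝ} (hR : 0 < R) : HasCompactSupport (cut R) :=
  HasCompactSupport.intro (isCompact_closedBall (0:E3) (3/2*R)) (fun x hx => by
    simp only [mem_closedBall, dist_zero_right, not_le] at hx
    exact cut_eq_zero hR hx.le)

lemma bump0_smooth : Sm (bump0 : E3 → ℝ) := bump0.contDiff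

lemma exists_cut_bound : ∃ C : ℝ, 1 ≤ C ∧ (∀ i x, |pd bump0 i x| ≤ C) ∧
    ∀ i j x, |pd (pd bump0 i) j x| ≤ C := by
  have h1 : ∀ i, ∃ C, ∀ x, ‖pd bump0 i x‖ ≤ C := fun i =>
    (continuous_pd bump0_smooth.one i).bounded_above_of_compact_support
      (hcs_pd bump0.hasCompactSupport i)
  have h2 : ∀ i j, ∃ C, ∀ x, ‖pd (pd bump0 i) j x‖ ≤ C := fun i j =>
    (continuous_pd (contDiff_pd bump0_smooth i).one j).bounded_above_of_compact_support
      (hcs_pd (hcs_pd bump0.hasCompactSupport i) j)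
  choose C1 hC1 using h1
  choose C2 hC2 using h2
  refine ⟨1 + ∑ i, |C1 i| + ∑ i, ∑ j, |C2 i j|, ?_, ?_, ?_⟩
  · have : 0 ≤ ∑ i, |C1 i| := Finset.sum_nonneg fun _ _ => abs_nonneg _
    have : 0 ≤ ∑ i, ∑ j, |C2 i j| :=
      Finset.sum_nonneg fun _ _ => Finset.sum_nonneg fun _ _ => abs_nonneg _
    linarith
  · intro i x
    have a1 : |C1 i| ≤ ∑ i, |C1 i| :=
      Finset.single_le_sum (f := fun i => |C1 i|) (fun _ _ => abs_nonneg _) (Finset.mem_univ i)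
    have : 0 ≤ ∑ i, ∑ j, |C2 i j| :=
      Finset.sum_nonneg fun _ _ => Finset.sum_nonneg fun _ _ => abs_nonneg _
    have := hC1 i x
    rw [Real.norm_eq_abs] at this
    have := le_abs_self (C1 i)
    linarith
  · intro i j x
    have : 0 ≤ ∑ i, |C1 i| := Finset.sum_nonneg fun _ _ => abs_nonneg _
    have a1 : |C2 i j| ≤ ∑ j, |C2 i j| :=
      Finset.single_le_sum (f := fun j => |C2 i j|) (fun _ _ => abs_nonneg _) (Finset.mem_univ j)
    have a2 : ∑ j, |C2 i j| ≤ ∑ i, ∑ j, |C2 i j| :=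
      Finset.single_le_sum (f := fun i => ∑ j, |C2 i j|)
        (fun _ _ => Finset.sum_nonneg fun _ _ => abs_nonneg _) (Finset.mem_univ i)
    have := hC2 i j x
    rw [Real.norm_eq_abs] at this
    have := le_abs_self (C2 i j)
    linarith

def Cθ : ℝ := Classical.choose exists_cut_bound
lemma one_le_Cθ : 1 ≤ Cθ := (Classical.choose_spec exists_cut_bound).1
lemma bump0_pd_le (i : Fin 3) (x : E3) : |pd bump0 i x| ≤ Cθ :=
  (Classical.choose_spec exists_cut_bound).2.1 i x
lemma bump0_pd2_le (i j : Fin 3) (x : E3) : |pd (pd bump0 i) j x| ≤ Cθ :=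
  (Classical.choose_spec exists_cut_bound).2.2 i j x

lemma pd_cut (R : ℝ) (i : Fin 3) (x : E3) : pd (cut R) i x = R⁻¹ * pd bump0 i (R⁻¹ • x) :=
  pd_comp_smul (bump0_smooth.one.differentiable one_ne_zero) _ _ _

lemma pd_cut_le {R : ℝ} (hR : 0 < R) (i : Fin 3) (x : E3) : |pd (cut R) i x| ≤ Cθ / R := by
  rw [pd_cut, abs_mul, abs_inv, abs_of_pos hR, div_eq_inv_mul]
  exact mul_le_mul_of_nonneg_left (bump0_pd_le _ _) (by positivity)

lemma pd2_cut_le {R : ℝ} (hR : 0 < R) (i j : Fin 3) (x : E3) :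
    |pd (pd (cut R) i) j x| ≤ Cθ / R ^ 2 := by
  have : pd (cut R) i = fun x => R⁻¹ * pd bump0 i (R⁻¹ • x) := funext (pd_cut R i)
  rw [this, pd_const_mul, pd_comp_smul ((contDiff_pd bump0_smooth i).one.differentiable one_ne_zero),
    ← mul_assoc, abs_mul, abs_of_pos (by positivity)]
  · calc R⁻¹ * R⁻¹ * |pd (pd bump0 i) j (R⁻¹ • x)| ≤ R⁻¹ * R⁻¹ * Cθ :=
        mul_le_mul_of_nonneg_left (bump0_pd2_le _ _ _) (by positivity)
      _ = Cθ / R ^ 2 := by field_simp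
  · have h := (contDiff_pd bump0_smooth i).one.differentiable one_ne_zero
    exact (h.comp (differentiable_id.const_smul R⁻¹)) x

lemma pd_cut_eq_zero_in {R : ℝ} (hR : 0 < R) {x : E3} (hx : ‖x‖ < R) (i : Fin 3) :
    pd (cut R) i x = 0 := by
  have : cut R =ᶠ[𝓝 x] fun _ => 1 := by
    filter_upwards [isOpen_ball.mem_nhds (show x ∈ ball (0:E3) R by simpa using hx)] with y hy
    exact cut_eq_one hR (by simpa using (mem_ball.mp hy).le)
  unfold pd
  rw [this.fderiv_eq]
  simp

lemma pd_cut_eq_zero_out {R : ℝ} (hR : 0 < R) {x : E3} (hx : 3/2*R < ‖x‖) (i : Fin 3) :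
    pd (cut R) i x = 0 := by
  have h : x ∉ tsupport (cut R) := fun h => by
    have := cut_tsupport hR h
    simp only [mem_closedBall, dist_zero_right] at this
    linarith
  unfold pd
  have : fderiv ℝ (cut R) x = 0 := by
    by_contra h2
    exact h (support_fderiv_subset ℝ h2)
  rw [this]; simp

def Ann (R : ℝ) : Set E3 := ball (0 : E3) (2 * R) \ ball (0 : E3) R

lemma measurableSet_Ann (R : ℝ) : MeasurableSet (Ann R) := measurableSet_ball.diff measurableSet_ball

lemma pd_cut_eq_zero {R : ℝ} (hR : 0 < R) {x : E3} (hx : x ∉ Ann R) (i : Fin 3) :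
    pd (cut R) i x = 0 := by
  by_cases h : ‖x‖ < R
  · exact pd_cut_eq_zero_in hR h i
  · apply pd_cut_eq_zero_out hR
    unfold Ann at hx
    simp only [Set.mem_sdiff, mem_ball, dist_zero_right, not_and_or, not_lt] at hx
    push Not at h
    rcases hx with hx | hx
    · linarith
    · exact absurd h hx

/-! ### Sobolev -/

lemma finrankE3 : Module.finrank ℝ E3 = 3 := by simp

lemma sobolev_q {q : ℝ≥0} {q' : ℝ≥0} (hq : 1 ≤ q) (hqq : (q' : ℝ)⁻¹ = (q : ℝ)⁻¹ - 3⁻¹) :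
    ∃ C : ℝ≥0, ∀ f : E3 → ℝ, ContDiff ℝ 1 f → HasCompactSupport f →
      eLpNorm f q' volume ≤ C * ∑ i, eLpNorm (pd f i) q volume := by
  refine ⟨SNormLESNormFDerivOfEqConst ℝ (volume : Measure E3) q, fun f hf hc => ?_⟩
  have h := eLpNorm_le_eLpNorm_fderiv_of_eq (F := ℝ) (volume : Measure E3) hf hc hq
    (by rw [finrankE3]; norm_num) (p' := q') (by rw [finrankE3]; simpa using hqq)
  refine h.trans (mul_le_mul_right ?_ _)
  have h1 : eLpNorm (fderiv ℝ f) q volume ≤ eLpNorm (fun x => ∑ i, |pd f i x|) q volume := by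
    apply eLpNorm_mono
    intro x
    refine (norm_fderiv_le_sum f x).trans (le_abs_self _)
  refine h1.trans ?_
  have h2 : (fun x => ∑ i, |pd f i x|) = ∑ i, (fun x => |pd f i x|) := by
    funext x; simp
  rw [h2]
  refine (eLpNorm_sum_le (fun i _ => ((continuous_pd hf i).abs.aestronglyMeasurable))
    (by exact_mod_cast hq)).trans (le_of_eq ?_)
  refine Finset.sum_congr rfl fun i _ => ?_
  exact eLpNorm_norm (pd f i)

end

noncomputable section

open MeasureTheory Metric Filter Topology Set
open scoped ENNReal NNReal

/-! ### Mollification -/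

lemma tendsto_translate {f : E3 → ℝ} {p : ℝ≥0∞} (hp1 : 1 ≤ p) (hp : p ≠ ∞)
    (hf : MemLp f p volume) :
    Tendsto (fun w : E3 => eLpNorm (fun x => f (x - w) - f x) p volume) (𝓝 0) (𝓝 0) := by
  have : Fact (1 ≤ p) := ⟨hp1⟩
  let F : C(E3 × E3, E3) := ⟨fun q => q.2 - q.1, by fun_prop⟩
  let g : E3 → C(E3, E3) := fun w => F.curry w
  have hg : Tendsto g (𝓝 0) (𝓝 (g 0)) := F.curry.continuous.tendsto 0
  have hgm : ∀ w, MeasurePreserving (g w) (volume : Measure E3) volume := fun w =>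
    measurePreserving_sub_right volume w
  have h := Filter.Tendsto.compMeasurePreservingLp
    (tendsto_const_nhds (x := hf.toLp f)) hg hgm (hgm 0) hp
  rw [tendsto_iff_edist_tendsto_0] at h
  refine h.congr fun w => ?_
  rw [Lp.toLp_compMeasurePreserving, Lp.toLp_compMeasurePreserving, Lp.edist_toLp_toLp]
  congr 1
  funext x
  simp [g, F, Function.comp]

def eta : E3 → ℝ := bump0.normed volume

lemma eta_smooth : Sm eta := bump0.contDiff_normed
lemma eta_nonneg (x : E3) : 0 ≤ eta x := bump0.nonneg_normed x
lemma eta_hcs : HasCompactSupport eta := bump0.hasCompactSupport_normed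
lemma integral_eta : ∫ x, eta x = 1 := bump0.integral_normed
lemma eta_cont : Continuous eta := bump0.continuous_normed
lemma eta_integrable : Integrable eta := eta_cont.integrable_of_hasCompactSupport eta_hcs
lemma eta_zero {z : E3} (hz : 2 ≤ ‖z‖) : eta z = 0 := by
  by_contra h
  have h1 : z ∈ Function.support eta := h
  unfold eta at h1
  rw [bump0.support_normed_eq] at h1
  simp [bump0] at h1
  linarith

lemma lintegral_eta : ∫⁻ z, ENNReal.ofReal (eta z) = 1 := by
  rw [← ofReal_integral_eq_lintegral_ofReal eta_integrable (ae_of_all _ eta_nonneg), integral_eta]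
  simp

def cv (K f : E3 → ℝ) (ε : ℝ) (x : E3) : ℝ := ∫ z, K z * f (x - ε • z)

def avg (f : E3 → ℝ) (ε : ℝ) (x : E3) : ℝ := ∫ z, eta z * f (x - ε • z)

lemma cv_eq_conv (K f : E3 → ℝ) {ε : ℝ} (hε : 0 < ε) (x : E3) :
    cv K f ε x = (ε ^ 3)⁻¹ * ∫ t, f t * K (ε⁻¹ • (x - t)) := by
  unfold cv
  have h := Measure.integral_comp_smul_of_nonneg (volume : Measure E3)
    (fun y => K (ε⁻¹ • y) * f (x - y)) ε (hR := hε.le)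
  simp only [inv_smul_smul₀ hε.ne'] at h
  rw [h, finrankE3, smul_eq_mul]
  congr 1
  rw [← integral_sub_left_eq_self _ volume x]
  congr 1
  funext t
  simp [mul_comm]

lemma cv_smooth {K f : E3 → ℝ} (hK : Sm K) (hKc : HasCompactSupport K)
    (hf : LocallyIntegrable f volume) {ε : ℝ} (hε : 0 < ε) : Sm (cv K f ε) := by
  have : cv K f ε = fun x => (ε ^ 3)⁻¹ *
      (MeasureTheory.convolution f (fun y => K (ε⁻¹ • y)) (ContinuousLinearMap.mul ℝ ℝ) volume) x := by
    funext x
    rw [cv_eq_conv K f hε x]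
    rfl
  rw [this]
  refine contDiff_const.mul ?_
  apply HasCompactSupport.contDiff_convolution_right
  · exact hKc.comp_smul (inv_ne_zero hε.ne')
  · exact hf
  · exact hK.comp (contDiff_const_smul _)

lemma avg_smooth {f : E3 → ℝ} (hf : LocallyIntegrable f volume) {ε : ℝ} (hε : 0 < ε) :
    Sm (avg f ε) := cv_smooth eta_smooth eta_hcs hf hε

lemma cv_integrable {K f : E3 → ℝ} (hK : Continuous K) (hKc : HasCompactSupport K)
    (hf : LocallyIntegrable f volume) {ε : ℝ} (hε : 0 < ε) (x : E3) :
    Integrable (fun z => K z * f (x - ε • z)) volume := by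
  have h1 : Integrable (fun t => f t * K (ε⁻¹ • (x - t))) volume := by
    have := hf.integrable_smul_right_of_hasCompactSupport
      (g := fun t => K (ε⁻¹ • (x - t))) (by fun_prop) ?_
    · simpa [mul_comm] using this
    · have h2 : HasCompactSupport (fun y => K (ε⁻¹ • y)) := hKc.comp_smul (inv_ne_zero hε.ne')
      exact h2.comp_homeomorph (Homeomorph.subLeft x)
  have h2 := (h1.comp_sub_left x).comp_smul hε.ne'
  refine h2.congr (ae_of_all _ fun z => ?_)
  simp [inv_smul_smul₀ hε.ne', mul_comm]

def nuE : Measure E3 := volume.withDensity (fun z => ENNReal.ofReal (eta z))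

instance : IsProbabilityMeasure nuE := ⟨by
  unfold nuE
  rw [withDensity_apply _ MeasurableSet.univ]
  simpa using lintegral_eta⟩

lemma eta_meas : Measurable (fun z => ENNReal.ofReal (eta z)) :=
  ENNReal.measurable_ofReal.comp eta_cont.measurable

lemma jensen {F : E3 → ℝ} (hF : Measurable F) {p : ℝ} (hp : 1 ≤ p) :
    ‖∫ z, eta z * F z‖ₑ ^ p ≤ ∫⁻ z, ENNReal.ofReal (eta z) * ‖F z‖ₑ ^ p := by
  have hp0 : 0 < p := by linarith
  have h1 : ‖∫ z, eta z * F z‖ₑ ≤ ∫⁻ z, ‖F z‖ₑ ∂nuE := by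
    refine (enorm_integral_le_lintegral_enorm _).trans (le_of_eq ?_)
    unfold nuE
    rw [lintegral_withDensity_eq_lintegral_mul _ eta_meas hF.enorm]
    congr 1
    funext z
    simp only [Pi.mul_apply, enorm_mul]
    rw [Real.enorm_eq_ofReal (eta_nonneg z)]
  have h2 : ∫⁻ z, ‖F z‖ₑ ∂nuE ≤ (∫⁻ z, ‖F z‖ₑ ^ p ∂nuE) ^ (1 / p) := by
    have := eLpNorm_le_eLpNorm_of_exponent_le (μ := nuE) (p := 1) (q := ENNReal.ofReal p)
      (by simpa using ENNReal.ofReal_le_ofReal hp) (f := F) hF.aestronglyMeasurable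
    rw [eLpNorm_one_eq_lintegral_enorm, eLpNorm_eq_lintegral_rpow_enorm_toReal (by simpa using hp0)
      ENNReal.ofReal_ne_top, ENNReal.toReal_ofReal hp0.le] at this
    exact this
  calc _ ≤ ((∫⁻ z, ‖F z‖ₑ ^ p ∂nuE) ^ (1 / p)) ^ p := ENNReal.rpow_le_rpow (h1.trans h2) hp0.le
    _ = ∫⁻ z, ‖F z‖ₑ ^ p ∂nuE := by
      rw [← ENNReal.rpow_mul, one_div_mul_cancel hp0.ne', ENNReal.rpow_one]
    _ = _ := by
      unfold nuE
      rw [lintegral_withDensity_eq_lintegral_mul _ eta_meas (hF.enorm.pow_const p)]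
      rfl

lemma jensen_int {Ψ : E3 → E3 → ℝ} (hΨ : Measurable (Function.uncurry Ψ)) {p : ℝ} (hp : 1 ≤ p) :
    ∫⁻ x, ‖∫ z, eta z * Ψ x z‖ₑ ^ p ≤
      ∫⁻ z, ENNReal.ofReal (eta z) * ∫⁻ x, ‖Ψ x z‖ₑ ^ p := by
  calc _ ≤ ∫⁻ x, ∫⁻ z, ENNReal.ofReal (eta z) * ‖Ψ x z‖ₑ ^ p :=
        lintegral_mono fun x => jensen (hΨ.comp measurable_prodMk_left) hp
    _ = ∫⁻ z, ∫⁻ x, ENNReal.ofReal (eta z) * ‖Ψ x z‖ₑ ^ p := by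
        rw [lintegral_lintegral_swap]
        exact ((eta_meas.comp measurable_snd).mul (hΨ.enorm.pow_const p)).aemeasurable
    _ = _ := by
        congr 1
        funext z
        rw [lintegral_const_mul]
        exact ((hΨ.comp measurable_prodMk_right).enorm.pow_const p)

lemma measurable_shift {f : E3 → ℝ} (hf : Measurable f) (ε : ℝ) :
    Measurable (Function.uncurry fun (x z : E3) => f (x - ε • z)) := by
  unfold Function.uncurry
  exact hf.comp (by fun_prop)

lemma avg_lint_le {f : E3 → ℝ} (hf : Measurable f) (ε : ℝ) {p : ℝ} (hp : 1 ≤ p) :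
    ∫⁻ x, ‖avg f ε x‖ₑ ^ p ≤ ∫⁻ x, ‖f x‖ₑ ^ p := by
  unfold avg
  refine (jensen_int (measurable_shift hf ε) hp).trans (le_of_eq ?_)
  have : ∀ z : E3, ∫⁻ x, ‖f (x - ε • z)‖ₑ ^ p = ∫⁻ x, ‖f x‖ₑ ^ p := fun z =>
    lintegral_sub_right_eq_self (fun x => ‖f x‖ₑ ^ p) (ε • z)
  simp only [this]
  rw [lintegral_mul_const _ eta_meas, lintegral_eta, one_mul]

lemma avg_eLpNorm_le {f : E3 → ℝ} (hf : Measurable f) (ε : ℝ) {p : ℝ} (hp : 1 ≤ p) :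
    eLpNorm (avg f ε) (ENNReal.ofReal p) volume ≤ eLpNorm f (ENNReal.ofReal p) volume := by
  have hp0 : 0 < p := by linarith
  rw [eLpNorm_eq_lintegral_rpow_enorm_toReal (by simpa using hp0) ENNReal.ofReal_ne_top,
    eLpNorm_eq_lintegral_rpow_enorm_toReal (by simpa using hp0) ENNReal.ofReal_ne_top,
    ENNReal.toReal_ofReal hp0.le]
  exact ENNReal.rpow_le_rpow (avg_lint_le hf ε hp) (by positivity)

lemma avg_tendsto {f : E3 → ℝ} (hf : Measurable f) (hfl : LocallyIntegrable f volume)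
    {p : ℝ} (hp : 1 ≤ p) (hfp : MemLp f (ENNReal.ofReal p) volume) {e : ℕ → ℝ} (he : ∀ n, 0 < e n)
    (he0 : Tendsto e atTop (𝓝 0)) :
    Tendsto (fun n => eLpNorm (fun x => avg f (e n) x - f x) (ENNReal.ofReal p) volume) atTop (𝓝 0) := by
  have hp0 : 0 < p := by linarith
  have hpn : ENNReal.ofReal p ≠ 0 := by simpa using hp0
  have hexp : ∀ g : E3 → ℝ, eLpNorm g (ENNReal.ofReal p) volume = (∫⁻ x, ‖g x‖ₑ ^ p) ^ (1 / p) := by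
    intro g
    rw [eLpNorm_eq_lintegral_rpow_enorm_toReal hpn ENNReal.ofReal_ne_top,
      ENNReal.toReal_ofReal hp0.le]
  have hexp' : ∀ g : E3 → ℝ, ∫⁻ x, ‖g x‖ₑ ^ p = eLpNorm g (ENNReal.ofReal p) volume ^ p := by
    intro g
    rw [hexp, ← ENNReal.rpow_mul, one_div_mul_cancel hp0.ne', ENNReal.rpow_one]
  have hcont : ∀ z : E3, Tendsto (fun n => e n • z) atTop (𝓝 0) := fun z => by
    simpa using he0.smul_const z
  set B := (2 * eLpNorm f (ENNReal.ofReal p) volume) ^ p with hB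
  have hBtop : B ≠ ∞ := by
    apply ENNReal.rpow_ne_top_of_nonneg hp0.le
    exact ENNReal.mul_ne_top (by simp) hfp.2.ne
  have hmain : Tendsto (fun n => ∫⁻ z, ENNReal.ofReal (eta z) *
      ∫⁻ x, ‖f (x - e n • z) - f x‖ₑ ^ p) atTop (𝓝 (∫⁻ z : E3, 0)) := by
    apply tendsto_lintegral_of_dominated_convergence (fun z => ENNReal.ofReal (eta z) * B)
    · intro n
      refine eta_meas.mul ?_
      apply Measurable.lintegral_prod_left' (f := fun q : E3 × E3 => ‖f (q.1 - e n • q.2) - f q.1‖ₑ ^ p)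
      have h1 : Measurable fun q : E3 × E3 => f (q.1 - e n • q.2) := measurable_shift hf (e n)
      exact (h1.sub (hf.comp measurable_fst)).enorm.pow_const p
    · intro n
      refine ae_of_all _ fun z => ?_
      simp only
      gcongr
      rw [hexp', hB]
      gcongr
      have h1 : MeasurePreserving (fun x : E3 => x - e n • z) volume volume :=
        measurePreserving_sub_right volume _
      have h2 := eLpNorm_comp_measurePreserving (p := ENNReal.ofReal p) hfp.1 h1
      have h3 := eLpNorm_sub_le (p := ENNReal.ofReal p) (hfp.1.comp_measurePreserving h1) hfp.1
        (by simpa using ENNReal.ofReal_le_ofReal hp)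
      rw [h2, ← two_mul] at h3
      exact h3
    · rw [lintegral_mul_const _ eta_meas, lintegral_eta, one_mul]; exact hBtop
    · refine ae_of_all _ fun z => ?_
      have h1 := (tendsto_translate (by simpa using ENNReal.ofReal_le_ofReal hp)
        ENNReal.ofReal_ne_top hfp).comp (hcont z)
      have h2 := (ENNReal.continuous_rpow_const (y := p)).tendsto _ |>.comp h1
      have h3 := ENNReal.Tendsto.const_mul h2 (a := ENNReal.ofReal (eta z)) (Or.inr ENNReal.ofReal_ne_top)
      rw [ENNReal.zero_rpow_of_pos hp0, mul_zero] at h3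
      refine h3.congr fun n => ?_
      simp only [Function.comp, hexp']
  have hle : ∀ n, ∫⁻ x, ‖avg f (e n) x - f x‖ₑ ^ p ≤
      ∫⁻ z, ENNReal.ofReal (eta z) * ∫⁻ x, ‖f (x - e n • z) - f x‖ₑ ^ p := by
    intro n
    have h1 : Measurable (Function.uncurry fun (x z : E3) => f (x - e n • z) - f x) :=
      (measurable_shift hf (e n)).sub (hf.comp measurable_fst)
    refine le_trans (le_of_eq ?_) (jensen_int h1 hp)
    congr 1
    funext x
    congr 2
    unfold avg
    simp only [mul_sub]
    rw [integral_sub (cv_integrable eta_cont eta_hcs hfl (he n) x) (eta_integrable.mul_const _),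
      integral_mul_const, integral_eta, one_mul]
  rw [lintegral_zero] at hmain
  have h4 := tendsto_of_tendsto_of_tendsto_of_le_of_le tendsto_const_nhds hmain
    (fun n => zero_le) hle
  have h5 := (ENNReal.continuous_rpow_const (y := 1 / p)).tendsto _ |>.comp h4
  rw [ENNReal.zero_rpow_of_pos (by positivity)] at h5
  refine h5.congr fun n => ?_
  simp only [Function.comp, hexp]

lemma cv_prod_integrable {K f g : E3 → ℝ} (hK : Continuous K) (hKc : HasCompactSupport K)
    (hfm : Measurable f) (hf : LocallyIntegrable f volume)
    (hg : Continuous g) (hgc : HasCompactSupport g) {ε : ℝ} :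
    Integrable (Function.uncurry fun (x z : E3) => K z * f (x - ε • z) * g x)
      (volume.prod volume) := by
  have hm : Measurable (Function.uncurry fun (x z : E3) => K z * f (x - ε • z) * g x) :=
    ((hK.measurable.comp measurable_snd).mul (measurable_shift hfm ε)).mul
      (hg.measurable.comp measurable_fst)
  refine (integrable_prod_iff' hm.aestronglyMeasurable).mpr ⟨ae_of_all _ fun z => ?_, ?_⟩
  · have h1 : Integrable (fun x => f x * g (x + ε • z)) volume := by
      have := hf.integrable_smul_right_of_hasCompactSupport
        (g := fun x => g (x + ε • z)) (by fun_prop) (hgc.comp_homeomorph (Homeomorph.addRight _))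
      simpa [mul_comm] using this
    have h2 := (h1.comp_sub_right (ε • z)).const_mul (K z)
    refine h2.congr (ae_of_all _ fun x => ?_)
    simp [Function.uncurry, mul_assoc]
  · obtain ⟨Cg, hCg⟩ := hg.bounded_above_of_compact_support hgc
    obtain ⟨rK, hrK⟩ := hKc.isCompact.isBounded.subset_closedBall (0 : E3)
    obtain ⟨rg, hrg⟩ := hgc.isCompact.isBounded.subset_closedBall (0 : E3)
    set B := closedBall (0 : E3) (rg + |ε| * rK) with hB
    have hBi : IntegrableOn f B volume := hf.integrableOn_isCompact (isCompact_closedBall _ _)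
    have hKi : Integrable K := hK.integrable_of_hasCompactSupport hKc
    refine Integrable.mono' (g := fun z => ‖K z‖ * (Cg * ∫ x in B, ‖f x‖)) (hKi.norm.mul_const _) ?_ ?_
    · exact (hm.norm.aestronglyMeasurable.prod_swap.integral_prod_right')
    · refine ae_of_all _ fun z => ?_
      rw [Real.norm_of_nonneg (integral_nonneg fun _ => norm_nonneg _)]
      simp only [Function.uncurry, norm_mul, mul_assoc]
      rw [integral_const_mul]
      by_cases hz : K z = 0
      · simp [hz]
      have hz' : ‖z‖ ≤ rK := by simpa using hrK (subset_tsupport K hz)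
      refine mul_le_mul_of_nonneg_left ?_ (norm_nonneg _)
      have e1 : ∫ x, ‖f (x - ε • z)‖ * ‖g x‖ = ∫ x, ‖f x‖ * ‖g (x + ε • z)‖ := by
        rw [← integral_sub_right_eq_self (fun x => ‖f x‖ * ‖g (x + ε • z)‖) (ε • z)]
        simp
      rw [e1, ← integral_const_mul, ← integral_indicator measurableSet_closedBall]
      apply integral_mono_of_nonneg
      · exact ae_of_all _ fun x => by positivity
      · rw [integrable_indicator_iff measurableSet_closedBall]
        exact hBi.norm.const_mul _
      · refine ae_of_all _ fun x => ?_
        simp only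
        by_cases hx : x ∈ B
        · rw [indicator_of_mem hx, mul_comm]
          exact mul_le_mul_of_nonneg_right (hCg _) (norm_nonneg _)
        · rw [indicator_of_notMem hx]
          have : g (x + ε • z) = 0 := by
            by_contra hne
            have h3 : ‖x + ε • z‖ ≤ rg := by simpa using hrg (subset_tsupport g hne)
            apply hx
            simp only [hB, mem_closedBall, dist_zero_right]
            calc ‖x‖ = ‖(x + ε • z) - ε • z‖ := by simp
              _ ≤ ‖x + ε • z‖ + ‖ε • z‖ := norm_sub_le _ _
              _ ≤ _ := by
                rw [norm_smul, Real.norm_eq_abs]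
                gcongr
          simp [this]
/-- Fubini for mollification. -/
lemma cv_fubini {K f g : E3 → ℝ} (hK : Continuous K) (hKc : HasCompactSupport K)
    (hfm : Measurable f) (hf : LocallyIntegrable f volume)
    (hg : Continuous g) (hgc : HasCompactSupport g) {ε : ℝ} :
    ∫ x, cv K f ε x * g x = ∫ z, K z * ∫ x, f x * g (x + ε • z) := by
  have hIntg := cv_prod_integrable hK hKc hfm hf hg hgc (ε := ε)
  calc ∫ x, cv K f ε x * g x = ∫ x, ∫ z, K z * f (x - ε • z) * g x := by
        congr 1; funext x; unfold cv; rw [integral_mul_const]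
    _ = ∫ z, ∫ x, K z * f (x - ε • z) * g x := integral_integral_swap hIntg
    _ = _ := by
        congr 1; funext z
        simp only [mul_assoc]
        rw [integral_const_mul]
        congr 1
        rw [← integral_sub_right_eq_self (fun x => f x * g (x + ε • z)) (ε • z)]
        simp

lemma cv_z_integrable {K f g : E3 → ℝ} (hK : Continuous K) (hKc : HasCompactSupport K)
    (hfm : Measurable f) (hf : LocallyIntegrable f volume)
    (hg : Continuous g) (hgc : HasCompactSupport g) {ε : ℝ} :
    Integrable (fun z => K z * ∫ x, f x * g (x + ε • z)) volume := by
  have hIntg := (cv_prod_integrable hK hKc hfm hf hg hgc (ε := ε)).integral_prod_right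
  refine hIntg.congr (ae_of_all _ fun z => ?_)
  simp only [Function.uncurry, mul_assoc]
  rw [integral_const_mul]
  congr 1
  rw [← integral_sub_right_eq_self (fun x => f x * g (x + ε • z)) (ε • z)]
  simp

end

noncomputable section

open MeasureTheory Metric Filter Topology Set
open scoped ENNReal NNReal

/-! ### L² duality with Laplacians -/

def lap (ψ : E3 → ℝ) (x : E3) : ℝ := ∑ i, pd (pd ψ i) i x

lemma lap_smooth {ψ : E3 → ℝ} (h : Sm ψ) : Sm (lap ψ) := by
  unfold lap
  exact ContDiff.sum fun i _ => contDiff_pd (contDiff_pd h i) i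

lemma lap_hcs {ψ : E3 → ℝ} (h : HasCompactSupport ψ) : HasCompactSupport (lap ψ) := by
  apply h.mono'
  intro x hx
  by_contra hne
  apply hx
  unfold lap
  apply Finset.sum_eq_zero
  intro i _
  have h1 : tsupport (pd (pd ψ i) i) ⊆ tsupport ψ := by
    refine (tsupport_fderiv_apply_subset (𝕜 := ℝ) (f := pd ψ i) (EuclideanSpace.single i 1)).trans ?_
    exact tsupport_fderiv_apply_subset (𝕜 := ℝ) (f := ψ) (EuclideanSpace.single i 1)
  exact image_eq_zero_of_notMem_tsupport fun h2 => hne (h1 h2)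

lemma lap_comp_add {ψ : E3 → ℝ} (a x : E3) : lap (fun y => ψ (y + a)) x = lap ψ (x + a) := by
  unfold lap
  congr 1
  funext i
  have : pd (fun y => ψ (y + a)) i = fun y => pd ψ i (y + a) := funext fun y => pd_comp_add ψ a i y
  rw [this, pd_comp_add]

lemma ibp_lap {f g : E3 → ℝ} (hf : Sm f) (hg : Sm g) (hc : HasCompactSupport g) :
    ∫ x, f x * lap g x = - ∑ i, ∫ x, pd f i x * pd g i x := by
  unfold lap
  simp only [Finset.mul_sum]
  rw [integral_finsetSum, ← Finset.sum_neg_distrib]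
  · refine Finset.sum_congr rfl fun i _ => ?_
    exact ibp hf.one (contDiff_pd hg i).one (hcs_pd hc i) i
  · intro i _
    exact (hf.continuous.mul (contDiff_pd (contDiff_pd hg i) i).continuous).integrable_of_hasCompactSupport
      (hcs_mul_right (hcs_pd (hcs_pd hc i) i))

/-- Caccioppoli for a smooth weakly harmonic function. -/
lemma caccioppoli {J : E3 → ℝ} (hJ : Sm J) (hJ2 : MemLp J 2 volume)
    (h : ∀ ψ, Sm ψ → HasCompactSupport ψ → ∫ x, J x * lap ψ x = 0) {R : ℝ} (hR : 0 < R) (k : Fin 3) :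
    ∫ x, cut R x * pd J k x ^ 2 ≤ 3 * Cθ / R ^ 2 * ∫ x, J x ^ 2 := by
  set θ := cut R with hθ
  have hθs : Sm θ := cut_smooth R
  have hθc : HasCompactSupport θ := cut_hcs hR
  have hdJ : ∀ x, DifferentiableAt ℝ J x := fun x => hJ.one.differentiable one_ne_zero x
  have hdθ : ∀ x, DifferentiableAt ℝ θ x := fun x => hθs.one.differentiable one_ne_zero x
  have h0 := h (fun x => θ x * J x) (hθs.mul hJ) (hcs_mul_left hθc)
  rw [ibp_lap hJ (hθs.mul hJ) (hcs_mul_left hθc)] at h0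
  have hi1 : ∀ i, Integrable (fun x => θ x * pd J i x ^ 2) := fun i =>
    (hθs.continuous.mul ((contDiff_pd hJ i).continuous.pow 2)).integrable_of_hasCompactSupport
      (hcs_mul_left hθc)
  have hi2 : ∀ i, Integrable (fun x => J x * pd J i x * pd θ i x) := fun i =>
    ((hJ.continuous.mul (contDiff_pd hJ i).continuous).mul
      (contDiff_pd hθs i).continuous).integrable_of_hasCompactSupport (hcs_mul_right (hcs_pd hθc i))
  have h1 : ∀ i, ∫ x, pd J i x * pd (fun x => θ x * J x) i x =
      (∫ x, θ x * pd J i x ^ 2) + ∫ x, J x * pd J i x * pd θ i x := by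
    intro i
    rw [← integral_add (hi1 i) (hi2 i)]
    congr 1; funext x
    rw [pd_mul (hdθ x) (hdJ x)]
    ring
  have h2 : ∑ i, ∫ x, J x * pd J i x * pd θ i x = - (1/2) * ∫ x, J x ^ 2 * lap θ x := by
    rw [ibp_lap (hJ.pow 2) hθs hθc, neg_mul_neg, Finset.mul_sum]
    refine Finset.sum_congr rfl fun i _ => ?_
    rw [← integral_const_mul]
    congr 1; funext x
    rw [pd_pow (hdJ x)]
    push_cast
    ring
  simp only [h1, Finset.sum_add_distrib, h2] at h0
  have h3 : ∫ x, J x ^ 2 * lap θ x ≤ 3 * Cθ / R ^ 2 * ∫ x, J x ^ 2 := by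
    rw [← integral_const_mul]
    apply integral_mono
    · exact ((hJ.continuous.pow 2).mul (lap_smooth hθs).continuous).integrable_of_hasCompactSupport
        (hcs_mul_right (lap_hcs hθc))
    · exact hJ2.integrable_sq.const_mul _
    · intro x
      simp only
      rw [mul_comm]
      apply mul_le_mul_of_nonneg_right _ (sq_nonneg _)
      have : ∀ i, pd (pd θ i) i x ≤ Cθ / R ^ 2 := fun i => (le_abs_self _).trans (pd2_cut_le hR i i x)
      unfold lap
      rw [Fin.sum_univ_three]
      have a0 := this 0; have a1 := this 1; have a2 := this 2
      have e : 3 * Cθ / R ^ 2 = Cθ / R ^ 2 + Cθ / R ^ 2 + Cθ / R ^ 2 := by ring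
      linarith
  have hnn : ∀ i, 0 ≤ ∫ x, θ x * pd J i x ^ 2 := fun i =>
    integral_nonneg fun x => mul_nonneg (cut_nonneg R x) (sq_nonneg _)
  have h4 : ∫ x, θ x * pd J k x ^ 2 ≤ ∑ i, ∫ x, θ x * pd J i x ^ 2 :=
    Finset.single_le_sum (f := fun i => ∫ x, θ x * pd J i x ^ 2) (fun i _ => hnn i) (Finset.mem_univ k)
  have h5 : 0 ≤ ∫ x, θ x * pd J k x ^ 2 := hnn k
  linarith

lemma smooth_harmonic_zero {J : E3 → ℝ} (hJ : Sm J) (hJ2 : MemLp J 2 volume)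
    (h : ∀ ψ, Sm ψ → HasCompactSupport ψ → ∫ x, J x * lap ψ x = 0) : J = 0 := by
  have hpd : ∀ i x, pd J i x = 0 := by
    intro i x
    by_contra hne
    set r := ‖x‖ + 1 with hr
    have hr0 : 0 < r := by positivity
    have hc : Continuous fun y => cut r y * pd J i y ^ 2 :=
      (cut_smooth r).continuous.mul ((contDiff_pd hJ i).continuous.pow 2)
    have hcc : HasCompactSupport fun y => cut r y * pd J i y ^ 2 := hcs_mul_left (cut_hcs hr0)
    have hpos : 0 < ∫ y, cut r y * pd J i y ^ 2 := by
      apply hc.integral_pos_of_hasCompactSupport_nonneg_nonzero hcc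
      · exact fun y => mul_nonneg (cut_nonneg _ _) (sq_nonneg _)
      · show cut r x * pd J i x ^ 2 ≠ 0
        rw [cut_eq_one hr0 (by rw [hr]; linarith)]
        simpa using hne
    have hb : ∀ R, 3/2 * r ≤ R → ∫ y, cut r y * pd J i y ^ 2 ≤ 3 * Cθ / R ^ 2 * ∫ x, J x ^ 2 := by
      intro R hR
      have hR0 : 0 < R := by linarith
      refine le_trans ?_ (caccioppoli hJ hJ2 h hR0 i)
      apply integral_mono (hc.integrable_of_hasCompactSupport hcc)
      · exact ((cut_smooth R).continuous.mul
          ((contDiff_pd hJ i).continuous.pow 2)).integrable_of_hasCompactSupport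
          (hcs_mul_left (cut_hcs hR0))
      · intro y
        apply mul_le_mul_of_nonneg_right _ (sq_nonneg _)
        by_cases hy : ‖y‖ ≤ R
        · rw [cut_eq_one hR0 hy]; exact cut_le_one _ _
        · rw [cut_eq_zero hr0 (by linarith)]; exact cut_nonneg _ _
    have hlim : Tendsto (fun R : ℝ => 3 * Cθ / R ^ 2 * ∫ x, J x ^ 2) atTop (𝓝 0) := by
      have : Tendsto (fun R : ℝ => 3 * Cθ / R ^ 2) atTop (𝓝 0) :=
        tendsto_const_nhds.div_atTop (tendsto_pow_atTop two_ne_zero)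
      simpa using this.mul_const (∫ x, J x ^ 2)
    have := ge_of_tendsto hlim ((eventually_ge_atTop (3/2 * r)).mono hb)
    linarith
  have hconst : ∀ x y, J x = J y := fun x y =>
    is_const_of_fderiv_eq_zero (hJ.one.differentiable one_ne_zero)
      (fun x => fderiv_eq_zero_of_pd fun i => hpd i x) x y
  have : J = fun _ => J 0 := funext fun x => hconst x 0
  rw [this] at hJ2
  rw [memLp_const_iff (by norm_num) (by norm_num)] at hJ2
  rcases hJ2 with h0 | h0
  · rw [this, h0]; rfl
  · exact absurd h0 (by simp [measure_univ_of_isAddLeftInvariant])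

def eseq (n : ℕ) : ℝ := 1 / ((n : ℝ) + 1)
lemma eseq_pos (n : ℕ) : 0 < eseq n := by unfold eseq; positivity
lemma eseq_le (n : ℕ) : eseq n ≤ 1 := by
  unfold eseq
  rw [div_le_one (by positivity)]
  have : (0:ℝ) ≤ n := n.cast_nonneg
  linarith
lemma eseq_tendsto : Tendsto eseq atTop (𝓝 0) := tendsto_one_div_add_atTop_nhds_zero_nat

lemma weakly_harmonic_zero {H : E3 → ℝ} (hHm : Measurable H) (hH : MemLp H 2 volume)
    (h : ∀ ψ, Sm ψ → HasCompactSupport ψ → ∫ x, H x * lap ψ x = 0) : H =ᵐ[volume] 0 := by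
  have hloc : LocallyIntegrable H volume := hH.locallyIntegrable (by norm_num)
  have h2 : ENNReal.ofReal 2 = 2 := by norm_num
  have hz : ∀ n, avg H (eseq n) = 0 := by
    intro n
    apply smooth_harmonic_zero (avg_smooth hloc (eseq_pos n))
    · refine ⟨(avg_smooth hloc (eseq_pos n)).continuous.aestronglyMeasurable, ?_⟩
      have := avg_eLpNorm_le hHm (eseq n) (p := 2) (by norm_num)
      rw [h2] at this
      exact this.trans_lt hH.2
    · intro ψ hψ hψc
      have := cv_fubini eta_cont eta_hcs hHm hloc (lap_smooth hψ).continuous (lap_hcs hψc)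
        (ε := eseq n)
      rw [show (∫ x, avg H (eseq n) x * lap ψ x) = ∫ x, cv eta H (eseq n) x * lap ψ x from rfl, this]
      have h0 : ∀ z : E3, ∫ x, H x * lap ψ (x + eseq n • z) = 0 := by
        intro z
        have := h (fun y => ψ (y + eseq n • z)) (hψ.comp (contDiff_id.add contDiff_const))
          (hψc.comp_homeomorph (Homeomorph.addRight (eseq n • z)))
        simpa only [lap_comp_add] using this
      simp [h0]
  have ht := avg_tendsto hHm hloc (p := 2) (by norm_num) (by rw [h2]; exact hH) eseq_pos eseq_tendsto
  simp only [hz, Pi.zero_apply, zero_sub] at ht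
  have h3 := tendsto_nhds_unique ht tendsto_const_nhds
  have h4 : eLpNorm H 2 volume = 0 := by
    have h5 : eLpNorm (-H) (ENNReal.ofReal 2) volume = 0 := h3.symm
    rwa [eLpNorm_neg, h2] at h5
  exact (eLpNorm_eq_zero_iff hH.1 (by norm_num)).mp h4

/-- Duality: L² norm controlled by pairing with Laplacians of test functions. -/
lemma dual_lap {P : E3 → ℝ} (hP : MemLp P 2 volume) {A : ℝ} (hA : 0 ≤ A)
    (h : ∀ ψ, Sm ψ → HasCompactSupport ψ →
      |∫ x, P x * lap ψ x| ≤ A * (eLpNorm (lap ψ) 2 volume).toReal) :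
    (eLpNorm P 2 volume).toReal ≤ A := by
  have hml : ∀ ψ, Sm ψ → HasCompactSupport ψ → MemLp (lap ψ) 2 volume := fun ψ h1 h2 =>
    (lap_smooth h1).continuous.memLp_of_hasCompactSupport (lap_hcs h2)
  have hlap_add : ∀ ψ₁ ψ₂, Sm ψ₁ → Sm ψ₂ → lap (fun x => ψ₁ x + ψ₂ x) = fun x => lap ψ₁ x + lap ψ₂ x := by
    intro a b ha hb
    funext x
    unfold lap
    rw [← Finset.sum_add_distrib]
    refine Finset.sum_congr rfl fun i _ => ?_
    have : pd (fun x => a x + b x) i = fun x => pd a i x + pd b i x := funext fun x =>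
      pd_add (ha.one.differentiable one_ne_zero x) (hb.one.differentiable one_ne_zero x) i
    rw [this, pd_add ((contDiff_pd ha i).one.differentiable one_ne_zero x)
      ((contDiff_pd hb i).one.differentiable one_ne_zero x)]
  have hlap_smul : ∀ (c : ℝ) ψ, Sm ψ → lap (fun x => c * ψ x) = fun x => c * lap ψ x := by
    intro c a ha
    funext x
    unfold lap
    rw [Finset.mul_sum]
    refine Finset.sum_congr rfl fun i _ => ?_
    have : pd (fun x => c * a x) i = fun x => c * pd a i x := funext fun x =>
      pd_const_mul c (ha.one.differentiable one_ne_zero x) i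
    rw [this, pd_const_mul c ((contDiff_pd ha i).one.differentiable one_ne_zero x)]
  let V : Submodule ℝ (Lp ℝ 2 (volume : Measure E3)) :=
    { carrier := {v | ∃ ψ, ∃ (h1 : Sm ψ) (h2 : HasCompactSupport ψ), v = (hml ψ h1 h2).toLp _}
      add_mem' := by
        rintro _ _ ⟨a, ha, hac, rfl⟩ ⟨b, hb, hbc, rfl⟩
        refine ⟨fun x => a x + b x, ha.add hb, hac.add hbc, ?_⟩
        rw [← MemLp.toLp_add]
        congr 1
        rw [hlap_add a b ha hb]; rfl
      zero_mem' := by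
        refine ⟨fun _ => 0, contDiff_const, HasCompactSupport.zero, ?_⟩
        symm
        rw [Lp.eq_zero_iff_ae_eq_zero]
        refine (MemLp.coeFn_toLp _).trans (ae_of_all _ fun x => ?_)
        unfold lap pd
        simp
      smul_mem' := by
        rintro c _ ⟨a, ha, hac, rfl⟩
        refine ⟨fun x => c * a x, contDiff_const.mul ha, hcs_mul_right hac, ?_⟩
        rw [← MemLp.toLp_const_smul]
        congr 1
        rw [hlap_smul c a ha]; rfl }
  have hinner : ∀ (v : Lp ℝ 2 (volume : Measure E3)) ψ (h1 : Sm ψ) (h2 : HasCompactSupport ψ),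
      inner ℝ ((hml ψ h1 h2).toLp _) v = ∫ x, v x * lap ψ x := by
    intro v ψ h1 h2
    rw [L2.inner_def]
    apply integral_congr_ae
    filter_upwards [(hml ψ h1 h2).coeFn_toLp] with x hx
    rw [hx]; simp
  have hperp : Vᗮ = ⊥ := by
    rw [Submodule.eq_bot_iff]
    intro H hH
    rw [Submodule.mem_orthogonal] at hH
    rw [Lp.eq_zero_iff_ae_eq_zero]
    apply weakly_harmonic_zero (Lp.stronglyMeasurable H).measurable (Lp.memLp H)
    intro ψ h1 h2
    rw [← hinner H ψ h1 h2]
    exact hH _ ⟨ψ, h1, h2, rfl⟩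
  have hdense : V.topologicalClosure = ⊤ := by
    rwa [Submodule.topologicalClosure_eq_top_iff]
  set Q := hP.toLp P with hQ
  have hall : ∀ v : Lp ℝ 2 (volume : Measure E3), inner ℝ v Q ≤ A * ‖v‖ := by
    intro v
    have hv : v ∈ closure (V : Set (Lp ℝ 2 (volume : Measure E3))) := by
      rw [← Submodule.topologicalClosure_coe, hdense]; trivial
    have hclosed : IsClosed {v : Lp ℝ 2 (volume : Measure E3) | inner ℝ v Q ≤ A * ‖v‖} :=
      isClosed_le (by fun_prop) (by fun_prop)
    refine closure_minimal ?_ hclosed hv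
    rintro _ ⟨ψ, h1, h2, rfl⟩
    show inner ℝ ((hml ψ h1 h2).toLp _) Q ≤ A * ‖(hml ψ h1 h2).toLp _‖
    rw [hinner _ _ h1 h2, Lp.norm_toLp]
    refine le_trans (le_of_eq ?_) ((le_abs_self _).trans (h ψ h1 h2))
    apply integral_congr_ae
    filter_upwards [hP.coeFn_toLp] with x hx
    rw [hx]
  have := hall Q
  rw [real_inner_self_eq_norm_mul_norm] at this
  rw [← Lp.norm_toLp P hP, ← hQ]
  by_cases h0 : ‖Q‖ = 0
  · rw [h0]
    exact hA
  · have hpos : 0 < ‖Q‖ := lt_of_le_of_ne (norm_nonneg _) (Ne.symm h0)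
    exact le_of_mul_le_mul_right this hpos

end

noncomputable section

open MeasureTheory Metric Filter Topology Set
open scoped ENNReal NNReal

/-! ### Norm shorthand and the local pressure estimate -/

abbrev nr (r : ℝ) (f : E3 → ℝ) : ℝ≥0∞ := eLpNorm f (ENNReal.ofReal r) volume

lemma nr_eq {r : ℝ} (hr : 0 < r) (f : E3 → ℝ) : nr r f = (∫⁻ x, ‖f x‖ₑ ^ r) ^ (1 / r) := by
  unfold nr
  rw [eLpNorm_eq_lintegral_rpow_enorm_toReal (by simpa using hr) ENNReal.ofReal_ne_top,
      ENNReal.toReal_ofReal hr.le]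

lemma nr_two (f : E3 → ℝ) : nr 2 f = eLpNorm f 2 volume := by
  unfold nr; rw [ENNReal.ofReal_ofNat]

lemma nr_rpow {r : ℝ} (hr : 0 < r) (f : E3 → ℝ) : nr r f ^ r = ∫⁻ x, ‖f x‖ₑ ^ r := by
  rw [nr_eq hr, ← ENNReal.rpow_mul, one_div_mul_cancel hr.ne', ENNReal.rpow_one]

lemma nr_mono {r : ℝ} {f g : E3 → ℝ} (h : ∀ x, |f x| ≤ |g x|) : nr r f ≤ nr r g :=
  eLpNorm_mono h

lemma nr_le_mul {r : ℝ} {f g : E3 → ℝ} {c : ℝ} (h : ∀ x, |f x| ≤ c * |g x|) :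
    nr r f ≤ ENNReal.ofReal c * nr r g :=
  eLpNorm_le_mul_eLpNorm_of_ae_le_mul (ae_of_all _ h) _

lemma nr_add {r : ℝ} (hr : 1 ≤ r) {f g : E3 → ℝ} (hf : Measurable f) (hg : Measurable g) :
    nr r (fun x => f x + g x) ≤ nr r f + nr r g :=
  eLpNorm_add_le hf.aestronglyMeasurable hg.aestronglyMeasurable
    (by simpa using ENNReal.ofReal_le_ofReal hr)

lemma holder2_lint {a b : ℝ} (hab : a.HolderConjugate b) {f g : E3 → ℝ} (hf : Measurable f)
    (hg : Measurable g) : ∫⁻ x, ‖f x‖ₑ * ‖g x‖ₑ ≤ nr a f * nr b g := by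
  rw [nr_eq hab.pos, nr_eq hab.symm.pos]
  exact ENNReal.lintegral_mul_le_Lp_mul_Lq volume hab hf.enorm.aemeasurable hg.enorm.aemeasurable

lemma holder2 {a b : ℝ} (hab : a.HolderConjugate b) {f g : E3 → ℝ} (hf : Measurable f)
    (hg : Measurable g) : ‖∫ x, f x * g x‖ₑ ≤ nr a f * nr b g := by
  refine (enorm_integral_le_lintegral_enorm _).trans ?_
  simp only [enorm_mul]
  exact holder2_lint hab hf hg

lemma conj65 : (6/5 : ℝ).HolderConjugate 6 := by
  rw [Real.holderConjugate_iff]; norm_num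

lemma conj22 : (2 : ℝ).HolderConjugate 2 := by
  rw [Real.holderConjugate_iff]; norm_num

lemma li_mul {f g : E3 → ℝ} (hf : LocallyIntegrable f volume) (hg : Continuous g)
    (hgc : HasCompactSupport g) : Integrable (fun x => f x * g x) volume := by
  have := hf.integrable_smul_right_of_hasCompactSupport hg hgc
  simpa [mul_comm] using this

lemma sobolev6 : ∃ C : ℝ≥0, ∀ f : E3 → ℝ, ContDiff ℝ 1 f → HasCompactSupport f →
    nr 6 f ≤ C * ∑ i, nr 2 (pd f i) := by
  obtain ⟨C, hC⟩ := sobolev_q (q := 2) (q' := 6) (by norm_num) (by norm_num)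
  refine ⟨C, fun f hf hc => ?_⟩
  have := hC f hf hc
  unfold nr
  simpa using this

def Cs : ℝ≥0 := Classical.choose sobolev6
lemma Cs_spec {f : E3 → ℝ} (hf : ContDiff ℝ 1 f) (hc : HasCompactSupport f) :
    nr 6 f ≤ Cs * ∑ i, nr 2 (pd f i) := Classical.choose_spec sobolev6 f hf hc

lemma hess_sq {ψ : E3 → ℝ} (hψ : Sm ψ) (hc : HasCompactSupport ψ) :
    ∑ i, ∑ j, ∫ x, pd (pd ψ i) j x ^ 2 = ∫ x, lap ψ x ^ 2 := by
  have h1 : ∀ i j, ∫ x, pd (pd ψ i) j x ^ 2 = ∫ x, pd (pd ψ i) i x * pd (pd ψ j) j x := by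
    intro i j
    rw [← ibp_swap (contDiff_pd hψ i) (contDiff_pd hψ j) (hcs_pd hc j) j i]
    congr 1; funext x
    rw [pd_comm hψ j i, sq]
  have hIntg : ∀ i j, Integrable (fun x => pd (pd ψ i) i x * pd (pd ψ j) j x) := fun i j =>
    ((contDiff_pd (contDiff_pd hψ i) i).continuous.mul
      (contDiff_pd (contDiff_pd hψ j) j).continuous).integrable_of_hasCompactSupport
      (hcs_mul_right (hcs_pd (hcs_pd hc j) j))
  simp only [h1]
  have h2 : ∀ x, lap ψ x ^ 2 = ∑ i, ∑ j, pd (pd ψ i) i x * pd (pd ψ j) j x := by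
    intro x
    unfold lap
    rw [sq, Finset.sum_mul_sum]
  simp only [h2]
  rw [integral_finsetSum _ fun i _ => integrable_finsetSum _ fun j _ => hIntg i j]
  refine Finset.sum_congr rfl fun i _ => ?_
  rw [integral_finsetSum _ fun j _ => hIntg i j]

lemma nr2_of_int {f : E3 → ℝ} (hf : MemLp f 2 volume) :
    nr 2 f = ENNReal.ofReal (Real.sqrt (∫ x, f x ^ 2)) := by
  rw [nr_eq two_pos, Real.sqrt_eq_rpow, ← ENNReal.ofReal_rpow_of_nonneg
    (integral_nonneg fun _ => sq_nonneg _) (by norm_num),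
    ofReal_integral_eq_lintegral_ofReal hf.integrable_sq (ae_of_all _ fun _ => sq_nonneg _)]
  congr 2
  funext x
  rw [← Real.enorm_eq_ofReal (sq_nonneg _), enorm_pow]
  norm_cast

lemma smMemLp {f : E3 → ℝ} (hf : Sm f) (hc : HasCompactSupport f) (p : ℝ≥0∞) : MemLp f p volume :=
  hf.continuous.memLp_of_hasCompactSupport hc

lemma hess_le {ψ : E3 → ℝ} (hψ : Sm ψ) (hc : HasCompactSupport ψ) (i j : Fin 3) :
    nr 2 (pd (pd ψ i) j) ≤ nr 2 (lap ψ) := by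
  rw [nr2_of_int (smMemLp (contDiff_pd (contDiff_pd hψ i) j) (hcs_pd (hcs_pd hc i) j) 2),
    nr2_of_int (smMemLp (lap_smooth hψ) (lap_hcs hc) 2), ← hess_sq hψ hc]
  apply ENNReal.ofReal_le_ofReal
  apply Real.sqrt_le_sqrt
  have hn : ∀ i j, 0 ≤ ∫ x, pd (pd ψ i) j x ^ 2 := fun i j => integral_nonneg fun _ => sq_nonneg _
  exact (Finset.single_le_sum (f := fun j => ∫ x, pd (pd ψ i) j x ^ 2) (fun j _ => hn i j)
    (Finset.mem_univ j)).trans (Finset.single_le_sum (f := fun i => ∑ j, ∫ x, pd (pd ψ i) j x ^ 2)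
    (fun i _ => Finset.sum_nonneg fun j _ => hn i j) (Finset.mem_univ i))

lemma grad6_le {ψ : E3 → ℝ} (hψ : Sm ψ) (hc : HasCompactSupport ψ) (i : Fin 3) :
    nr 6 (pd ψ i) ≤ 3 * Cs * nr 2 (lap ψ) := by
  refine (Cs_spec (contDiff_pd hψ i).one (hcs_pd hc i)).trans ?_
  calc (Cs : ℝ≥0∞) * ∑ j, nr 2 (pd (pd ψ i) j) ≤ Cs * ∑ j : Fin 3, nr 2 (lap ψ) := by
        gcongr with j; exact hess_le hψ hc i j
    _ = _ := by simp; ring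

lemma dual_lap_e {P : E3 → ℝ} (hP : MemLp P 2 volume) {A : ℝ≥0∞}
    (h : ∀ ψ, Sm ψ → HasCompactSupport ψ → ‖∫ x, P x * lap ψ x‖ₑ ≤ A * nr 2 (lap ψ)) :
    nr 2 P ≤ A := by
  by_cases hA : A = ⊤
  · rw [hA]; exact le_top
  have h1 := dual_lap hP (A := A.toReal) ENNReal.toReal_nonneg (fun ψ h1 h2 => by
    have h3 := h ψ h1 h2
    rw [nr_two] at h3
    have h4 : A * eLpNorm (lap ψ) 2 volume ≠ ⊤ :=
      ENNReal.mul_ne_top hA (smMemLp (lap_smooth h1) (lap_hcs h2) 2).2.ne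
    have h5 := ENNReal.toReal_mono h4 h3
    rw [ENNReal.toReal_mul] at h5
    simpa using h5)
  rw [nr_two]
  exact (ENNReal.toReal_le_toReal hP.2.ne hA).mp h1

/-- The weak equation `∇p = div F ... ` in tested form. -/
def WEq (p : E3 → ℝ) (F : Fin 3 → Fin 3 → E3 → ℝ) (h : Fin 3 → E3 → ℝ) : Prop :=
  ∀ φ : Fin 3 → E3 → ℝ, (∀ i, Sm (φ i)) → (∀ i, HasCompactSupport (φ i)) →
    ∑ i, ∫ x, p x * pd (φ i) i x =
      (∑ i, ∑ j, ∫ x, F i j x * pd (φ i) j x) - ∑ i, ∫ x, h i x * φ i x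

lemma pd_cut3_le {R : ℝ} (hR : 0 < R) (i : Fin 3) (x : E3) :
    |pd (fun y => cut R y ^ 3) i x| ≤ 3 * Cθ / R * cut R x := by
  rw [pd_pow ((cut_smooth R).one.differentiable one_ne_zero x)]
  push_cast
  have h0 := cut_nonneg R x
  have h1 := cut_le_one R x
  rw [abs_mul, abs_of_nonneg (by positivity)]
  have h2 := pd_cut_le hR i x
  have hC : 0 ≤ Cθ / R := div_nonneg (by linarith [one_le_Cθ]) hR.le
  calc 3 * cut R x ^ (3 - 1) * |pd (cut R) i x| ≤ 3 * cut R x ^ 2 * (Cθ / R) := by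
        norm_num; gcongr
    _ ≤ 3 * cut R x * (Cθ / R) := by
        have : cut R x ^ 2 ≤ cut R x := by nlinarith
        gcongr
    _ = _ := by ring

lemma press : ∃ C : ℝ≥0, ∀ (p : E3 → ℝ) (F : Fin 3 → Fin 3 → E3 → ℝ) (h : Fin 3 → E3 → ℝ),
    Measurable p → (∀ i j, Measurable (F i j)) → (∀ i, Measurable (h i)) →
    LocallyIntegrable p volume → (∀ i j, LocallyIntegrable (F i j) volume) →
    (∀ i, LocallyIntegrable (h i) volume) → WEq p F h →
    ∀ R, 0 < R → MemLp (fun x => cut R x ^ 3 * p x) 2 volume →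
    nr 2 (fun x => cut R x ^ 3 * p x) ≤ C * (ENNReal.ofReal R⁻¹ * nr (6/5) (fun x => cut R x * p x)
      + ENNReal.ofReal R⁻¹ * (∑ i, ∑ j, nr (6/5) (fun x => cut R x * F i j x))
      + (∑ i, ∑ j, nr 2 (fun x => cut R x ^ 3 * F i j x))
      + ∑ i, nr (6/5) (fun x => cut R x ^ 3 * h i x)) := by
  set K : ℝ≥0 := (3 * Cθ).toNNReal * (3 * Cs) with hK
  refine ⟨3 * K + 1 + 3 * Cs, fun p F h pm Fm hm pl Fl hl heq R hR hP => ?_⟩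
  apply dual_lap_e hP
  intro ψ hψ hψc
  set χ : E3 → ℝ := fun y => cut R y ^ 3 with hχ
  have hχs : Sm χ := (cut_smooth R).pow 3
  have hχc : HasCompactSupport χ := by
    have : χ = fun y => cut R y * cut R y ^ 2 := by funext y; simp only [hχ]; ring
    rw [this]; exact hcs_mul_left (cut_hcs hR)
  set D := nr 2 (lap ψ) with hD
  have hdψ : ∀ i x, DifferentiableAt ℝ (pd ψ i) x := fun i x =>
    (contDiff_pd hψ i).one.differentiable one_ne_zero x
  have hdχ : ∀ x, DifferentiableAt ℝ χ x := fun x => hχs.one.differentiable one_ne_zero x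
  have he := heq (fun i x => χ x * pd ψ i x) (fun i => hχs.mul (contDiff_pd hψ i))
    (fun i => hcs_mul_left hχc)
  have hpd : ∀ i j x, pd (fun x => χ x * pd ψ i x) j x = pd χ j x * pd ψ i x + χ x * pd (pd ψ i) j x :=
    fun i j x => pd_mul (hdχ x) (hdψ i x) j
  simp only [hpd] at he
  -- integrability
  have i1 : ∀ {f : E3 → ℝ}, LocallyIntegrable f volume → ∀ i j,
      Integrable (fun x => f x * (pd χ j x * pd ψ i x)) := fun hf i j =>
    li_mul hf ((contDiff_pd hχs j).continuous.mul (contDiff_pd hψ i).continuous)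
      (hcs_mul_left (hcs_pd hχc j))
  have i2 : ∀ {f : E3 → ℝ}, LocallyIntegrable f volume → ∀ i j,
      Integrable (fun x => f x * (χ x * pd (pd ψ i) j x)) := fun hf i j =>
    li_mul hf (hχs.continuous.mul (contDiff_pd (contDiff_pd hψ i) j).continuous) (hcs_mul_left hχc)
  simp only [mul_add] at he
  have e1 : ∀ i, ∫ x, (p x * (pd χ i x * pd ψ i x) + p x * (χ x * pd (pd ψ i) i x)) =
      (∫ x, p x * (pd χ i x * pd ψ i x)) + ∫ x, p x * (χ x * pd (pd ψ i) i x) := fun i =>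
    integral_add (i1 pl i i) (i2 pl i i)
  have e2 : ∀ i j, ∫ x, (F i j x * (pd χ j x * pd ψ i x) + F i j x * (χ x * pd (pd ψ i) j x)) =
      (∫ x, F i j x * (pd χ j x * pd ψ i x)) + ∫ x, F i j x * (χ x * pd (pd ψ i) j x) := fun i j =>
    integral_add (i1 (Fl i j) i j) (i2 (Fl i j) i j)
  simp only [e1, e2, Finset.sum_add_distrib] at he
  have e3 : ∑ i, ∫ x, p x * (χ x * pd (pd ψ i) i x) = ∫ x, χ x * p x * lap ψ x := by
    rw [← integral_finsetSum _ fun i _ => i2 pl i i]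
    congr 1; funext x
    unfold lap
    rw [Finset.mul_sum]
    refine Finset.sum_congr rfl fun i _ => ?_
    ring
  rw [e3] at he
  have he' : ∫ x, χ x * p x * lap ψ x = (∑ i, ∑ j, ∫ x, F i j x * (pd χ j x * pd ψ i x))
      + (∑ i, ∑ j, ∫ x, F i j x * (χ x * pd (pd ψ i) j x)) - (∑ i, ∫ x, h i x * (χ x * pd ψ i x))
      - ∑ i, ∫ x, p x * (pd χ i x * pd ψ i x) := by linarith
  have hRi : ENNReal.ofReal (3 * Cθ / R) = ENNReal.ofReal (3 * Cθ) * ENNReal.ofReal R⁻¹ := by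
    rw [div_eq_mul_inv, ENNReal.ofReal_mul (by linarith [one_le_Cθ])]
  have b1 : ∀ {f : E3 → ℝ}, Measurable f → ∀ i j, ‖∫ x, f x * (pd χ j x * pd ψ i x)‖ₑ ≤
      K * (ENNReal.ofReal R⁻¹ * nr (6/5) (fun x => cut R x * f x)) * D := by
    intro f hf i j
    have : ∀ x, f x * (pd χ j x * pd ψ i x) = (f x * pd χ j x) * pd ψ i x := fun x => by ring
    simp only [this]
    refine (holder2 conj65 (hf.mul (contDiff_pd hχs j).continuous.measurable)
      (contDiff_pd hψ i).continuous.measurable).trans ?_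
    have h1 : nr (6/5) (fun x => f x * pd χ j x) ≤
        ENNReal.ofReal (3 * Cθ / R) * nr (6/5) (fun x => cut R x * f x) := by
      apply nr_le_mul
      intro x
      rw [abs_mul, abs_mul, abs_of_nonneg (cut_nonneg R x), mul_comm]
      have := mul_le_mul_of_nonneg_right (pd_cut3_le hR j x) (abs_nonneg (f x))
      linarith
    calc _ ≤ (ENNReal.ofReal (3 * Cθ / R) * nr (6/5) (fun x => cut R x * f x)) *
          (3 * Cs * nr 2 (lap ψ)) := mul_le_mul' h1 (grad6_le hψ hψc i)
      _ = _ := by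
        rw [hRi, hK]
        push_cast
        rw [← hD, show ((3 * Cθ).toNNReal : ℝ≥0∞) = ENNReal.ofReal (3 * Cθ) from rfl]
        ring
  have b2 : ∀ i j, ‖∫ x, F i j x * (χ x * pd (pd ψ i) j x)‖ₑ ≤
      nr 2 (fun x => cut R x ^ 3 * F i j x) * D := by
    intro i j
    have : ∀ x, F i j x * (χ x * pd (pd ψ i) j x) = (χ x * F i j x) * pd (pd ψ i) j x := fun x => by ring
    simp only [this]
    refine (holder2 conj22 (hχs.continuous.measurable.mul (Fm i j))
      (contDiff_pd (contDiff_pd hψ i) j).continuous.measurable).trans ?_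
    exact mul_le_mul' le_rfl (hess_le hψ hψc i j)
  have b3 : ∀ i, ‖∫ x, h i x * (χ x * pd ψ i x)‖ₑ ≤
      3 * Cs * nr (6/5) (fun x => cut R x ^ 3 * h i x) * D := by
    intro i
    have : ∀ x, h i x * (χ x * pd ψ i x) = (χ x * h i x) * pd ψ i x := fun x => by ring
    simp only [this]
    refine (holder2 conj65 (hχs.continuous.measurable.mul (hm i))
      (contDiff_pd hψ i).continuous.measurable).trans ?_
    calc _ ≤ nr (6/5) (fun x => χ x * h i x) * (3 * Cs * nr 2 (lap ψ)) :=
          mul_le_mul' le_rfl (grad6_le hψ hψc i)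
      _ = _ := by ring
  rw [he']
  set a := ENNReal.ofReal R⁻¹ * nr (6/5) (fun x => cut R x * p x) with ha
  set b := ENNReal.ofReal R⁻¹ * ∑ i, ∑ j, nr (6/5) (fun x => cut R x * F i j x) with hb
  set c := ∑ i, ∑ j, nr 2 (fun x => cut R x ^ 3 * F i j x) with hc
  set d := ∑ i, nr (6/5) (fun x => cut R x ^ 3 * h i x) with hd
  have s1 : ‖∑ i, ∑ j, ∫ x, F i j x * (pd χ j x * pd ψ i x)‖ₑ ≤ K * b * D := by
    refine (enorm_sum_le _ _).trans ((Finset.sum_le_sum fun i _ => (enorm_sum_le _ _).trans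
      (Finset.sum_le_sum fun j _ => b1 (Fm i j) i j)).trans (le_of_eq ?_))
    simp only [hb, Finset.mul_sum, Finset.sum_mul]
  have s2 : ‖∑ i, ∑ j, ∫ x, F i j x * (χ x * pd (pd ψ i) j x)‖ₑ ≤ c * D := by
    refine (enorm_sum_le _ _).trans ((Finset.sum_le_sum fun i _ => (enorm_sum_le _ _).trans
      (Finset.sum_le_sum fun j _ => b2 i j)).trans (le_of_eq ?_))
    simp only [hc, Finset.sum_mul]
  have s3 : ‖∑ i, ∫ x, h i x * (χ x * pd ψ i x)‖ₑ ≤ 3 * Cs * d * D := by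
    refine (enorm_sum_le _ _).trans ((Finset.sum_le_sum fun i _ => b3 i).trans (le_of_eq ?_))
    simp only [hd, Finset.mul_sum, Finset.sum_mul]
  have s4 : ‖∑ i, ∫ x, p x * (pd χ i x * pd ψ i x)‖ₑ ≤ 3 * K * a * D := by
    refine (enorm_sum_le _ _).trans ((Finset.sum_le_sum fun i _ => b1 pm i i).trans (le_of_eq ?_))
    simp [← ha]; ring
  calc _ ≤ K * b * D + c * D + 3 * Cs * d * D + 3 * K * a * D := by
        refine enorm_sub_le.trans (add_le_add (enorm_sub_le.trans (add_le_add
          ((enorm_add_le _ _).trans (add_le_add s1 s2)) s3)) s4)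
    _ ≤ ((3 * K + 1 + 3 * Cs : ℝ≥0) : ℝ≥0∞) * (a + b + c + d) * D := by
        rw [← add_mul, ← add_mul, ← add_mul]
        gcongr
        push_cast
        have : ((3 : ℝ≥0∞) * K + 1 + 3 * Cs) * (a + b + c + d) =
          (K * b + c + 3 * Cs * d + 3 * K * a) +
          (2 * K * b + (3 * K + 3 * Cs) * c + (3 * K + 1) * d + (1 + 3 * Cs) * a + (1 + 3 * Cs) * b) := by
          ring
        rw [this]
        exact le_self_add

end

noncomputable section

open MeasureTheory Metric Filter Topology Set
open scoped ENNReal NNReal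

/-! ### Local L² integrability of the pressure -/

lemma WEq_avg {p : E3 → ℝ} {F : Fin 3 → Fin 3 → E3 → ℝ} {h : Fin 3 → E3 → ℝ}
    (pm : Measurable p) (Fm : ∀ i j, Measurable (F i j)) (hm : ∀ i, Measurable (h i))
    (pl : LocallyIntegrable p volume) (Fl : ∀ i j, LocallyIntegrable (F i j) volume)
    (hl : ∀ i, LocallyIntegrable (h i) volume) (heq : WEq p F h) (ε : ℝ) :
    WEq (avg p ε) (fun i j => avg (F i j) ε) (fun i => avg (h i) ε) := by
  intro φ hφ hφc
  have fub : ∀ {f g : E3 → ℝ}, Measurable f → LocallyIntegrable f volume → Continuous g →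
      HasCompactSupport g → ∫ x, avg f ε x * g x = ∫ z, eta z * ∫ x, f x * g (x + ε • z) :=
    fun hfm hfl hg hgc => cv_fubini eta_cont eta_hcs hfm hfl hg hgc
  have zi : ∀ {f g : E3 → ℝ}, Measurable f → LocallyIntegrable f volume → Continuous g →
      HasCompactSupport g → Integrable (fun z => eta z * ∫ x, f x * g (x + ε • z)) volume :=
    fun hfm hfl hg hgc => cv_z_integrable eta_cont eta_hcs hfm hfl hg hgc
  have c1 : ∀ i j, Continuous (pd (φ i) j) := fun i j => (contDiff_pd (hφ i) j).continuous
  have c2 : ∀ i j, HasCompactSupport (pd (φ i) j) := fun i j => hcs_pd (hφc i) j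
  have c3 : ∀ i, Continuous (φ i) := fun i => (hφ i).continuous
  simp only [fub pm pl (c1 _ _) (c2 _ _), fub (Fm _ _) (Fl _ _) (c1 _ _) (c2 _ _),
    fub (hm _) (hl _) (c3 _) (hφc _)]
  rw [← integral_finsetSum _ fun i _ => zi pm pl (c1 i i) (c2 i i)]
  have e1 : ∀ i, ∑ j, ∫ z, eta z * ∫ x, F i j x * pd (φ i) j (x + ε • z) =
      ∫ z, ∑ j, eta z * ∫ x, F i j x * pd (φ i) j (x + ε • z) := fun i =>
    (integral_finsetSum _ fun j _ => zi (Fm i j) (Fl i j) (c1 i j) (c2 i j)).symm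
  simp only [e1]
  rw [← integral_finsetSum _ fun i _ => integrable_finsetSum _ fun j _ =>
      zi (Fm i j) (Fl i j) (c1 i j) (c2 i j),
    ← integral_finsetSum _ fun i _ => zi (hm i) (hl i) (c3 i) (hφc i),
    ← integral_sub (integrable_finsetSum _ fun i _ => integrable_finsetSum _ fun j _ =>
      zi (Fm i j) (Fl i j) (c1 i j) (c2 i j))
      (integrable_finsetSum _ fun i _ => zi (hm i) (hl i) (c3 i) (hφc i))]
  congr 1; funext z
  have := heq (fun i x => φ i (x + ε • z)) (fun i => (hφ i).comp (contDiff_id.add contDiff_const))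
    (fun i => (hφc i).comp_homeomorph (Homeomorph.addRight (ε • z)))
  simp only [pd_comp_add] at this
  simp only [← Finset.mul_sum, ← mul_sub]
  rw [this]

def ind (r : ℝ) (f : E3 → ℝ) : E3 → ℝ := (closedBall (0 : E3) r).indicator f

lemma ind_of_le {r : ℝ} {x : E3} (h : ‖x‖ ≤ r) (f : E3 → ℝ) : ind r f x = f x :=
  indicator_of_mem (by simpa using h) f
lemma ind_of_lt {r : ℝ} {x : E3} (h : r < ‖x‖) (f : E3 → ℝ) : ind r f x = 0 :=
  indicator_of_notMem (by simpa using h) f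
lemma abs_ind_le (r : ℝ) (f : E3 → ℝ) (x : E3) : |ind r f x| ≤ |f x| := by
  by_cases h : ‖x‖ ≤ r
  · rw [ind_of_le h]
  · rw [ind_of_lt (not_le.mp h)]; simp
lemma ind_meas {f : E3 → ℝ} (hf : Measurable f) (r : ℝ) : Measurable (ind r f) :=
  hf.indicator measurableSet_closedBall

lemma avg_ind {f : E3 → ℝ} {r ε : ℝ} (hε : 0 < ε) (hε1 : ε ≤ 1) {x : E3} (hx : ‖x‖ ≤ r) :
    avg f ε x = avg (ind (r + 2) f) ε x := by
  unfold avg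
  congr 1; funext z
  by_cases hz : 2 ≤ ‖z‖
  · rw [eta_zero hz]; simp
  · push Not at hz
    rw [ind_of_le]
    calc ‖x - ε • z‖ ≤ ‖x‖ + ‖ε • z‖ := norm_sub_le _ _
      _ ≤ r + 2 := by
        rw [norm_smul, Real.norm_of_nonneg hε.le]
        have : ε * ‖z‖ ≤ 1 * 2 := by gcongr
        linarith

lemma nr_ind_avg {f : E3 → ℝ} (hf : Measurable f) {r ε s : ℝ} (hε : 0 < ε) (hε1 : ε ≤ 1)
    (hs : 1 ≤ s) : nr s (ind r (avg f ε)) ≤ nr s (ind (r + 2) f) := by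
  refine le_trans (nr_mono fun x => ?_) (avg_eLpNorm_le (ind_meas hf (r + 2)) ε hs)
  by_cases h : ‖x‖ ≤ r
  · rw [ind_of_le h, avg_ind hε hε1 h]
  · rw [ind_of_lt (not_le.mp h)]; simp

lemma nr_cut_le {f : E3 → ℝ} {R s : ℝ} (hR : 0 < R) (n : ℕ) (hn : n ≠ 0) :
    nr s (fun x => cut R x ^ n * f x) ≤ nr s (ind (2 * R) f) := by
  apply nr_mono
  intro x
  by_cases h : ‖x‖ ≤ 2 * R
  · rw [ind_of_le h, abs_mul, abs_of_nonneg (pow_nonneg (cut_nonneg R x) n)]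
    exact mul_le_of_le_one_left (abs_nonneg _) (pow_le_one₀ (cut_nonneg R x) (cut_le_one R x))
  · rw [cut_eq_zero hR (by linarith [not_le.mp h])]; simp [hn]

lemma interp65_aux (x a b : ℝ≥0∞)
    (h : x ≤ a ^ (1/5 : ℝ) * b ^ (4/5 : ℝ)) :
    x ^ (5/6 : ℝ) ≤ (a ^ (1/2 : ℝ)) ^ (1/3 : ℝ) * b ^ (2/3 : ℝ) := by
  have h1 := ENNReal.rpow_le_rpow h (z := (5/6 : ℝ)) (by norm_num)
  rw [ENNReal.mul_rpow_of_nonneg _ _ (by norm_num), ← ENNReal.rpow_mul, ← ENNReal.rpow_mul] at h1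
  rw [← ENNReal.rpow_mul]
  have e1 : (1/5 : ℝ) * (5/6) = 1/2 * (1/3) := by norm_num
  have e2 : (4/5 : ℝ) * (5/6) = 2/3 := by norm_num
  rwa [e1, e2] at h1

lemma interp65_pt {f : E3 → ℝ} {R : ℝ} (hR : 0 < R) (x : E3) : ‖cut R x * f x‖ₑ ^ (6/5 : ℝ) =
      ‖cut R x ^ 3 * f x‖ₑ ^ (2/5 : ℝ) * ‖ind (2 * R) f x‖ₑ ^ (4/5 : ℝ) := by
  by_cases hx : ‖x‖ ≤ 2 * R
  · have e1 : (3:ℕ) * (2/5 : ℝ) = 6/5 := by norm_num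
    have e2 : (2/5 : ℝ) + 4/5 = 6/5 := by norm_num
    rw [ind_of_le hx, enorm_mul, enorm_mul, enorm_pow, ENNReal.mul_rpow_of_nonneg _ _ (by norm_num),
      ENNReal.mul_rpow_of_nonneg _ _ (by norm_num), mul_assoc,
      ← ENNReal.rpow_add_of_nonneg _ _ (by norm_num) (by norm_num),
      ← ENNReal.rpow_natCast, ← ENNReal.rpow_mul, e1, e2]
  · have h65 : (0:ℝ) < 6/5 := by norm_num
    have h45 : (0:ℝ) < 4/5 := by norm_num
    rw [cut_eq_zero hR (by linarith [not_le.mp hx]), ind_of_lt (not_le.mp hx), zero_mul, enorm_zero,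
      ENNReal.zero_rpow_of_pos h65, ENNReal.zero_rpow_of_pos h45, mul_zero]

lemma holder5 {a b : E3 → ℝ≥0∞} (ha : Measurable a) (hb : Measurable b) :
    ∫⁻ x, a x ^ (2/5 : ℝ) * b x ^ (4/5 : ℝ) ≤
      (∫⁻ x, a x ^ (2 : ℝ)) ^ (1/5 : ℝ) * (∫⁻ x, b x ^ (1 : ℝ)) ^ (4/5 : ℝ) := by
  have hconj : (5 : ℝ).HolderConjugate (5/4) := by
    rw [Real.holderConjugate_iff]; constructor <;> norm_num
  have h := ENNReal.lintegral_mul_le_Lp_mul_Lq (volume : Measure E3) hconj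
    (ha.pow_const (2/5 : ℝ)).aemeasurable (hb.pow_const (4/5 : ℝ)).aemeasurable
  have e1 : (2/5 : ℝ) * 5 = 2 := by norm_num
  have e2 : (4/5 : ℝ) * (5/4) = 1 := by norm_num
  have e3 : (1 : ℝ) / (5/4) = 4/5 := by norm_num
  simp only [Pi.mul_apply, ← ENNReal.rpow_mul, e1, e2, e3] at h
  exact h

lemma interp65 {f : E3 → ℝ} (hf : Measurable f) {R : ℝ} (hR : 0 < R) :
    nr (6/5) (fun x => cut R x * f x) ≤
      nr 2 (fun x => cut R x ^ 3 * f x) ^ (1/3 : ℝ) * nr 1 (ind (2 * R) f) ^ (2/3 : ℝ) := by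
  have hcm : Measurable (cut R) := (cut_smooth R).continuous.measurable
  have n1 : nr (6/5) (fun x => cut R x * f x) = (∫⁻ x, ‖cut R x * f x‖ₑ ^ (6/5 : ℝ)) ^ (5/6 : ℝ) := by
    have h65 : (0:ℝ) < 6/5 := by norm_num
    have e4 : (5/6 : ℝ) = 1 / (6/5) := by norm_num
    rw [e4]; exact nr_eq h65 _
  have n2 : nr 2 (fun x => cut R x ^ 3 * f x) = (∫⁻ x, ‖cut R x ^ 3 * f x‖ₑ ^ (2 : ℝ)) ^ (1/2 : ℝ) :=
    nr_eq two_pos _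
  have n3 : nr 1 (ind (2 * R) f) = ∫⁻ x, ‖ind (2 * R) f x‖ₑ ^ (1 : ℝ) := by
    have := nr_eq (f := ind (2 * R) f) one_pos
    rwa [div_one, ENNReal.rpow_one] at this
  rw [n1, n2, n3]
  apply interp65_aux
  have h := holder5 (a := fun x => ‖cut R x ^ 3 * f x‖ₑ) (b := fun x => ‖ind (2 * R) f x‖ₑ)
    ((hcm.pow_const 3).mul hf).enorm (ind_meas hf _).enorm
  simp only [← interp65_pt hR] at h
  exact h

lemma toReal_aux (C : ℝ≥0) {X Y w1 w2 H : ℝ≥0∞} {R δ : ℝ} (hR : 0 < R) (hδ0 : 0 < δ)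
    (hXt : X ≠ ⊤) (hYt : Y ≠ ⊤) (hw1t : w1 ≠ ⊤) (hw2t : w2 ≠ ⊤) (hHt : H ≠ ⊤)
    (h2 : X ≤ C * (ENNReal.ofReal R⁻¹ * Y + ENNReal.ofReal R⁻¹ * (9 * (ENNReal.ofReal δ * Y + w1))
        + 9 * (ENNReal.ofReal δ * X + w2) + H)) :
    X.toReal ≤ C * (R⁻¹ * Y.toReal + R⁻¹ * (9 * (δ * Y.toReal + w1.toReal))
        + 9 * (δ * X.toReal + w2.toReal) + H.toReal) := by
  lift X to ℝ≥0 using hXt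
  lift Y to ℝ≥0 using hYt
  lift w1 to ℝ≥0 using hw1t
  lift w2 to ℝ≥0 using hw2t
  lift H to ℝ≥0 using hHt
  have hd : ENNReal.ofReal δ = ((δ.toNNReal : ℝ≥0) : ℝ≥0∞) := rfl
  have hr : ENNReal.ofReal R⁻¹ = ((R⁻¹.toNNReal : ℝ≥0) : ℝ≥0∞) := rfl
  rw [hd, hr] at h2
  have h3 : X ≤ C * (R⁻¹.toNNReal * Y + R⁻¹.toNNReal * (9 * (δ.toNNReal * Y + w1))
    + 9 * (δ.toNNReal * X + w2) + H) := by exact_mod_cast h2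
  have h4 : (X : ℝ) ≤ ((C * (R⁻¹.toNNReal * Y + R⁻¹.toNNReal * (9 * (δ.toNNReal * Y + w1))
    + 9 * (δ.toNNReal * X + w2) + H) : ℝ≥0) : ℝ) := by exact_mod_cast h3
  push_cast at h4
  rw [Real.coe_toNNReal _ hδ0.le, Real.coe_toNNReal _ (inv_nonneg.mpr hR.le)] at h4
  simpa using h4

lemma nr_ind_finite_of_le {f : E3 → ℝ} (hf : Measurable f) {r s t : ℝ} (hst : s ≤ t)
    (h : nr t (ind r f) ≠ ⊤) : nr s (ind r f) ≠ ⊤ := by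
  have e : ∀ q : ℝ, nr q (ind r f) = eLpNorm f (ENNReal.ofReal q) (volume.restrict (closedBall 0 r)) :=
    fun q => eLpNorm_indicator_eq_eLpNorm_restrict measurableSet_closedBall
  rw [e] at h ⊢
  have : IsFiniteMeasure (volume.restrict (closedBall (0 : E3) r)) :=
    ⟨by rw [Measure.restrict_apply_univ]; exact measure_closedBall_lt_top⟩
  have h2 : MemLp f (ENNReal.ofReal t) (volume.restrict (closedBall (0:E3) r)) :=
    ⟨hf.aestronglyMeasurable, lt_top_iff_ne_top.mpr h⟩
  exact (h2.mono_exponent (ENNReal.ofReal_le_ofReal hst)).2.ne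

lemma amgm13 {x n A : ℝ} (hx : 0 ≤ x) (hn : 0 ≤ n) (hA : 0 ≤ A) :
    A * (x ^ (1/3 : ℝ) * n ^ (2/3 : ℝ)) ≤ x / 3 + 2 / 3 * (A ^ (3/2 : ℝ) * n) := by
  have h := Real.geom_mean_le_arith_mean2_weighted (w₁ := 1/3) (w₂ := 2/3) (by norm_num) (by norm_num)
    hx (mul_nonneg (Real.rpow_nonneg hA (3/2)) hn) (by norm_num)
  rw [Real.mul_rpow (Real.rpow_nonneg hA _) hn, ← Real.rpow_mul hA] at h
  norm_num at h ⊢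
  linarith

lemma li_avg_mono {f g : E3 → ℝ} (hf : LocallyIntegrable f volume) (hg : LocallyIntegrable g volume)
    (h : ∀ x, f x ≤ g x) {ε : ℝ} (hε : 0 < ε) (x : E3) : avg f ε x ≤ avg g ε x := by
  unfold avg
  apply integral_mono (cv_integrable eta_cont eta_hcs hf hε x)
    (cv_integrable eta_cont eta_hcs hg hε x)
  intro z
  exact mul_le_mul_of_nonneg_left (h _) (eta_nonneg z)

lemma li_of_ind {f : E3 → ℝ} (h : ∀ r, nr 1 (ind r f) ≠ ⊤) (hf : Measurable f) :
    LocallyIntegrable f volume := by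
  rw [locallyIntegrable_iff]
  intro K hK
  obtain ⟨r, hr⟩ := hK.isBounded.subset_closedBall (0 : E3)
  refine IntegrableOn.mono_set ?_ hr
  have h1 := h r
  unfold nr ind at h1
  rw [eLpNorm_indicator_eq_eLpNorm_restrict measurableSet_closedBall, ENNReal.ofReal_one] at h1
  exact memLp_one_iff_integrable.mp ⟨hf.aestronglyMeasurable, lt_top_iff_ne_top.mpr h1⟩

lemma ind_of_li {f : E3 → ℝ} (h : LocallyIntegrable f volume) (r : ℝ) : nr 1 (ind r f) ≠ ⊤ := by
  unfold nr ind
  rw [eLpNorm_indicator_eq_eLpNorm_restrict measurableSet_closedBall, ENNReal.ofReal_one]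
  exact (memLp_one_iff_integrable.mpr (h.integrableOn_isCompact (isCompact_closedBall 0 r))).2.ne

lemma stepA {p : E3 → ℝ} {F : Fin 3 → Fin 3 → E3 → ℝ} {h : Fin 3 → E3 → ℝ}
    (pm : Measurable p) (Fm : ∀ i j, Measurable (F i j)) (hm : ∀ i, Measurable (h i))
    (pl : LocallyIntegrable p volume) (Fl : ∀ i j, LocallyIntegrable (F i j) volume)
    (hl : ∀ i, LocallyIntegrable (h i) volume) (heq : WEq p F h)
    (hF : ∀ δ > 0, ∃ W : E3 → ℝ, Measurable W ∧ (∀ r, nr 2 (ind r W) ≠ ⊤) ∧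
      ∀ i j x, |F i j x| ≤ δ * p x + W x)
    (h65 : ∀ i r, nr (6/5) (ind r (h i)) ≠ ⊤) {R : ℝ} (hR : 0 < R) :
    nr 2 (fun x => cut R x ^ 3 * p x) ≠ ⊤ := by
  obtain ⟨C, hC⟩ := press
  set δ : ℝ := 1 / (36 * (C + 1)) with hδ
  have hδ0 : 0 < δ := by positivity
  have hδC : 9 * C * δ ≤ 1 / 4 := by
    rw [hδ]
    have : (0:ℝ) ≤ C := C.2
    rw [mul_one_div, div_le_div_iff₀ (by positivity) (by norm_num)]
    linarith
  obtain ⟨W, Wm, W2, hFW⟩ := hF δ hδ0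
  have Wl : LocallyIntegrable W volume := li_of_ind
    (fun r => nr_ind_finite_of_le Wm (by norm_num) (W2 r)) Wm
  set w2 := nr 2 (ind (2 * R + 2) W) with hw2
  set w1 := nr (6/5) (ind (2 * R + 2) W) with hw1
  have hw2t : w2 ≠ ⊤ := W2 _
  have hw1t : w1 ≠ ⊤ := nr_ind_finite_of_le Wm (by norm_num) (W2 _)
  set H := ∑ i, nr (6/5) (ind (2 * R + 2) (h i)) with hH
  have hHt : H ≠ ⊤ := ENNReal.sum_ne_top.mpr fun i _ => h65 i _
  set N := nr 1 (ind (2 * R + 2) p) with hN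
  have hNt : N ≠ ⊤ := ind_of_li pl _
  set A : ℝ := C * (R⁻¹ + 9 * R⁻¹ * δ) with hA
  have hA0 : 0 ≤ A := by have : (0:ℝ) ≤ C := C.2; positivity
  set M : ℝ := 12 / 5 * (2 / 3 * (A ^ (3/2 : ℝ) * N.toReal)
    + C * (9 * R⁻¹ * w1.toReal + 9 * w2.toReal + H.toReal)) with hM
  have key : ∀ n, nr 2 (fun x => cut R x ^ 3 * avg p (eseq n) x) ≤ ENNReal.ofReal M := by
    intro n
    set ε := eseq n
    have hε : 0 < ε := eseq_pos n
    have hε1 : ε ≤ 1 := eseq_le n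
    have sP := avg_smooth pl hε
    have sF := fun i j => avg_smooth (Fl i j) hε
    have sh := fun i => avg_smooth (hl i) hε
    have sW := avg_smooth Wl hε
    have hml : MemLp (fun x => cut R x ^ 3 * avg p ε x) 2 volume := by
      apply smMemLp (((cut_smooth R).pow 3).mul sP)
      have : (fun x => cut R x ^ 3 * avg p ε x) = fun x => cut R x * (cut R x ^ 2 * avg p ε x) := by
        funext x; ring
      rw [this]; exact hcs_mul_left (cut_hcs hR)
    have h1 := hC (avg p ε) (fun i j => avg (F i j) ε) (fun i => avg (h i) ε)
      sP.continuous.measurable (fun i j => (sF i j).continuous.measurable)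
      (fun i => (sh i).continuous.measurable) sP.continuous.locallyIntegrable
      (fun i j => (sF i j).continuous.locallyIntegrable)
      (fun i => (sh i).continuous.locallyIntegrable)
      (WEq_avg pm Fm hm pl Fl hl heq ε) R hR hml
    set X := nr 2 (fun x => cut R x ^ 3 * avg p ε x) with hX
    have hXt : X ≠ ⊤ := by rw [hX, nr_two]; exact hml.2.ne
    set Y := nr (6/5) (fun x => cut R x * avg p ε x) with hY
    have hcm : Measurable (cut R) := (cut_smooth R).continuous.measurable
    have pW : ∀ i j x, |avg (F i j) ε x| ≤ δ * avg p ε x + avg W ε x := by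
      intro i j x
      have e : δ * avg p ε x + avg W ε x = avg (fun y => δ * p y + W y) ε x := by
        unfold avg
        rw [← integral_const_mul, ← integral_add ((cv_integrable eta_cont eta_hcs pl hε x).const_mul _)
          (cv_integrable eta_cont eta_hcs Wl hε x)]
        congr 1; funext z; ring
      have lg : LocallyIntegrable (fun y => δ * p y + W y) volume := (pl.smul δ).add Wl
      rw [e, abs_le]
      constructor
      · have := li_avg_mono (f := fun y => - F i j y) (g := fun y => δ * p y + W y) (Fl i j).neg lg
          (fun y => (neg_le_abs _).trans (hFW i j y)) hε x
        have e2 : avg (fun y => - F i j y) ε x = - avg (F i j) ε x := by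
          unfold avg; rw [← integral_neg]; congr 1; funext z; ring
        linarith
      · exact li_avg_mono (Fl i j) lg (fun y => (le_abs_self _).trans (hFW i j y)) hε x
    have bF : ∀ (k : ℕ), k ≠ 0 → ∀ s, 1 ≤ s → ∀ i j, nr s (fun x => cut R x ^ k * avg (F i j) ε x) ≤
        ENNReal.ofReal δ * nr s (fun x => cut R x ^ k * avg p ε x) + nr s (ind (2 * R + 2) W) := by
      intro k hk s hs i j
      have t1 : nr s (fun x => cut R x ^ k * avg (F i j) ε x) ≤
          nr s (fun x => δ * (cut R x ^ k * avg p ε x) + cut R x ^ k * avg W ε x) := by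
        apply nr_mono
        intro x
        rw [abs_mul, abs_of_nonneg (pow_nonneg (cut_nonneg R x) k)]
        refine (mul_le_mul_of_nonneg_left (pW i j x) (pow_nonneg (cut_nonneg R x) k)).trans ?_
        refine le_trans (le_of_eq ?_) (le_abs_self _)
        ring
      refine t1.trans ((nr_add hs (((hcm.pow_const k).mul sP.continuous.measurable).const_mul δ)
        ((hcm.pow_const k).mul sW.continuous.measurable)).trans (add_le_add ?_ ?_))
      · apply nr_le_mul
        intro x
        rw [abs_mul, abs_of_pos hδ0]
        exact le_rfl
      · exact (nr_cut_le hR k hk).trans (nr_ind_avg Wm hε hε1 hs)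
    have bF1 : ∀ i j, nr (6/5) (fun x => cut R x * avg (F i j) ε x) ≤ ENNReal.ofReal δ * Y + w1 := by
      intro i j
      have := bF 1 one_ne_zero (6/5) (by norm_num) i j
      simpa only [pow_one] using this
    have bF2 : ∀ i j, nr 2 (fun x => cut R x ^ 3 * avg (F i j) ε x) ≤ ENNReal.ofReal δ * X + w2 :=
      bF 3 (by norm_num) 2 (by norm_num)
    have bH : ∑ i, nr (6/5) (fun x => cut R x ^ 3 * avg (h i) ε x) ≤ H :=
      Finset.sum_le_sum fun i _ => (nr_cut_le hR 3 (by norm_num)).trans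
        (nr_ind_avg (hm i) hε hε1 (by norm_num))
    have bY : Y ≤ X ^ (1/3 : ℝ) * N ^ (2/3 : ℝ) := by
      refine (interp65 sP.continuous.measurable hR).trans ?_
      gcongr
      exact nr_ind_avg pm hε hε1 le_rfl
    have h2 : X ≤ C * (ENNReal.ofReal R⁻¹ * Y + ENNReal.ofReal R⁻¹ * (9 * (ENNReal.ofReal δ * Y + w1))
        + 9 * (ENNReal.ofReal δ * X + w2) + H) := by
      refine h1.trans ?_
      have s9 : ∀ c : ℝ≥0∞, ∑ i : Fin 3, ∑ j : Fin 3, c = 9 * c := by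
        intro c; simp; rw [← mul_assoc]; norm_num
      gcongr
      · rw [← s9]; exact Finset.sum_le_sum fun i _ => Finset.sum_le_sum fun j _ => bF1 i j
      · rw [← s9]; exact Finset.sum_le_sum fun i _ => Finset.sum_le_sum fun j _ => bF2 i j
    have hYt' : X ^ (1/3 : ℝ) * N ^ (2/3 : ℝ) ≠ ⊤ := ENNReal.mul_ne_top
      (ENNReal.rpow_ne_top_of_nonneg (by norm_num) hXt) (ENNReal.rpow_ne_top_of_nonneg (by norm_num) hNt)
    have hYt : Y ≠ ⊤ := ne_top_of_le_ne_top hYt' bY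
    have rY : Y.toReal ≤ X.toReal ^ (1/3 : ℝ) * N.toReal ^ (2/3 : ℝ) := by
      have := ENNReal.toReal_mono hYt' bY
      rwa [ENNReal.toReal_mul, ← ENNReal.toReal_rpow, ← ENNReal.toReal_rpow] at this
    have rX : X.toReal ≤ C * (R⁻¹ * Y.toReal + R⁻¹ * (9 * (δ * Y.toReal + w1.toReal))
        + 9 * (δ * X.toReal + w2.toReal) + H.toReal) := by
      exact toReal_aux C hR hδ0 hXt hYt hw1t hw2t hHt h2
    have hX0 : 0 ≤ X.toReal := ENNReal.toReal_nonneg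
    have am := amgm13 hX0 (ENNReal.toReal_nonneg (a := N)) hA0
    have am2 := mul_le_mul_of_nonneg_left rY hA0
    have e1 : (C : ℝ) * (R⁻¹ * Y.toReal + R⁻¹ * (9 * (δ * Y.toReal + w1.toReal))
        + 9 * (δ * X.toReal + w2.toReal) + H.toReal) = A * Y.toReal + (9 * C * δ) * X.toReal
        + C * (9 * R⁻¹ * w1.toReal + 9 * w2.toReal + H.toReal) := by rw [hA]; ring
    rw [e1] at rX
    have e2 := mul_le_mul_of_nonneg_right hδC hX0
    have fin : X.toReal ≤ M := by rw [hM]; linarith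
    rw [← ENNReal.ofReal_toReal hXt]
    exact ENNReal.ofReal_le_ofReal fin
  -- pass to the limit
  have hPm := ind_meas pm (2 * R + 2)
  have hP1 : MemLp (ind (2 * R + 2) p) (ENNReal.ofReal 1) volume :=
    ⟨hPm.aestronglyMeasurable, lt_top_iff_ne_top.mpr hNt⟩
  have hPl : LocallyIntegrable (ind (2 * R + 2) p) volume := by
    rw [ENNReal.ofReal_one] at hP1
    exact (memLp_one_iff_integrable.mp hP1).locallyIntegrable
  have ht := avg_tendsto hPm hPl le_rfl hP1 eseq_pos eseq_tendsto
  have hmeas := tendstoInMeasure_of_tendsto_eLpNorm (p := ENNReal.ofReal 1) (by simp)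
    (fun n => (avg_smooth hPl (eseq_pos n)).continuous.aestronglyMeasurable)
    hPm.aestronglyMeasurable ht
  obtain ⟨ns, _, hns⟩ := hmeas.exists_seq_tendsto_ae
  have hlim : ∀ᵐ x : E3, Tendsto (fun k => cut R x ^ 3 * avg p (eseq (ns k)) x) atTop
      (𝓝 (cut R x ^ 3 * p x)) := by
    filter_upwards [hns] with x hx
    by_cases hx2 : ‖x‖ ≤ 2 * R
    · have e : ∀ k, avg p (eseq (ns k)) x = avg (ind (2 * R + 2) p) (eseq (ns k)) x := fun k =>
        avg_ind (eseq_pos _) (eseq_le _) hx2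
      simp only [e]
      rw [ind_of_le (by linarith)] at hx
      exact hx.const_mul _
    · rw [cut_eq_zero hR (by linarith [not_le.mp hx2])]
      simp
  have hcm : Measurable (cut R) := (cut_smooth R).continuous.measurable
  have hfat := Lp.eLpNorm_lim_le_liminf_eLpNorm (p := ENNReal.ofReal 2) (μ := (volume : Measure E3))
    (f := fun k x => cut R x ^ 3 * avg p (eseq (ns k)) x)
    (fun k => ((hcm.pow_const 3).mul
      (avg_smooth pl (eseq_pos (ns k))).continuous.measurable).aestronglyMeasurable)
    _ hlim
  refine ne_top_of_le_ne_top (b := ENNReal.ofReal M) ENNReal.ofReal_ne_top (hfat.trans ?_)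
  refine liminf_le_of_frequently_le' ?_
  exact Frequently.of_forall fun k => key (ns k)

end

noncomputable section

open MeasureTheory Metric Filter Topology Set
open scoped ENNReal NNReal

/-! ### Basic estimates for the density -/

lemma nr_mul {a b c : ℝ} (ha : 0 < a) (hb : 0 < b) (hc : 0 < c) (habc : a⁻¹ + b⁻¹ = c⁻¹)
    {f g : E3 → ℝ} (hf : Measurable f) (hg : Measurable g) :
    nr c (fun x => f x * g x) ≤ nr a f * nr b g := by
  have : ENNReal.HolderTriple (ENNReal.ofReal a) (ENNReal.ofReal b) (ENNReal.ofReal c) := by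
    constructor
    rw [← ENNReal.ofReal_inv_of_pos ha, ← ENNReal.ofReal_inv_of_pos hb,
      ← ENNReal.ofReal_inv_of_pos hc, ← ENNReal.ofReal_add (by positivity) (by positivity), habc]
  exact eLpNorm_smul_le_mul_eLpNorm (φ := f) (f := g) hg.aestronglyMeasurable
    hf.aestronglyMeasurable

def cB : ℝ := max 1 (volume (ball (0 : E3) 1)).toReal

lemma one_le_cB : 1 ≤ cB := le_max_left _ _

lemma nr_ind_holder {f : E3 → ℝ} (hf : Measurable f) {r s t : ℝ} (hr : 0 < r) (hs : 1 ≤ s)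
    (hst : s ≤ t) :
    nr s (ind r f) ≤ ENNReal.ofReal (cB * r ^ (3 / s - 3 / t)) * nr t (ind r f) := by
  have ht : 1 ≤ t := hs.trans hst
  have e : ∀ q : ℝ, nr q (ind r f) = eLpNorm f (ENNReal.ofReal q) (volume.restrict (closedBall 0 r)) :=
    fun q => eLpNorm_indicator_eq_eLpNorm_restrict measurableSet_closedBall
  rw [e, e]
  refine (eLpNorm_le_eLpNorm_mul_rpow_measure_univ (ENNReal.ofReal_le_ofReal hst)
    hf.aestronglyMeasurable).trans ?_
  rw [mul_comm, ENNReal.toReal_ofReal (by linarith), ENNReal.toReal_ofReal (by linarith),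
    Measure.restrict_apply_univ, Measure.addHaar_closedBall _ _ hr.le, finrankE3]
  gcongr
  have h0 : 0 ≤ 1 / s - 1 / t := by
    have := one_div_le_one_div_of_le (by linarith : 0 < s) hst; linarith
  have h1 : 1 / s - 1 / t ≤ 1 := by
    have : 1 / s ≤ 1 := by rw [div_le_one (by linarith)]; exact hs
    have : 0 ≤ 1 / t := by positivity
    linarith
  rw [ENNReal.mul_rpow_of_nonneg _ _ h0, mul_comm, ENNReal.ofReal_mul (by linarith [one_le_cB])]
  gcongr
  · have hfin : volume (ball (0 : E3) 1) ≠ ⊤ := measure_ball_lt_top.ne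
    have : volume (ball (0 : E3) 1) ≤ ENNReal.ofReal cB := by
      rw [← ENNReal.ofReal_toReal hfin]; exact ENNReal.ofReal_le_ofReal (le_max_right _ _)
    refine (ENNReal.rpow_le_rpow this h0).trans ?_
    have h2 : (1 : ℝ≥0∞) ≤ ENNReal.ofReal cB := by
      rw [← ENNReal.ofReal_one]; exact ENNReal.ofReal_le_ofReal one_le_cB
    calc _ ≤ ENNReal.ofReal cB ^ (1 : ℝ) := ENNReal.rpow_le_rpow_of_exponent_le h2 h1
      _ = _ := ENNReal.rpow_one _
  · rw [ENNReal.ofReal_rpow_of_pos (by positivity), ← Real.rpow_natCast, ← Real.rpow_mul hr.le]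
    apply le_of_eq; congr 2; push_cast; ring

/-- exterior truncation -/
def out (r : ℝ) (f : E3 → ℝ) : E3 → ℝ := ((closedBall (0 : E3) r)ᶜ).indicator f

lemma out_of_le {r : ℝ} {x : E3} (h : ‖x‖ ≤ r) (f : E3 → ℝ) : out r f x = 0 :=
  indicator_of_notMem (by simpa using h) f
lemma out_of_lt {r : ℝ} {x : E3} (h : r < ‖x‖) (f : E3 → ℝ) : out r f x = f x :=
  indicator_of_mem (by simpa using h) f
lemma abs_out_le (r : ℝ) (f : E3 → ℝ) (x : E3) : |out r f x| ≤ |f x| := by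
  by_cases h : ‖x‖ ≤ r
  · rw [out_of_le h]; simp
  · rw [out_of_lt (not_le.mp h)]
lemma out_meas {f : E3 → ℝ} (hf : Measurable f) (r : ℝ) : Measurable (out r f) :=
  hf.indicator measurableSet_closedBall.compl
lemma ind_add_out (r : ℝ) (f : E3 → ℝ) (x : E3) : ind r f x + out r f x = f x := by
  by_cases h : ‖x‖ ≤ r
  · rw [out_of_le h, ind_of_le h]; simp
  · rw [out_of_lt (not_le.mp h), ind_of_lt (not_le.mp h)]; simp

lemma tail_small {f : E3 → ℝ} (hf : Measurable f) {s : ℝ} (h : nr s f ≠ ⊤) {δ : ℝ} (hδ : 0 < δ) :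
    ∃ M₀ : ℝ, ∀ M ≥ M₀, nr s (out M f) ≤ ENNReal.ofReal δ := by
  obtain ⟨g, hg, hfg, -⟩ := MemLp.exists_hasCompactSupport_eLpNorm_sub_le (ENNReal.ofReal_ne_top)
    (⟨hf.aestronglyMeasurable, lt_top_iff_ne_top.mpr h⟩ : MemLp f (ENNReal.ofReal s) volume)
    (ε := ENNReal.ofReal δ) (by simpa using hδ)
  obtain ⟨r, hr⟩ := hg.isCompact.isBounded.subset_closedBall (0 : E3)
  refine ⟨r, fun M hM => le_trans (nr_mono fun x => ?_) hfg⟩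
  by_cases hx : ‖x‖ ≤ M
  · rw [out_of_le hx]; simp
  · rw [out_of_lt (not_le.mp hx)]
    have : x ∉ tsupport g := fun hxs => by
      have := hr hxs; simp at this; linarith [not_le.mp hx]
    simp [image_eq_zero_of_notMem_tsupport this]

lemma tail_small3 {f : Fin 3 → E3 → ℝ} (hf : ∀ i, Measurable (f i)) {s : ℝ}
    (h : ∀ i, nr s (f i) ≠ ⊤) {δ : ℝ} (hδ : 0 < δ) :
    ∃ M : ℝ, 0 < M ∧ ∀ i, nr s (out M (f i)) ≤ ENNReal.ofReal δ := by
  choose M₀ hM₀ using fun i => tail_small (hf i) (h i) hδ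
  refine ⟨max 1 (max (M₀ 0) (max (M₀ 1) (M₀ 2))), by positivity, fun i => hM₀ i _ ?_⟩
  fin_cases i <;> simp

lemma nr_pow {f : E3 → ℝ} {s t : ℝ} (hs : 0 < s) (n : ℕ) (hn : n ≠ 0) (hst : t = n * s) :
    nr s (fun x => f x ^ n) = nr t f ^ n := by
  have hn' : (0:ℝ) < n := by positivity
  rw [nr_eq hs, nr_eq (by rw [hst]; positivity), ← ENNReal.rpow_natCast, ← ENNReal.rpow_mul]
  have : ∀ x, ‖f x ^ n‖ₑ ^ s = ‖f x‖ₑ ^ t := by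
    intro x
    rw [enorm_pow, ← ENNReal.rpow_natCast, ← ENNReal.rpow_mul, hst]
  simp only [this]
  congr 1
  rw [hst]; field_simp

def qG (γ : ℝ) : ℝ := 6 * γ / (5 * γ - 6)

structure Core (γ : ℝ) (ρ : E3 → ℝ) (u : Fin 3 → E3 → ℝ) (S : Fin 3 → Fin 3 → E3 → ℝ)
    (dG : Fin 3 → E3 → ℝ) : Prop where
  hγ : 3 ≤ γ
  ρm : Measurable ρ
  um : ∀ i, Measurable (u i)
  Sm' : ∀ i j, Measurable (S i j)
  dGm : ∀ i, Measurable (dG i)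
  ρ0 : ∀ x, 0 ≤ ρ x
  pl : LocallyIntegrable (fun x => ρ x ^ γ) volume
  u6 : ∀ i, nr 6 (u i) ≠ ⊤
  S2 : ∀ i j, nr 2 (S i j) ≠ ⊤
  dGq : ∀ i, nr (qG γ) (dG i) ≠ ⊤
  weq : WEq (fun x => ρ x ^ γ) (fun i j x => S i j x - ρ x * u i x * u j x)
    (fun i x => ρ x * dG i x)

lemma young32 {ρ s δ : ℝ} (hρ : 0 ≤ ρ) (hs : 0 ≤ s) (hδ : 0 < δ) :
    ρ * s ^ 2 ≤ δ * ρ ^ 3 + s ^ 3 / Real.sqrt δ := by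
  have hq := Real.sqrt_pos.mpr hδ
  have hq2 := Real.sq_sqrt hδ.le
  set c := Real.sqrt δ
  have hs3 : 0 ≤ s ^ 3 / c := by positivity
  have hr3 : 0 ≤ δ * ρ ^ 3 := by positivity
  rcases le_total s (c * ρ) with h | h
  · have : s ^ 2 ≤ (c * ρ) ^ 2 := by gcongr
    have h2 := mul_le_mul_of_nonneg_left this hρ
    have : ρ * (c * ρ) ^ 2 = δ * ρ ^ 3 := by rw [← hq2]; ring
    linarith
  · have : ρ ≤ s / c := by rw [le_div_iff₀ hq]; linarith
    have h2 := mul_le_mul_of_nonneg_right this (sq_nonneg s)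
    have : s / c * s ^ 2 = s ^ 3 / c := by ring
    linarith

lemma pow_le_one_add_rpow {ρ a b : ℝ} (hρ : 0 ≤ ρ) (ha : 0 ≤ a) (hab : a ≤ b) : ρ ^ a ≤ 1 + ρ ^ b := by
  rcases le_total ρ 1 with h | h
  · have := Real.rpow_le_one hρ h ha
    have := Real.rpow_nonneg hρ b
    linarith
  · have := Real.rpow_le_rpow_of_exponent_le h hab
    linarith

lemma qG_pos {γ : ℝ} (hγ : 3 ≤ γ) : 0 < qG γ := by
  unfold qG; apply div_pos <;> linarith

lemma qG_inv {γ : ℝ} (hγ : 3 ≤ γ) : γ⁻¹ + (qG γ)⁻¹ = (6/5 : ℝ)⁻¹ := by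
  unfold qG
  have : 5 * γ - 6 ≠ 0 := by linarith
  field_simp; ring

namespace Core

variable {γ : ℝ} {ρ : E3 → ℝ} {u : Fin 3 → E3 → ℝ} {S : Fin 3 → Fin 3 → E3 → ℝ}
    {dG : Fin 3 → E3 → ℝ}

lemma γpos (H : Core γ ρ u S dG) : 0 < γ := by linarith [H.hγ]

lemma pm (H : Core γ ρ u S dG) : Measurable (fun x => ρ x ^ γ) := H.ρm.pow_const γ

lemma Fm (H : Core γ ρ u S dG) (i j : Fin 3) :
    Measurable (fun x => S i j x - ρ x * u i x * u j x) :=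
  (H.Sm' i j).sub ((H.ρm.mul (H.um i)).mul (H.um j))

lemma hm (H : Core γ ρ u S dG) (i : Fin 3) : Measurable (fun x => ρ x * dG i x) :=
  H.ρm.mul (H.dGm i)

def U (u : Fin 3 → E3 → ℝ) (x : E3) : ℝ := |u 0 x| + |u 1 x| + |u 2 x|

lemma U_nonneg (u : Fin 3 → E3 → ℝ) (x : E3) : 0 ≤ U u x := by unfold U; positivity

lemma le_U (u : Fin 3 → E3 → ℝ) (i : Fin 3) (x : E3) : |u i x| ≤ U u x := by
  unfold U
  have := abs_nonneg (u 0 x); have := abs_nonneg (u 1 x); have := abs_nonneg (u 2 x)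
  fin_cases i <;> simp <;> linarith

lemma Um (H : Core γ ρ u S dG) : Measurable (U u) :=
  ((H.um 0).abs.add (H.um 1).abs).add (H.um 2).abs

lemma U6 (H : Core γ ρ u S dG) : nr 6 (U u) ≠ ⊤ := by
  have a : ∀ i, nr 6 (fun x => |u i x|) = nr 6 (u i) := fun i =>
    le_antisymm (nr_mono fun x => by simp) (nr_mono fun x => by simp)
  refine ne_top_of_le_ne_top ?_ ((nr_add (by norm_num) ((H.um 0).abs.add (H.um 1).abs) (H.um 2).abs).trans
    (add_le_add_left (nr_add (by norm_num) (H.um 0).abs (H.um 1).abs) _))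
  rw [a, a, a]
  exact ENNReal.add_ne_top.mpr ⟨ENNReal.add_ne_top.mpr ⟨H.u6 0, H.u6 1⟩, H.u6 2⟩

lemma ruu_le (H : Core γ ρ u S dG) (i j : Fin 3) {δ : ℝ} (hδ : 0 < δ) (x : E3) :
    |ρ x * u i x * u j x| ≤ δ * ρ x ^ γ + (δ + U u x ^ 3 / Real.sqrt δ) := by
  have h1 := young32 (H.ρ0 x) (U_nonneg u x) hδ
  have h2 := pow_le_one_add_rpow (H.ρ0 x) (by norm_num : (0:ℝ) ≤ 3) H.hγ
  have h3 : ρ x ^ (3:ℝ) = ρ x ^ 3 := by norm_cast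
  rw [h3] at h2
  have h4 : |ρ x * u i x * u j x| ≤ ρ x * U u x ^ 2 := by
    rw [abs_mul, abs_mul, abs_of_nonneg (H.ρ0 x), mul_assoc, sq]
    exact mul_le_mul_of_nonneg_left (mul_le_mul (le_U u i x) (le_U u j x) (abs_nonneg _)
      (U_nonneg u x)) (H.ρ0 x)
  nlinarith

lemma W_ex (H : Core γ ρ u S dG) {δ : ℝ} (hδ : 0 < δ) : ∃ W : E3 → ℝ, Measurable W ∧
    (∀ r, nr 2 (ind r W) ≠ ⊤) ∧
      ∀ i j x, |S i j x - ρ x * u i x * u j x| ≤ δ * ρ x ^ γ + W x := by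
  refine ⟨fun x => (∑ i, ∑ j, |S i j x|) + (δ + U u x ^ 3 / Real.sqrt δ), ?_, ?_, ?_⟩
  · exact (Finset.measurable_sum _ fun i _ => Finset.measurable_sum _ fun j _ => (H.Sm' i j).abs).add
      (measurable_const.add ((H.Um.pow_const 3).div_const _))
  · intro r
    have mS : MemLp (fun x => ∑ i, ∑ j, |S i j x|) 2 volume := by
      apply memLp_finsetSum
      intro i _
      apply memLp_finsetSum
      intro j _
      have : MemLp (S i j) 2 volume := ⟨(H.Sm' i j).aestronglyMeasurable, by
        rw [← nr_two]; exact lt_top_iff_ne_top.mpr (H.S2 i j)⟩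
      exact this.abs
    have mU : MemLp (fun x => U u x ^ 3 / Real.sqrt δ) 2 volume := by
      have : MemLp (fun x => U u x ^ 3) 2 volume := ⟨(H.Um.pow_const 3).aestronglyMeasurable, by
        rw [← nr_two, nr_pow two_pos 3 (by norm_num) (by norm_num : (6:ℝ) = (3:ℕ) * 2)]
        exact ENNReal.pow_lt_top (lt_top_iff_ne_top.mpr H.U6)⟩
      simpa only [div_eq_mul_inv] using this.mul_const _
    have : MemLp (fun x => (∑ i, ∑ j, |S i j x|) + (δ + U u x ^ 3 / Real.sqrt δ)) 2
        (volume.restrict (closedBall (0:E3) r)) := by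
      have : IsFiniteMeasure (volume.restrict (closedBall (0 : E3) r)) :=
        ⟨by rw [Measure.restrict_apply_univ]; exact measure_closedBall_lt_top⟩
      exact (mS.restrict _).add ((memLp_const δ).add (mU.restrict _))
    rw [nr_two]
    unfold ind
    rw [eLpNorm_indicator_eq_eLpNorm_restrict measurableSet_closedBall]
    exact this.2.ne
  · intro i j x
    have h1 := H.ruu_le i j hδ x
    have h2 : |S i j x| ≤ ∑ i, ∑ j, |S i j x| :=
      (Finset.single_le_sum (f := fun j => |S i j x|) (fun _ _ => abs_nonneg _) (Finset.mem_univ j)).trans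
       (Finset.single_le_sum (f := fun i => ∑ j, |S i j x|)
        (fun _ _ => Finset.sum_nonneg fun _ _ => abs_nonneg _) (Finset.mem_univ i))
    have h3 := abs_sub (S i j x) (ρ x * u i x * u j x)
    simp only
    linarith

lemma Fl (H : Core γ ρ u S dG) (i j : Fin 3) :
    LocallyIntegrable (fun x => S i j x - ρ x * u i x * u j x) volume := by
  obtain ⟨W, Wm, W2, hW⟩ := H.W_ex one_pos
  have Wl : LocallyIntegrable W volume := li_of_ind
    (fun r => nr_ind_finite_of_le Wm (by norm_num) (W2 r)) Wm
  have := H.pl.add Wl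
  refine this.mono (H.Fm i j).aestronglyMeasurable (Eventually.of_forall fun x => ?_)
  have := hW i j x
  rw [one_mul] at this
  rw [Real.norm_eq_abs, Real.norm_eq_abs]
  exact this.trans (le_abs_self _)

lemma p_ind (H : Core γ ρ u S dG) (r : ℝ) : nr γ (ind r ρ) ^ γ = nr 1 (ind r (fun x => ρ x ^ γ)) := by
  rw [nr_rpow H.γpos, nr_eq one_pos, div_one, ENNReal.rpow_one]
  congr 1; funext x
  rw [ENNReal.rpow_one]
  by_cases hx : ‖x‖ ≤ r
  · rw [ind_of_le hx, ind_of_le hx, Real.enorm_of_nonneg (H.ρ0 x),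
      Real.enorm_of_nonneg (Real.rpow_nonneg (H.ρ0 x) _), ENNReal.ofReal_rpow_of_nonneg (H.ρ0 x) H.γpos.le]
  · rw [ind_of_lt (not_le.mp hx), ind_of_lt (not_le.mp hx)]
    simp [H.γpos]

lemma ρ_fin (H : Core γ ρ u S dG) (r : ℝ) : nr γ (ind r ρ) ≠ ⊤ := by
  intro h
  have := H.p_ind r
  rw [h, ENNReal.top_rpow_of_pos H.γpos] at this
  exact ind_of_li H.pl r this.symm

lemma h65_le (H : Core γ ρ u S dG) (r : ℝ) {g : E3 → ℝ} (hg : Measurable g) :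
    nr (6/5) (ind r (fun x => ρ x * g x)) ≤ nr γ (ind r ρ) * nr (qG γ) g := by
  refine le_trans (nr_mono fun x => ?_) (nr_mul H.γpos (qG_pos H.hγ) (by norm_num) (qG_inv H.hγ)
    (ind_meas H.ρm r) hg)
  by_cases hx : ‖x‖ ≤ r
  · rw [ind_of_le hx, ind_of_le hx]
  · rw [ind_of_lt (not_le.mp hx), abs_zero]; positivity

lemma h65 (H : Core γ ρ u S dG) (i : Fin 3) (r : ℝ) : nr (6/5) (ind r (fun x => ρ x * dG i x)) ≠ ⊤ :=
  ne_top_of_le_ne_top (ENNReal.mul_ne_top (H.ρ_fin r) (H.dGq i)) (H.h65_le r (H.dGm i))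

lemma hl (H : Core γ ρ u S dG) (i : Fin 3) : LocallyIntegrable (fun x => ρ x * dG i x) volume :=
  li_of_ind (fun r => nr_ind_finite_of_le (H.hm i) (by norm_num) (H.h65 i r)) (H.hm i)

lemma X_fin (H : Core γ ρ u S dG) {R : ℝ} (hR : 0 < R) :
    nr 2 (fun x => cut R x ^ 3 * ρ x ^ γ) ≠ ⊤ :=
  stepA H.pm H.Fm H.hm H.pl H.Fl H.hl H.weq (fun _ hδ => H.W_ex hδ) H.h65 hR

lemma p2_fin (H : Core γ ρ u S dG) (r : ℝ) : nr 2 (ind r (fun x => ρ x ^ γ)) ≠ ⊤ := by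
  have hR : 0 < |r| + 1 := by positivity
  refine ne_top_of_le_ne_top (H.X_fin hR) (nr_mono fun x => ?_)
  by_cases hx : ‖x‖ ≤ r
  · rw [ind_of_le hx, cut_eq_one hR (by linarith [le_abs_self r])]; simp
  · rw [ind_of_lt (not_le.mp hx), abs_zero]; positivity

end Core

end

noncomputable section

open MeasureTheory Metric Filter Topology Set
open scoped ENNReal NNReal

/-! ### Improved bound for the mass of the pressure -/

lemma pd_coord (i j : Fin 3) (x : E3) : pd (fun y : E3 => y i) j x = if i = j then 1 else 0 := by
  unfold pd
  have : (fun y : E3 => y i) = (EuclideanSpace.proj i : E3 →L[ℝ] ℝ) := by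
    funext y; rfl
  rw [this, ContinuousLinearMap.fderiv]
  simp

lemma coord_smooth (i : Fin 3) : Sm (fun y : E3 => y i) :=
  (EuclideanSpace.proj i : E3 →L[ℝ] ℝ).contDiff

lemma abs_coord_le (i : Fin 3) (x : E3) : |x i| ≤ ‖x‖ := PiLp.norm_apply_le x i

lemma norm_sq_eq (x : E3) : ‖x‖ ^ 2 = ∑ i, x i ^ 2 := by
  rw [EuclideanSpace.norm_sq_eq]; simp

def ww (R : ℝ) (x : E3) : ℝ := (R ^ 2 + ‖x‖ ^ 2) ^ (-(3/2) : ℝ)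

lemma ww_smooth {R : ℝ} (hR : 0 < R) : Sm (ww R) := by
  unfold ww
  apply ContDiff.rpow_const_of_ne
  · exact contDiff_const.add (contDiff_norm_sq ℝ)
  · intro x; positivity

lemma pd_ww {R : ℝ} (hR : 0 < R) (j : Fin 3) (x : E3) :
    pd (ww R) j x = -3 * x j * (R ^ 2 + ‖x‖ ^ 2) ^ (-(5/2) : ℝ) := by
  have h0 : HasFDerivAt (fun y : E3 => R ^ 2 + ‖y‖ ^ 2) (2 • innerSL ℝ x) x :=
    (hasStrictFDerivAt_norm_sq x).hasFDerivAt.const_add _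
  have h1 := h0.rpow_const (p := (-(3/2) : ℝ)) (Or.inl (by positivity))
  unfold pd
  have e : ww R = fun y => (R ^ 2 + ‖y‖ ^ 2) ^ (-(3/2) : ℝ) := rfl
  rw [e, h1.fderiv]
  have e2 : (-(3/2) : ℝ) - 1 = -(5/2) := by norm_num
  rw [e2]
  simp [EuclideanSpace.inner_single_right]
  ring

lemma xw_smooth {R : ℝ} (hR : 0 < R) (i : Fin 3) : Sm (fun x => x i * ww R x) :=
  (coord_smooth i).mul (ww_smooth hR)

lemma pd_xw {R : ℝ} (hR : 0 < R) (i j : Fin 3) (x : E3) :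
    pd (fun x => x i * ww R x) j x = (if i = j then 1 else 0) * ww R x
      + x i * (-3 * x j * (R ^ 2 + ‖x‖ ^ 2) ^ (-(5/2) : ℝ)) := by
  rw [pd_mul ((coord_smooth i).differentiable (by simp) x) ((ww_smooth hR).differentiable (by simp) x),
    pd_coord, pd_ww hR]

lemma ss_facts {R : ℝ} (hR : 0 < R) (x : E3) :
    ww R x = (R ^ 2 + ‖x‖ ^ 2) * (R ^ 2 + ‖x‖ ^ 2) ^ (-(5/2) : ℝ) ∧ 0 < (R ^ 2 + ‖x‖ ^ 2) ^ (-(5/2) : ℝ) ∧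
    ∀ r, 0 < r → r ^ 2 ≤ R ^ 2 + ‖x‖ ^ 2 → ww R x ≤ 1 / r ^ 3 ∧ ‖x‖ * ww R x ≤ 1 / r ^ 2 := by
  have hs : 0 < R ^ 2 + ‖x‖ ^ 2 := by positivity
  refine ⟨?_, by positivity, ?_⟩
  · unfold ww
    rw [← Real.rpow_one_add' hs.le (by norm_num)]; norm_num
  · intro r hr hrs
    set t := Real.sqrt (R ^ 2 + ‖x‖ ^ 2) with ht
    have ht0 : 0 < t := Real.sqrt_pos.mpr hs
    have hw : ww R x = 1 / t ^ 3 := by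
      unfold ww
      rw [ht, Real.sqrt_eq_rpow, ← Real.rpow_natCast (_ ^ (1/2:ℝ)) 3, ← Real.rpow_mul hs.le, Real.rpow_neg hs.le]
      norm_num
    have hrt : r ≤ t := Real.le_sqrt_of_sq_le hrs
    have hxt : ‖x‖ ≤ t := Real.le_sqrt_of_sq_le (by nlinarith)
    rw [hw]
    constructor
    · gcongr
    · calc ‖x‖ * (1 / t ^ 3) ≤ t * (1 / t ^ 3) := by gcongr
        _ = 1 / t ^ 2 := by field_simp
        _ ≤ _ := by gcongr

lemma int_bd {f g : E3 → ℝ} (hf : LocallyIntegrable f volume) {r c : ℝ} (hc : 0 ≤ c)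
    (hg : ∀ x, |g x| ≤ c) (hg0 : ∀ x, r < ‖x‖ → g x = 0) :
    |∫ x, f x * g x| ≤ c * (nr 1 (ind r f)).toReal := by
  have hi : Integrable (ind r f) volume :=
    (integrable_indicator_iff measurableSet_closedBall).mpr
      (hf.integrableOn_isCompact (isCompact_closedBall 0 r))
  have e : (nr 1 (ind r f)).toReal = ∫ x, ‖ind r f x‖ := by
    rw [integral_norm_eq_lintegral_enorm hi.aestronglyMeasurable]
    unfold nr
    rw [ENNReal.ofReal_one, eLpNorm_one_eq_lintegral_enorm]
  rw [e, ← integral_const_mul]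
  rw [← Real.norm_eq_abs]
  refine (norm_integral_le_of_norm_le (hi.norm.const_mul c) (Eventually.of_forall fun x => ?_))
  by_cases hx : ‖x‖ ≤ r
  · rw [ind_of_le hx, norm_mul, mul_comm]
    exact mul_le_mul_of_nonneg_right (hg x) (norm_nonneg _)
  · rw [hg0 x (not_le.mp hx)]; simp; positivity

lemma N_real {p : E3 → ℝ} {F : Fin 3 → Fin 3 → E3 → ℝ} {h : Fin 3 → E3 → ℝ}
    (p0 : ∀ x, 0 ≤ p x)
    (pl : LocallyIntegrable p volume) (Fl : ∀ i j, LocallyIntegrable (F i j) volume)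
    (hl : ∀ i, LocallyIntegrable (h i) volume) (heq : WEq p F h) {R K : ℝ} (hR : 0 < R) (hK : 1 ≤ K) :
    (nr 1 (ind R p)).toReal ≤ 2 * ((Cθ + 4) * (∑ i, ∑ j, (nr 1 (ind (2 * (K * R)) (F i j))).toReal)
      + R * (∑ i, (nr 1 (ind (2 * (K * R)) (h i))).toReal)
      + 3 * Cθ / K ^ 3 * (nr 1 (ind (2 * (K * R)) p)).toReal) := by
  have hKR : 0 < K * R := by positivity
  have hC := one_le_Cθ
  set θ := cut (K * R) with hθ
  have θs : Sm θ := cut_smooth _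
  set φ : Fin 3 → E3 → ℝ := fun i x => θ x * (x i * ww R x) with hφ
  have φs : ∀ i, Sm (φ i) := fun i => θs.mul (xw_smooth hR i)
  have φc : ∀ i, HasCompactSupport (φ i) := fun i => hcs_mul_left (cut_hcs hKR)
  have pdφ : ∀ i j x, pd (φ i) j x = pd θ j x * (x i * ww R x) + θ x * pd (fun x => x i * ww R x) j x :=
    fun i j x => pd_mul (θs.differentiable (by simp) x) ((xw_smooth hR i).differentiable (by simp) x) j
  have w0 : ∀ x, 0 ≤ ww R x := fun x => by unfold ww; positivity
  have zero_out : ∀ x : E3, 2 * (K * R) < ‖x‖ → θ x = 0 := fun x hx => cut_eq_zero hKR (by linarith)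
  have pzero_out : ∀ (x : E3) j, 2 * (K * R) < ‖x‖ → pd θ j x = 0 := fun x j hx =>
    pd_cut_eq_zero_out hKR (by linarith) j
  have xw : ∀ i x, |x i * ww R x| ≤ ‖x‖ * ww R x := fun i x => by
    rw [abs_mul, abs_of_nonneg (w0 x)]
    exact mul_le_mul_of_nonneg_right (abs_coord_le i x) (w0 x)
  have xw2 : ∀ i x, |x i * ww R x| ≤ 1 / R ^ 2 := fun i x =>
    (xw i x).trans ((ss_facts hR x).2.2 R hR (by nlinarith [sq_nonneg ‖x‖])).2
  have θabs : ∀ x, |θ x| ≤ 1 := fun x => by rw [abs_of_nonneg (cut_nonneg _ x)]; exact cut_le_one _ x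
  have bφ : ∀ i x, |φ i x| ≤ 1 / R ^ 2 := fun i x => by
    rw [hφ]; simp only; rw [abs_mul]
    exact (mul_le_of_le_one_left (abs_nonneg _) (θabs x)).trans (xw2 i x)
  have bpxw : ∀ i j x, |pd (fun x => x i * ww R x) j x| ≤ 4 / R ^ 3 := by
    intro i j x
    rw [pd_xw hR]
    obtain ⟨h1, h2, h3⟩ := ss_facts hR x
    have h4 := (h3 R hR (by nlinarith [sq_nonneg ‖x‖])).1
    set s5 := (R ^ 2 + ‖x‖ ^ 2) ^ (-(5/2) : ℝ)
    have hx : |x i * (-3 * x j * s5)| ≤ 3 * ww R x := by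
      have e : |x i * (-3 * x j * s5)| = 3 * (|x i| * |x j| * s5) := by
        simp only [abs_mul, abs_of_pos h2]; norm_num; ring
      rw [e, h1]
      have : |x i| * |x j| ≤ ‖x‖ * ‖x‖ :=
        mul_le_mul (abs_coord_le i x) (abs_coord_le j x) (abs_nonneg _) (norm_nonneg _)
      have : |x i| * |x j| ≤ R ^ 2 + ‖x‖ ^ 2 := by nlinarith
      nlinarith
    have hi : |(if i = j then (1:ℝ) else 0) * ww R x| ≤ ww R x := by
      split_ifs <;> simp [abs_of_nonneg (w0 x), w0 x]
    calc _ ≤ _ := abs_add_le _ _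
      _ ≤ 4 * ww R x := by linarith
      _ ≤ 4 * (1 / R ^ 3) := by gcongr
      _ = _ := by ring
  have bpφ : ∀ i j x, |pd (φ i) j x| ≤ (Cθ + 4) / R ^ 3 := by
    intro i j x
    rw [pdφ]
    have h1 : |pd θ j x * (x i * ww R x)| ≤ Cθ / R * (1 / R ^ 2) := by
      rw [abs_mul]
      refine mul_le_mul ((pd_cut_le hKR j x).trans ?_) (xw2 i x) (abs_nonneg _) (by positivity)
      gcongr
      nlinarith
    have h2 : |θ x * pd (fun x => x i * ww R x) j x| ≤ 4 / R ^ 3 := by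
      rw [abs_mul]
      exact (mul_le_of_le_one_left (abs_nonneg _) (θabs x)).trans (bpxw i j x)
    calc _ ≤ _ := abs_add_le _ _
      _ ≤ Cθ / R * (1 / R ^ 2) + 4 / R ^ 3 := add_le_add h1 h2
      _ = _ := by field_simp
  have brem : ∀ i x, |pd θ i x * (x i * ww R x)| ≤ Cθ / (K * R) ^ 3 := by
    intro i x
    by_cases hx : ‖x‖ < K * R
    · rw [pd_cut_eq_zero_in hKR hx]; simp; positivity
    · push Not at hx
      have := ((ss_facts hR x).2.2 (K * R) hKR (by nlinarith)).2
      rw [abs_mul]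
      calc _ ≤ Cθ / (K * R) * (1 / (K * R) ^ 2) :=
            mul_le_mul (pd_cut_le hKR i x) ((xw i x).trans this) (abs_nonneg _) (by positivity)
        _ = _ := by field_simp
  -- the identity
  have key := heq φ φs φc
  have iF : ∀ i j, |∫ x, F i j x * pd (φ i) j x| ≤
      (Cθ + 4) / R ^ 3 * (nr 1 (ind (2 * (K * R)) (F i j))).toReal := fun i j =>
    int_bd (Fl i j) (by positivity) (bpφ i j) fun x hx => by
      rw [pdφ, zero_out x hx, pzero_out x j hx]; simp
  have ih : ∀ i, |∫ x, h i x * φ i x| ≤ 1 / R ^ 2 * (nr 1 (ind (2 * (K * R)) (h i))).toReal := fun i =>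
    int_bd (hl i) (by positivity) (bφ i) fun x hx => by
      simp only [hφ]; rw [zero_out x hx]; simp
  have ir : ∀ i, |∫ x, p x * (pd θ i x * (x i * ww R x))| ≤
      Cθ / (K * R) ^ 3 * (nr 1 (ind (2 * (K * R)) p)).toReal := fun i =>
    int_bd pl (by positivity) (brem i) fun x hx => by rw [pzero_out x i hx]; simp
  have c1 : ∀ i, Integrable (fun x => p x * (pd θ i x * (x i * ww R x))) volume := fun i =>
    li_mul pl ((contDiff_pd θs i).mul (xw_smooth hR i)).continuous
      (hcs_mul_left (hcs_pd (cut_hcs hKR) i))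
  have c2 : ∀ i, Integrable (fun x => p x * (θ x * pd (fun x => x i * ww R x) i x)) volume := fun i =>
    li_mul pl (θs.mul (contDiff_pd (xw_smooth hR i) i)).continuous (hcs_mul_left (cut_hcs hKR))
  have e1 : ∑ i, ∫ x, p x * pd (φ i) i x = (∑ i, ∫ x, p x * (pd θ i x * (x i * ww R x)))
      + ∫ x, p x * (θ x * (3 * R ^ 2 * (R ^ 2 + ‖x‖ ^ 2) ^ (-(5/2) : ℝ))) := by
    have : ∀ x, p x * (θ x * (3 * R ^ 2 * (R ^ 2 + ‖x‖ ^ 2) ^ (-(5/2) : ℝ))) =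
        ∑ i, p x * (θ x * pd (fun x => x i * ww R x) i x) := by
      intro x
      simp only [← Finset.mul_sum]
      congr 2
      simp only [pd_xw hR, Fin.sum_univ_three, (ss_facts hR x).1, norm_sq_eq x]
      simp; ring
    simp only [this]
    rw [integral_finsetSum _ fun i _ => c2 i, ← Finset.sum_add_distrib]
    congr 1; funext i
    rw [← integral_add (c1 i) (c2 i)]
    congr 1; funext x
    rw [pdφ]; ring
  have hind : Integrable (ind R p) volume :=
    (integrable_indicator_iff measurableSet_closedBall).mpr
      (pl.integrableOn_isCompact (isCompact_closedBall 0 R))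
  have eN : (nr 1 (ind R p)).toReal = ∫ x, ind R p x := by
    have a : ∫ x, ind R p x = ∫ x, ‖ind R p x‖ := by
      congr 1; funext x; rw [Real.norm_of_nonneg]; exact indicator_nonneg (fun _ _ => p0 _) _
    rw [a, integral_norm_eq_lintegral_enorm hind.aestronglyMeasurable]
    unfold nr
    rw [ENNReal.ofReal_one, eLpNorm_one_eq_lintegral_enorm]
  have low : 1 / (2 * R ^ 3) * (nr 1 (ind R p)).toReal ≤
      ∫ x, p x * (θ x * (3 * R ^ 2 * (R ^ 2 + ‖x‖ ^ 2) ^ (-(5/2) : ℝ))) := by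
    rw [eN, ← integral_const_mul]
    apply integral_mono (hind.const_mul _)
    · have cc : Continuous fun x : E3 => θ x * (3 * R ^ 2 * (R ^ 2 + ‖x‖ ^ 2) ^ (-(5/2) : ℝ)) := by
        apply θs.continuous.mul (continuous_const.mul _)
        apply Continuous.rpow_const (by fun_prop)
        intro x; left; positivity
      exact li_mul pl cc (hcs_mul_left (cut_hcs hKR))
    · intro x
      simp only
      by_cases hx : ‖x‖ ≤ R
      · rw [ind_of_le hx, hθ, cut_eq_one hKR (by nlinarith), one_mul, mul_comm]
        apply mul_le_mul_of_nonneg_left _ (p0 x)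
        have hs : 0 < R ^ 2 + ‖x‖ ^ 2 := by positivity
        have hle : R ^ 2 + ‖x‖ ^ 2 ≤ 2 * R ^ 2 := by nlinarith [norm_nonneg x]
        have h1 : (2 * R ^ 2) ^ (-(5/2) : ℝ) ≤ (R ^ 2 + ‖x‖ ^ 2) ^ (-(5/2) : ℝ) :=
          Real.rpow_le_rpow_of_nonpos hs hle (by norm_num)
        have h2 : (2 * R ^ 2 : ℝ) ^ (-(5/2) : ℝ) = (2:ℝ) ^ (-(5/2) : ℝ) * (1 / R ^ 5) := by
          rw [Real.mul_rpow (by norm_num) (by positivity), ← Real.rpow_natCast, ← Real.rpow_mul hR.le]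
          congr 1
          rw [one_div, ← Real.rpow_natCast, ← Real.rpow_neg hR.le]
          norm_num
        have h3 : (1:ℝ)/6 ≤ (2:ℝ) ^ (-(5/2) : ℝ) := by
          rw [Real.rpow_neg (by norm_num), one_div]
          apply inv_anti₀ (by positivity)
          have : (2:ℝ) ^ (5/2 : ℝ) = Real.sqrt 32 := by
            rw [Real.sqrt_eq_rpow]
            have : (32:ℝ) = 2 ^ (5:ℝ) := by norm_num
            rw [this, ← Real.rpow_mul (by norm_num)]; norm_num
          rw [this, Real.sqrt_le_left (by norm_num)]; norm_num
        calc 1 / (2 * R ^ 3) = 3 * R ^ 2 * (1 / 6 * (1 / R ^ 5)) := by field_simp; norm_num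
          _ ≤ 3 * R ^ 2 * ((2:ℝ) ^ (-(5/2) : ℝ) * (1 / R ^ 5)) := by gcongr
          _ = 3 * R ^ 2 * (2 * R ^ 2) ^ (-(5/2) : ℝ) := by rw [h2]
          _ ≤ _ := by gcongr
      · rw [ind_of_lt (not_le.mp hx), mul_zero]
        have := p0 x
        have := cut_nonneg (K * R) x
        positivity
  have s1 : |∑ i, ∫ x, p x * (pd θ i x * (x i * ww R x))| ≤
      3 * (Cθ / (K * R) ^ 3 * (nr 1 (ind (2 * (K * R)) p)).toReal) := by
    refine (Finset.abs_sum_le_sum_abs _ _).trans ((Finset.sum_le_sum fun i _ => ir i).trans ?_)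
    simp
  have s2 : |∑ i, ∑ j, ∫ x, F i j x * pd (φ i) j x| ≤
      (Cθ + 4) / R ^ 3 * ∑ i, ∑ j, (nr 1 (ind (2 * (K * R)) (F i j))).toReal := by
    refine (Finset.abs_sum_le_sum_abs _ _).trans ?_
    rw [Finset.mul_sum]
    apply Finset.sum_le_sum; intro i _
    refine (Finset.abs_sum_le_sum_abs _ _).trans ?_
    rw [Finset.mul_sum]
    exact Finset.sum_le_sum fun j _ => iF i j
  have s3 : |∑ i, ∫ x, h i x * φ i x| ≤
      1 / R ^ 2 * ∑ i, (nr 1 (ind (2 * (K * R)) (h i))).toReal := by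
    refine (Finset.abs_sum_le_sum_abs _ _).trans ?_
    rw [Finset.mul_sum]
    exact Finset.sum_le_sum fun i _ => ih i
  rw [e1] at key
  have b1 := neg_abs_le (∑ i, ∫ x, p x * (pd θ i x * (x i * ww R x)))
  have b2 := le_abs_self (∑ i, ∑ j, ∫ x, F i j x * pd (φ i) j x)
  have b3 := neg_abs_le (∑ i, ∫ x, h i x * φ i x)
  set n := (nr 1 (ind R p)).toReal
  set f := ∑ i, ∑ j, (nr 1 (ind (2 * (K * R)) (F i j))).toReal
  set g := ∑ i, (nr 1 (ind (2 * (K * R)) (h i))).toReal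
  set m := (nr 1 (ind (2 * (K * R)) p)).toReal
  have fin : 1 / (2 * R ^ 3) * n ≤ (Cθ + 4) / R ^ 3 * f + 1 / R ^ 2 * g + 3 * (Cθ / (K * R) ^ 3 * m) := by
    linarith
  have := mul_le_mul_of_nonneg_left fin (by positivity : 0 ≤ 2 * R ^ 3)
  calc n = 2 * R ^ 3 * (1 / (2 * R ^ 3) * n) := by field_simp
    _ ≤ _ := this
    _ = _ := by field_simp

end

noncomputable section

open MeasureTheory Metric Filter Topology Set
open scoped ENNReal NNReal

/-! ### Growth of the pressure in L² -/

def SmallE (E : ℝ) (Q : ℝ → ℝ≥0∞) : Prop :=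
  ∀ ε > 0, ∃ C : ℝ, 0 ≤ C ∧ ∀ R ≥ 1, Q R ≤ ENNReal.ofReal (ε * R ^ E + C)

lemma SmallE.mono {E : ℝ} {Q Q' : ℝ → ℝ≥0∞} (h : SmallE E Q) (hQ : ∀ R ≥ 1, Q' R ≤ Q R) : SmallE E Q' := by
  intro ε hε
  obtain ⟨C, hC, h1⟩ := h ε hε
  exact ⟨C, hC, fun R hR => (hQ R hR).trans (h1 R hR)⟩

lemma SmallE.add {E : ℝ} {Q Q' : ℝ → ℝ≥0∞} (h : SmallE E Q) (h' : SmallE E Q') :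
    SmallE E (fun R => Q R + Q' R) := by
  intro ε hε
  obtain ⟨C, hC, h1⟩ := h (ε / 2) (by positivity)
  obtain ⟨C', hC', h1'⟩ := h' (ε / 2) (by positivity)
  refine ⟨C + C', by positivity, fun R hR => ?_⟩
  have hR0 : 0 < R := by linarith
  refine (add_le_add (h1 R hR) (h1' R hR)).trans ?_
  rw [← ENNReal.ofReal_add (by positivity) (by positivity)]
  apply ENNReal.ofReal_le_ofReal
  linarith

lemma SmallE.const {E : ℝ} {c : ℝ≥0∞} (hc : c ≠ ⊤) : SmallE E (fun _ => c) := by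
  intro ε hε
  refine ⟨c.toReal, ENNReal.toReal_nonneg, fun R hR => ?_⟩
  have hR0 : 0 < R := by linarith
  conv_lhs => rw [← ENNReal.ofReal_toReal hc]
  apply ENNReal.ofReal_le_ofReal
  have : 0 ≤ ε * R ^ E := by positivity
  linarith

lemma SmallE.const_mul {E : ℝ} {Q : ℝ → ℝ≥0∞} (h : SmallE E Q) {c : ℝ≥0∞} (hc : c ≠ ⊤) :
    SmallE E (fun R => c * Q R) := by
  intro ε hε
  obtain ⟨C, hC, h1⟩ := h (ε / (c.toReal + 1)) (by positivity)
  have hc0 : 0 ≤ c.toReal := ENNReal.toReal_nonneg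
  refine ⟨c.toReal * C, by positivity, fun R hR => ?_⟩
  have hR0 : 0 < R := by linarith
  refine (mul_le_mul_right (h1 R hR) c).trans ?_
  nth_rewrite 1 [← ENNReal.ofReal_toReal hc]
  rw [← ENNReal.ofReal_mul hc0]
  apply ENNReal.ofReal_le_ofReal
  have : c.toReal * (ε / (c.toReal + 1) * R ^ E) ≤ ε * R ^ E := by
    rw [← mul_assoc]
    apply mul_le_mul_of_nonneg_right _ (by positivity)
    rw [mul_div_assoc', div_le_iff₀ (by positivity)]
    nlinarith
  linarith

lemma SmallE.sum {E : ℝ} {ι : Type*} (s : Finset ι) {Q : ι → ℝ → ℝ≥0∞} (h : ∀ i, SmallE E (Q i)) :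
    SmallE E (fun R => ∑ i ∈ s, Q i R) := by
  classical
  induction s using Finset.induction_on with
  | empty => simpa using SmallE.const (E := E) (c := 0) (by simp)
  | insert a s ha ih =>
    simp only [Finset.sum_insert ha]
    exact (h a).add ih

lemma SmallE.of_pow {E : ℝ} {Q : ℝ → ℝ≥0∞} {B : ℝ} (hB : 0 ≤ B)
    (h : ∀ δ > 0, ∃ c : ℝ≥0∞, c ≠ ⊤ ∧ ∀ R ≥ 1, Q R ≤ c + ENNReal.ofReal (δ * (B * R ^ E))) :
    SmallE E Q := by
  intro ε hε
  obtain ⟨c, hc, h1⟩ := h (ε / (B + 1)) (by positivity)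
  refine ⟨c.toReal, ENNReal.toReal_nonneg, fun R hR => (h1 R hR).trans ?_⟩
  have hR0 : 0 < R := by linarith
  conv_lhs => rw [← ENNReal.ofReal_toReal hc]
  rw [← ENNReal.ofReal_add ENNReal.toReal_nonneg (by positivity)]
  apply ENNReal.ofReal_le_ofReal
  have : ε / (B + 1) * (B * R ^ E) ≤ ε * R ^ E := by
    rw [← mul_assoc]
    apply mul_le_mul_of_nonneg_right _ (by positivity)
    rw [div_mul_eq_mul_div, div_le_iff₀ (by positivity)]
    nlinarith
  linarith

lemma half_absorb {x a : ℝ≥0∞} (hx : x ≠ ⊤) (h : x ≤ ENNReal.ofReal (1/2) * x + a) : x ≤ 2 * a := by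
  by_cases ha : a = ⊤
  · rw [ha]; simp
  lift x to ℝ≥0 using hx
  lift a to ℝ≥0 using ha
  have h2 : x ≤ (1/2 : ℝ).toNNReal * x + a := by
    rw [← ENNReal.coe_le_coe]; push_cast; exact h
  have h3 : (x : ℝ) ≤ 1/2 * x + a := by
    have : (x : ℝ) ≤ (((1/2 : ℝ).toNNReal * x + a : ℝ≥0) : ℝ) := by exact_mod_cast h2
    push_cast at this
    rwa [Real.coe_toNNReal _ (by norm_num)] at this
  have h4 : x ≤ 2 * a := by
    rw [← NNReal.coe_le_coe]; push_cast; linarith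
  exact_mod_cast h4

lemma amgm_e {x n : ℝ≥0∞} (hx : x ≠ ⊤) (hn : n ≠ ⊤) {A : ℝ} (hA : 0 ≤ A) :
    ENNReal.ofReal A * (x ^ (1/3 : ℝ) * n ^ (2/3 : ℝ)) ≤
      ENNReal.ofReal (1/3) * x + ENNReal.ofReal (A ^ (3/2 : ℝ)) * n := by
  have h := amgm13 (ENNReal.toReal_nonneg (a := x)) (ENNReal.toReal_nonneg (a := n)) hA
  have h0 : 0 ≤ A ^ (3/2 : ℝ) * n.toReal := by positivity
  have h1 : A * (x.toReal ^ (1/3 : ℝ) * n.toReal ^ (2/3 : ℝ)) ≤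
    1/3 * x.toReal + A ^ (3/2 : ℝ) * n.toReal := by linarith
  have h2 := ENNReal.ofReal_le_ofReal h1
  rw [ENNReal.ofReal_mul hA, ENNReal.ofReal_mul (by positivity), ENNReal.ofReal_add (by positivity) h0,
    ENNReal.ofReal_mul (by norm_num), ENNReal.ofReal_mul (by positivity), ENNReal.toReal_rpow,
    ENNReal.toReal_rpow, ENNReal.ofReal_toReal hx, ENNReal.ofReal_toReal hn,
    ENNReal.ofReal_toReal (ENNReal.rpow_ne_top_of_nonneg (by norm_num) hx),
    ENNReal.ofReal_toReal (ENNReal.rpow_ne_top_of_nonneg (by norm_num) hn)] at h2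
  exact h2

lemma e_rpow_le_one_add (x : ℝ≥0∞) {s : ℝ} (hs0 : 0 ≤ s) (hs : s ≤ 1) : x ^ s ≤ 1 + x := by
  rcases le_total x 1 with h | h
  · exact (ENNReal.rpow_le_one h hs0).trans le_self_add
  · calc x ^ s ≤ x ^ (1:ℝ) := ENNReal.rpow_le_rpow_of_exponent_le h hs
      _ = x := ENNReal.rpow_one x
      _ ≤ _ := le_add_self

lemma nr_ind_mono (r : ℝ) (f : E3 → ℝ) (s : ℝ) : nr s (ind r f) ≤ nr s f := nr_mono (abs_ind_le r f)

lemma ind_ind_le {s r M : ℝ} {f : E3 → ℝ} : nr s (ind r (ind M f)) ≤ nr s (ind M f) := nr_ind_mono _ _ _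

lemma Rpow_le {R a b : ℝ} (hR : 1 ≤ R) (hab : a ≤ b) : R ^ a ≤ R ^ b :=
  Real.rpow_le_rpow_of_exponent_le hR hab

namespace Core

variable {γ : ℝ} {ρ : E3 → ℝ} {u : Fin 3 → E3 → ℝ} {S : Fin 3 → Fin 3 → E3 → ℝ}
    {dG : Fin 3 → E3 → ℝ}

/-- growth hypotheses -/
structure Gr (γ : ℝ) (ρ : E3 → ℝ) (α E K : ℝ) : Prop where
  α0 : 0 ≤ α
  K0 : 0 ≤ K
  αE : α ≤ E
  e1 : α + 1/2 - 3/γ ≤ E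
  e2 : α * γ - 3/2 ≤ E
  e3 : α * γ ≤ 5/2
  gr : ∀ R ≥ 1, nr γ (ind R ρ) ≤ ENNReal.ofReal (K * R ^ α)

variable {α E K : ℝ}

lemma grc (D : Gr γ ρ α E K) {c R : ℝ} (hc : 1 ≤ c) (hR : 1 ≤ R) :
    nr γ (ind (c * R) ρ) ≤ ENNReal.ofReal (K * c ^ α * R ^ α) := by
  have := D.gr (c * R) (by nlinarith)
  rwa [Real.mul_rpow (by linarith) (by linarith), ← mul_assoc] at this

lemma h_small (H : Core γ ρ u S dG) (D : Gr γ ρ α E K) {c : ℝ} (hc : 1 ≤ c) (i : Fin 3) :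
    SmallE E (fun R => nr (6/5) (ind (c * R) (fun x => ρ x * dG i x))) := by
  have hK := D.K0
  refine SmallE.of_pow (B := K * c ^ α) (by positivity) fun δ hδ => ?_
  obtain ⟨M, hM⟩ := tail_small (H.dGm i) (H.dGq i) hδ
  refine ⟨nr (6/5) (ind M (fun x => ρ x * dG i x)), H.h65 i M, fun R hR => ?_⟩
  have hR0 : 0 < R := by linarith
  have m1 := ind_meas (ind_meas (H.hm i) M) (c * R)
  have m2 := ind_meas (H.ρm.mul (out_meas (H.dGm i) M)) (c * R)
  calc nr (6/5) (ind (c * R) (fun x => ρ x * dG i x))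
      ≤ nr (6/5) (fun x => ind (c * R) (ind M (fun x => ρ x * dG i x)) x
          + ind (c * R) (fun x => ρ x * out M (dG i) x) x) := by
        apply nr_mono; intro x
        apply le_of_eq; congr 1
        by_cases hx : ‖x‖ ≤ c * R
        · simp only [ind_of_le hx]
          by_cases hx2 : ‖x‖ ≤ M
          · rw [ind_of_le hx2, out_of_le hx2]; ring
          · rw [ind_of_lt (not_le.mp hx2), out_of_lt (not_le.mp hx2)]; ring
        · simp only [ind_of_lt (not_le.mp hx)]; ring
    _ ≤ _ := nr_add (by norm_num) m1 m2
    _ ≤ _ := by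
      apply add_le_add ind_ind_le
      refine (H.h65_le (c * R) (out_meas (H.dGm i) M)).trans ?_
      refine (mul_le_mul' (grc D hc hR) (hM M le_rfl)).trans ?_
      rw [← ENNReal.ofReal_mul (by positivity)]
      apply ENNReal.ofReal_le_ofReal
      rw [mul_comm]
      gcongr
      exact D.αE

lemma Tm (H : Core γ ρ u S dG) (i j : Fin 3) : Measurable (fun x => ρ x * u i x * u j x) :=
  (H.ρm.mul (H.um i)).mul (H.um j)

lemma T2_fin (H : Core γ ρ u S dG) (i j : Fin 3) (M : ℝ) :
    nr 2 (ind M (fun x => ρ x * u i x * u j x)) ≠ ⊤ := by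
  obtain ⟨W, Wm, W2, hW⟩ := H.W_ex one_pos
  have le : nr 2 (ind M (fun x => ρ x * u i x * u j x)) ≤
      nr 2 (fun x => (ind M (fun x => |S i j x|) x + ind M (fun x => ρ x ^ γ) x) + ind M W x) := by
    apply nr_mono; intro x
    by_cases hx : ‖x‖ ≤ M
    · simp only [ind_of_le hx]
      have h1 := hW i j x
      refine le_trans ?_ (le_abs_self _)
      have h2 : |ρ x * u i x * u j x| ≤ |S i j x| + |S i j x - ρ x * u i x * u j x| := by
        have := abs_sub (S i j x) (S i j x - ρ x * u i x * u j x)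
        rwa [sub_sub_cancel] at this
      linarith
    · rw [ind_of_lt (not_le.mp hx), abs_zero]; positivity
  have m1 := ind_meas (H.Sm' i j).abs M
  have m2 := ind_meas H.pm M
  have m3 := ind_meas Wm M
  refine ne_top_of_le_ne_top ?_ (le.trans ((nr_add (by norm_num) (m1.add m2) m3).trans
    (add_le_add_left (nr_add (by norm_num) m1 m2) _)))
  refine ENNReal.add_ne_top.mpr ⟨ENNReal.add_ne_top.mpr ⟨?_, H.p2_fin M⟩, W2 M⟩
  refine ne_top_of_le_ne_top (H.S2 i j) ((nr_ind_mono _ _ _).trans (nr_mono fun x => by simp))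

lemma T_split (i j : Fin 3) (M : ℝ) (x : E3) :
    ρ x * u i x * u j x = ind M (fun x => ρ x * u i x * u j x) x +
      ρ x * (out M (u i) x * out M (u j) x) := by
  by_cases hx2 : ‖x‖ ≤ M
  · rw [ind_of_le hx2, out_of_le hx2]; ring
  · rw [ind_of_lt (not_le.mp hx2), out_of_lt (not_le.mp hx2), out_of_lt (not_le.mp hx2)]; ring

lemma vv_le (H : Core γ ρ u S dG) {M δ : ℝ} (hδ : 0 < δ)
    (hM : ∀ i, nr 6 (out M (u i)) ≤ ENNReal.ofReal δ) (i j : Fin 3) :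
    nr 3 (fun x => out M (u i) x * out M (u j) x) ≤ ENNReal.ofReal (δ ^ 2) := by
  refine (nr_mul (a := 6) (b := 6) (by norm_num) (by norm_num) (by norm_num) (by norm_num)
    (out_meas (H.um i) M) (out_meas (H.um j) M)).trans ((mul_le_mul' (hM i) (hM j)).trans ?_)
  rw [← ENNReal.ofReal_mul hδ.le, sq]

lemma T1_small (H : Core γ ρ u S dG) (D : Gr γ ρ α E K) {c : ℝ} (hc : 1 ≤ c) (i j : Fin 3) :
    SmallE E (fun R => ENNReal.ofReal (R ^ (-(3/2) : ℝ)) *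
      nr 1 (ind (c * R) (fun x => ρ x * u i x * u j x))) := by
  have hK := D.K0
  have hγ := H.hγ
  have hcB := one_le_cB
  refine SmallE.of_pow (B := cB * c ^ (2 - 3/γ) * (K * c ^ α)) (by positivity) fun δ hδ => ?_
  obtain ⟨M, hM0, hM⟩ := tail_small3 H.um H.u6 (Real.sqrt_pos.mpr hδ)
  refine ⟨nr 1 (ind M (fun x => ρ x * u i x * u j x)),
    nr_ind_finite_of_le (H.Tm i j) (by norm_num) (H.T2_fin i j M), fun R hR => ?_⟩
  have hR0 : 0 < R := by linarith
  set v := fun x => out M (u i) x * out M (u j) x with hv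
  have vm : Measurable v := (out_meas (H.um i) M).mul (out_meas (H.um j) M)
  have m1 := ind_meas (ind_meas (H.Tm i j) M) (c * R)
  have m2 := ind_meas (H.ρm.mul vm) (c * R)
  have hR1 : ENNReal.ofReal (R ^ (-(3/2) : ℝ)) ≤ 1 := by
    rw [← ENNReal.ofReal_one]
    exact ENNReal.ofReal_le_ofReal (Real.rpow_le_one_of_one_le_of_nonpos hR (by norm_num))
  have hv3 : nr 3 v ≤ ENNReal.ofReal δ := by
    have := H.vv_le (Real.sqrt_pos.mpr hδ) hM i j
    rwa [Real.sq_sqrt hδ.le] at this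
  have b2 : nr 1 (ind (c * R) (fun x => ρ x * v x)) ≤
      ENNReal.ofReal (cB * (c * R) ^ (2 - 3/γ)) * ENNReal.ofReal (K * c ^ α * R ^ α) * ENNReal.ofReal δ := by
    have h1 : nr 1 (ind (c * R) (fun x => ρ x * v x)) ≤ nr (3/2) (ind (c * R) ρ) * nr 3 v := by
      refine le_trans (nr_mono fun x => ?_) (nr_mul (by norm_num) (by norm_num) (by norm_num) (by norm_num)
        (ind_meas H.ρm (c * R)) vm)
      by_cases hx : ‖x‖ ≤ c * R
      · rw [ind_of_le hx, ind_of_le hx]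
      · rw [ind_of_lt (not_le.mp hx), abs_zero]; positivity
    refine h1.trans (mul_le_mul' ?_ hv3)
    have h2 := nr_ind_holder H.ρm (r := c * R) (s := 3/2) (t := γ) (by positivity) (by norm_num)
      (by linarith)
    have e : (3:ℝ) / (3/2) = 2 := by norm_num
    rw [e] at h2
    exact h2.trans (mul_le_mul' le_rfl (grc D hc hR))
  calc ENNReal.ofReal (R ^ (-(3/2) : ℝ)) * nr 1 (ind (c * R) (fun x => ρ x * u i x * u j x))
      ≤ ENNReal.ofReal (R ^ (-(3/2) : ℝ)) * (nr 1 (ind (c * R) (ind M (fun x => ρ x * u i x * u j x)))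
          + nr 1 (ind (c * R) (fun x => ρ x * v x))) := by
        apply mul_le_mul_right
        refine le_trans (nr_mono fun x => le_of_eq ?_) (nr_add le_rfl m1 m2)
        congr 1
        by_cases hx : ‖x‖ ≤ c * R
        · simp only [ind_of_le hx]
          exact T_split i j M x
        · simp only [ind_of_lt (not_le.mp hx)]; ring
    _ ≤ _ := by
      rw [mul_add]
      apply add_le_add
      · exact (mul_le_of_le_one_left zero_le hR1).trans ind_ind_le
      · refine (mul_le_mul_right b2 _).trans ?_
        rw [← ENNReal.ofReal_mul (by positivity), ← ENNReal.ofReal_mul (by positivity),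
          ← ENNReal.ofReal_mul (by positivity)]
        apply ENNReal.ofReal_le_ofReal
        rw [Real.mul_rpow (by linarith) hR0.le]
        have e : R ^ (-(3/2) : ℝ) * R ^ (2 - 3/γ) * R ^ α = R ^ (α + 1/2 - 3/γ) := by
          rw [← Real.rpow_add hR0, ← Real.rpow_add hR0]; congr 1; ring
        calc _ = δ * (cB * c ^ (2 - 3/γ) * (K * c ^ α) * (R ^ (-(3/2) : ℝ) * R ^ (2 - 3/γ) * R ^ α)) := by ring
          _ ≤ _ := by
            rw [e]
            gcongr
            exact D.e1

lemma N_small (H : Core γ ρ u S dG) (D : Gr γ ρ α E K) :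
    SmallE E (fun R => ENNReal.ofReal (R ^ (-(3/2) : ℝ)) * nr 1 (ind (2 * R) (fun x => ρ x ^ γ))) := by
  have hK := D.K0
  have hγ := H.hγ
  have hcB := one_le_cB
  have hCθ := one_le_Cθ
  have hN : ∀ c ≥ 1, ∀ R ≥ 1, nr 1 (ind (c * R) (fun x => ρ x ^ γ)) ≤
      ENNReal.ofReal (K ^ γ * c ^ (5/2 : ℝ) * R ^ (α * γ)) := by
    intro c hc R hR
    have hR0 : 0 < R := by linarith
    rw [← H.p_ind]
    refine (ENNReal.rpow_le_rpow (grc D hc hR) H.γpos.le).trans ?_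
    rw [ENNReal.ofReal_rpow_of_nonneg (by positivity) H.γpos.le]
    apply ENNReal.ofReal_le_ofReal
    rw [Real.mul_rpow (by positivity) (by positivity), Real.mul_rpow (by positivity) (by positivity),
      ← Real.rpow_mul (by positivity), ← Real.rpow_mul (by positivity)]
    gcongr
    exact D.e3
  intro ε hε
  -- choose the parameter
  set B : ℝ := 6 * Cθ * K ^ γ * 4 ^ (5/2 : ℝ) with hB
  have hB0 : 0 ≤ B := by positivity
  obtain ⟨L, hL1, hL⟩ : ∃ L : ℝ, 1 ≤ L ∧ B * L ^ (-(1/2) : ℝ) ≤ ε / 2 := by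
    have ht : Tendsto (fun L : ℝ => B * L ^ (-(1/2) : ℝ)) atTop (𝓝 (B * 0)) :=
      (tendsto_rpow_neg_atTop (by norm_num : (0:ℝ) < 1/2)).const_mul B
    rw [mul_zero] at ht
    have := (ht.eventually_le_const (by positivity : 0 < ε / 2)).and (eventually_ge_atTop 1)
    obtain ⟨L, h1, h2⟩ := this.exists
    exact ⟨L, h2, h1⟩
  set F : Fin 3 → Fin 3 → E3 → ℝ := fun i j x => S i j x - ρ x * u i x * u j x with hF
  set h : Fin 3 → E3 → ℝ := fun i x => ρ x * dG i x with hh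
  have hc4 : (1:ℝ) ≤ 4 * L := by linarith
  have sF : SmallE E (fun R => ENNReal.ofReal (R ^ (-(3/2) : ℝ)) *
      ∑ i, ∑ j, nr 1 (ind (4 * L * R) (F i j))) := by
    simp only [Finset.mul_sum]
    refine SmallE.sum _ fun i => SmallE.sum _ fun j => ?_
    have c0 : ENNReal.ofReal (cB * (4 * L) ^ (3/2 : ℝ)) * nr 2 (S i j) ≠ ⊤ :=
      ENNReal.mul_ne_top ENNReal.ofReal_ne_top (H.S2 i j)
    refine ((SmallE.const c0).add (H.T1_small D hc4 i j)).mono fun R hR => ?_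
    have hR0 : 0 < R := by linarith
    have m1 := ind_meas (H.Sm' i j) (4 * L * R)
    have m2 := ind_meas (H.Tm i j) (4 * L * R)
    have h1 : nr 1 (ind (4 * L * R) (F i j)) ≤ nr 1 (ind (4 * L * R) (S i j)) +
        nr 1 (ind (4 * L * R) (fun x => ρ x * u i x * u j x)) := by
      have n1 : nr 1 (fun x => - ind (4 * L * R) (fun x => ρ x * u i x * u j x) x) ≤
          nr 1 (ind (4 * L * R) (fun x => ρ x * u i x * u j x)) := nr_mono fun x => by rw [abs_neg]
      refine le_trans (nr_mono fun x => le_of_eq ?_)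
        ((nr_add le_rfl m1 m2.neg).trans (add_le_add le_rfl n1))
      congr 1
      by_cases hx : ‖x‖ ≤ 4 * L * R
      · simp only [Pi.neg_apply, ind_of_le hx, hF]; ring
      · simp only [Pi.neg_apply, ind_of_lt (not_le.mp hx)]; ring
    refine (mul_le_mul_right h1 _).trans ?_
    rw [mul_add]
    refine add_le_add ?_ le_rfl
    have h2 := nr_ind_holder (H.Sm' i j) (r := 4 * L * R) (s := 1) (t := 2) (by positivity) le_rfl
      (by norm_num)
    have e : (3:ℝ) / 1 - 3 / 2 = 3 / 2 := by norm_num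
    rw [e] at h2
    refine (mul_le_mul_right (h2.trans (mul_le_mul' le_rfl (nr_ind_mono _ _ _))) _).trans ?_
    rw [← mul_assoc, ← ENNReal.ofReal_mul (by positivity), Real.mul_rpow (by positivity) hR0.le]
    apply mul_le_mul' _ le_rfl
    apply le_of_eq; congr 1
    have : R ^ (-(3/2) : ℝ) * R ^ (3/2 : ℝ) = 1 := by
      rw [← Real.rpow_add hR0]; norm_num
    linear_combination cB * (4 * L) ^ (3/2 : ℝ) * this
  have sh : SmallE E (fun R => ENNReal.ofReal (R ^ (-(3/2) : ℝ)) * (ENNReal.ofReal R *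
      ∑ i, nr 1 (ind (4 * L * R) (h i)))) := by
    simp only [Finset.mul_sum]
    refine SmallE.sum _ fun i => ?_
    refine ((H.h_small D hc4 i).const_mul
      (ENNReal.ofReal_ne_top (r := cB * (4 * L) ^ (1/2 : ℝ)))).mono fun R hR => ?_
    have hR0 : 0 < R := by linarith
    have h2 := nr_ind_holder (H.hm i) (r := 4 * L * R) (s := 1) (t := 6/5) (by positivity) le_rfl
      (by norm_num)
    have e : (3:ℝ) / 1 - 3 / (6/5) = 1 / 2 := by norm_num
    rw [e] at h2
    refine (mul_le_mul_right (mul_le_mul_right h2 _) _).trans ?_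
    rw [← mul_assoc, ← mul_assoc, ← ENNReal.ofReal_mul (by positivity), ← ENNReal.ofReal_mul (by positivity),
      Real.mul_rpow (by positivity) hR0.le]
    apply mul_le_mul' _ le_rfl
    apply le_of_eq; congr 1
    have : R ^ (-(3/2) : ℝ) * R * R ^ (1/2 : ℝ) = 1 := by
      nth_rewrite 2 [← Real.rpow_one R]
      rw [← Real.rpow_add hR0, ← Real.rpow_add hR0]; norm_num
    linear_combination cB * (4 * L) ^ (1/2 : ℝ) * this
  obtain ⟨C, hC0, hC⟩ := ((sF.const_mul (ENNReal.ofReal_ne_top (r := 2 * (Cθ + 4)))).add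
    (sh.const_mul (ENNReal.ofReal_ne_top (r := 4)))) (ε / 2) (by positivity)
  refine ⟨C, hC0, fun R hR => ?_⟩
  have hR0 : 0 < R := by linarith
  have key := N_real (p := fun x => ρ x ^ γ) (F := F) (h := h) (fun x => Real.rpow_nonneg (H.ρ0 x) _)
    H.pl H.Fl H.hl H.weq (R := 2 * R) (K := L) (by positivity) hL1
  have er : 2 * (L * (2 * R)) = 4 * L * R := by ring
  rw [er] at key
  have fF : ∀ i j, nr 1 (ind (4 * L * R) (F i j)) ≠ ⊤ := fun i j => ind_of_li (H.Fl i j) _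
  have fh : ∀ i, nr 1 (ind (4 * L * R) (h i)) ≠ ⊤ := fun i => ind_of_li (H.hl i) _
  have fp : ∀ r, nr 1 (ind r (fun x => ρ x ^ γ)) ≠ ⊤ := fun r => ind_of_li H.pl _
  have e1 : ∑ i, ∑ j, (nr 1 (ind (4 * L * R) (F i j))).toReal =
      (∑ i, ∑ j, nr 1 (ind (4 * L * R) (F i j))).toReal := by
    rw [ENNReal.toReal_sum fun i _ => ENNReal.sum_ne_top.mpr fun j _ => fF i j]
    congr 1; funext i
    rw [ENNReal.toReal_sum fun j _ => fF i j]
  have e2 : ∑ i, (nr 1 (ind (4 * L * R) (h i))).toReal =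
      (∑ i, nr 1 (ind (4 * L * R) (h i))).toReal := by
    rw [ENNReal.toReal_sum fun i _ => fh i]
  rw [e1, e2] at key
  set sFF := ∑ i, ∑ j, nr 1 (ind (4 * L * R) (F i j)) with hsFF
  set shh := ∑ i, nr 1 (ind (4 * L * R) (h i)) with hshh
  have tF : sFF ≠ ⊤ := ENNReal.sum_ne_top.mpr fun i _ => ENNReal.sum_ne_top.mpr fun j _ => fF i j
  have th : shh ≠ ⊤ := ENNReal.sum_ne_top.mpr fun i _ => fh i
  have hC2 := hC R hR
  have hC3 := ENNReal.toReal_le_of_le_ofReal (by positivity) hC2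
  rw [ENNReal.toReal_add (by finiteness) (by finiteness)] at hC3
  simp only [ENNReal.toReal_mul, ENNReal.toReal_ofReal (show 0 ≤ 2 * (Cθ + 4) by positivity),
    ENNReal.toReal_ofReal (show 0 ≤ R ^ (-(3/2) : ℝ) by positivity), ENNReal.toReal_ofReal hR0.le,
    ENNReal.toReal_ofReal (show (0:ℝ) ≤ 4 by norm_num)] at hC3
  have hN2 := ENNReal.toReal_le_of_le_ofReal (by positivity) (hN (4 * L) hc4 R hR)
  beta_reduce
  rw [← ENNReal.ofReal_toReal (fp (2 * R)), ← ENNReal.ofReal_mul (by positivity)]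
  apply ENNReal.ofReal_le_ofReal
  set n := (nr 1 (ind (2 * R) fun x => ρ x ^ γ)).toReal
  set m := (nr 1 (ind (4 * L * R) fun x => ρ x ^ γ)).toReal
  have hR32 : 0 ≤ R ^ (-(3/2) : ℝ) := by positivity
  have k1 := mul_le_mul_of_nonneg_left key hR32
  have k2 : R ^ (-(3/2) : ℝ) * (2 * (3 * Cθ / L ^ 3 * m)) ≤ ε / 2 * R ^ E := by
    have hL0 : 0 < L := by linarith
    have eL : (4 * L) ^ (5/2 : ℝ) / L ^ 3 = 4 ^ (5/2 : ℝ) * L ^ (-(1/2) : ℝ) := by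
      rw [Real.mul_rpow (by norm_num) hL0.le, mul_div_assoc]
      congr 1
      rw [← Real.rpow_natCast, ← Real.rpow_sub hL0]; norm_num
    have eR : R ^ (-(3/2) : ℝ) * R ^ (α * γ) ≤ R ^ E := by
      rw [← Real.rpow_add hR0]; exact Rpow_le hR (by linarith [D.e2])
    calc R ^ (-(3/2) : ℝ) * (2 * (3 * Cθ / L ^ 3 * m))
        ≤ R ^ (-(3/2) : ℝ) * (2 * (3 * Cθ / L ^ 3 * (K ^ γ * (4 * L) ^ (5/2 : ℝ) * R ^ (α * γ)))) := by
          gcongr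
      _ = 6 * Cθ * K ^ γ * ((4 * L) ^ (5/2 : ℝ) / L ^ 3) * (R ^ (-(3/2) : ℝ) * R ^ (α * γ)) := by
          ring
      _ = B * L ^ (-(1/2) : ℝ) * (R ^ (-(3/2) : ℝ) * R ^ (α * γ)) := by rw [eL, hB]; ring
      _ ≤ ε / 2 * R ^ E := by gcongr
  linarith

end Core

end

noncomputable section

open MeasureTheory Metric Filter Topology Set
open scoped ENNReal NNReal

namespace Core

variable {γ : ℝ} {ρ : E3 → ℝ} {u : Fin 3 → E3 → ℝ} {S : Fin 3 → Fin 3 → E3 → ℝ}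
    {dG : Fin 3 → E3 → ℝ} {α E K : ℝ}

lemma cutm (R : ℝ) : Measurable (cut R) := (cut_smooth R).continuous.measurable

lemma Q_le (H : Core γ ρ u S dG) (D : Gr γ ρ α E K) : ∃ B : ℝ, 0 ≤ B ∧ ∀ R ≥ 1,
    nr 6 (fun x => cut R x * ρ x) ≤ nr 2 (fun x => cut R x ^ 3 * ρ x ^ γ) + 2
      + ENNReal.ofReal (B * R ^ E) := by
  have hK := D.K0
  have hγ := H.hγ
  have hcB := one_le_cB
  rcases le_total γ 6 with h6 | h6
  · refine ⟨K * 2 ^ α, by positivity, fun R hR => ?_⟩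
    have hR0 : 0 < R := by linarith
    set X := nr 2 (fun x => cut R x ^ 3 * ρ x ^ γ) with hX
    set Q := nr 6 (fun x => cut R x * ρ x) with hQ
    set a := nr γ (ind (2 * R) ρ) with ha
    have h1 : Q ^ 6 ≤ a ^ γ + X ^ 2 := by
      have e1 : nr 1 (fun x => (cut R x * ρ x) ^ 6) = Q ^ 6 :=
        nr_pow one_pos 6 (by norm_num) (by norm_num)
      have e2 : nr 1 (fun x => (cut R x ^ 3 * ρ x ^ γ) ^ 2) = X ^ 2 :=
        nr_pow one_pos 2 (by norm_num) (by norm_num)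
      rw [← e1, ← e2, ha, H.p_ind]
      refine le_trans (nr_mono fun x => ?_) (nr_add le_rfl (ind_meas H.pm _)
        ((((cutm R).pow_const 3).mul H.pm).pow_const 2))
      by_cases hx : ‖x‖ ≤ 2 * R
      · rw [ind_of_le hx]
        have hρ := H.ρ0 x
        have c0 := cut_nonneg R x
        have c1 := cut_le_one R x
        rw [abs_of_nonneg (by positivity), abs_of_nonneg (by positivity)]
        have e6 : ρ x ^ (6:ℕ) = ρ x ^ (6:ℝ) := by norm_cast
        have e2 : (ρ x ^ γ) ^ 2 = ρ x ^ (γ * 2) := by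
          rw [Real.rpow_mul hρ]; norm_cast
        rw [mul_pow, mul_pow, ← pow_mul]
        norm_num
        rw [e2]
        rcases le_total (ρ x) 1 with hr | hr
        · have : ρ x ^ 6 ≤ ρ x ^ γ := by
            rw [e6]
            rcases eq_or_lt_of_le hρ with h0 | h0
            · rw [← h0, Real.zero_rpow (by norm_num)]; positivity
            · exact Real.rpow_le_rpow_of_exponent_ge h0 hr h6
          have c6 : cut R x ^ 6 ≤ 1 := pow_le_one₀ c0 c1
          have : cut R x ^ 6 * ρ x ^ 6 ≤ 1 * ρ x ^ γ := mul_le_mul c6 this (by positivity) (by positivity)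
          have : 0 ≤ cut R x ^ 6 * ρ x ^ (γ * 2) := by positivity
          linarith
        · have : ρ x ^ 6 ≤ ρ x ^ (γ * 2) := by
            rw [e6]; exact Rpow_le hr (by linarith)
          have : cut R x ^ 6 * ρ x ^ 6 ≤ cut R x ^ 6 * ρ x ^ (γ * 2) := by gcongr
          have : 0 ≤ ρ x ^ γ := by positivity
          linarith
      · have := cut_eq_zero hR0 (x := x) (by linarith [not_le.mp hx])
        rw [this]; simp
    have h2 : Q ≤ a ^ (γ/6) + X ^ (1/3 : ℝ) := by
      have h3 := ENNReal.rpow_le_rpow h1 (z := (1/6 : ℝ)) (by norm_num)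
      rw [← ENNReal.rpow_natCast, ← ENNReal.rpow_mul] at h3
      norm_num at h3
      refine h3.trans ?_
      refine (ENNReal.rpow_add_le_add_rpow _ _ (by norm_num) (by norm_num)).trans (le_of_eq ?_)
      congr 1
      · rw [← ENNReal.rpow_mul]; congr 1; ring
      · rw [← ENNReal.rpow_natCast, ← ENNReal.rpow_mul]; norm_num
    have h3 := e_rpow_le_one_add a (s := γ/6) (by positivity) (by linarith)
    have h4 := e_rpow_le_one_add X (s := 1/3) (by norm_num) (by norm_num)
    have h5 : a ≤ ENNReal.ofReal (K * 2 ^ α * R ^ E) := by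
      refine (grc D (by norm_num : (1:ℝ) ≤ 2) hR).trans (ENNReal.ofReal_le_ofReal ?_)
      have := D.αE
      gcongr
    calc Q ≤ (1 + a) + (1 + X) := h2.trans (add_le_add h3 h4)
      _ = X + 2 + a := by ring
      _ ≤ _ := by gcongr
  · refine ⟨cB * 2 ^ (1/2 - 3/γ) * (K * 2 ^ α), by positivity, fun R hR => ?_⟩
    have hR0 : 0 < R := by linarith
    have h1 := nr_cut_le (f := ρ) (s := 6) hR0 1 one_ne_zero
    simp only [pow_one] at h1
    have h2 := nr_ind_holder H.ρm (r := 2 * R) (s := 6) (t := γ) (by positivity) (by norm_num) h6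
    have e : (3:ℝ)/6 = 1/2 := by norm_num
    rw [e] at h2
    refine (h1.trans (h2.trans (mul_le_mul' le_rfl (grc D (by norm_num) hR)))).trans ?_
    refine le_trans ?_ le_add_self
    rw [← ENNReal.ofReal_mul (by positivity)]
    apply ENNReal.ofReal_le_ofReal
    rw [Real.mul_rpow (by norm_num) hR0.le]
    have e3 : R ^ (1/2 - 3/γ) * R ^ α ≤ R ^ E := by
      rw [← Real.rpow_add hR0]; exact Rpow_le hR (by linarith [D.e1])
    calc _ = cB * 2 ^ (1/2 - 3/γ) * (K * 2 ^ α) * (R ^ (1/2 - 3/γ) * R ^ α) := by ring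
      _ ≤ _ := by gcongr

lemma T2_le (H : Core γ ρ u S dG) {δ : ℝ} (hδ : 0 < δ) : ∃ c : ℝ≥0∞, c ≠ ⊤ ∧ ∀ R > 0, ∀ i j,
    nr 2 (fun x => cut R x * (S i j x - ρ x * u i x * u j x)) ≤ c + ENNReal.ofReal δ *
      nr 6 (fun x => cut R x * ρ x) := by
  obtain ⟨M, hM0, hM⟩ := tail_small3 H.um H.u6 (Real.sqrt_pos.mpr hδ)
  refine ⟨∑ i, ∑ j, (nr 2 (S i j) + nr 2 (ind M (fun x => ρ x * u i x * u j x))), ?_, fun R hR i j => ?_⟩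
  · exact ENNReal.sum_ne_top.mpr fun i _ => ENNReal.sum_ne_top.mpr fun j _ =>
      ENNReal.add_ne_top.mpr ⟨H.S2 i j, H.T2_fin i j M⟩
  have hv3 := H.vv_le (Real.sqrt_pos.mpr hδ) hM i j
  rw [Real.sq_sqrt hδ.le] at hv3
  set v := fun x => out M (u i) x * out M (u j) x with hv
  have vm : Measurable v := (out_meas (H.um i) M).mul (out_meas (H.um j) M)
  have m1 := H.Sm' i j
  have m2 := ind_meas (H.Tm i j) M
  have m3 := ((cutm R).mul H.ρm).mul vm
  have c0 := cut_nonneg R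
  have c1 := cut_le_one R
  have step : nr 2 (fun x => cut R x * (S i j x - ρ x * u i x * u j x)) ≤
      nr 2 (fun x => (|S i j x| + |ind M (fun x => ρ x * u i x * u j x) x|) + |cut R x * ρ x * v x|) := by
    apply nr_mono; intro x
    refine le_trans ?_ (le_abs_self _)
    have := T_split (ρ := ρ) (u := u) i j M x
    rw [this]
    have e : cut R x * (S i j x - (ind M (fun x => ρ x * u i x * u j x) x +
        ρ x * (out M (u i) x * out M (u j) x))) = cut R x * S i j x -
        cut R x * ind M (fun x => ρ x * u i x * u j x) x - cut R x * ρ x * v x := by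
      simp only [hv]; ring
    rw [e]
    refine (abs_sub _ _).trans (add_le_add ((abs_sub _ _).trans (add_le_add ?_ ?_)) le_rfl)
    · rw [abs_mul, abs_of_nonneg (c0 x)]; exact mul_le_of_le_one_left (abs_nonneg _) (c1 x)
    · rw [abs_mul, abs_of_nonneg (c0 x)]; exact mul_le_of_le_one_left (abs_nonneg _) (c1 x)
  refine step.trans ((nr_add (by norm_num) (m1.abs.add m2.abs) m3.abs).trans (add_le_add ?_ ?_))
  · refine (nr_add (by norm_num) m1.abs m2.abs).trans ?_
    refine le_trans ?_ (Finset.single_le_sum (f := fun i => ∑ j, (nr 2 (S i j) + nr 2 (ind M (fun x => ρ x * u i x * u j x))))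
      (fun _ _ => zero_le) (Finset.mem_univ i))
    refine le_trans ?_ (Finset.single_le_sum (f := fun j => (nr 2 (S i j) + nr 2 (ind M (fun x => ρ x * u i x * u j x))))
      (fun _ _ => zero_le) (Finset.mem_univ j))
    exact add_le_add (nr_mono fun x => by simp) (nr_mono fun x => by simp)
  · refine (nr_mono (g := fun x => (cut R x * ρ x) * v x) fun x => by simp).trans ?_
    refine (nr_mul (a := 6) (b := 3) (by norm_num) (by norm_num) (by norm_num) (by norm_num)
      ((cutm R).mul H.ρm) vm).trans ?_
    rw [mul_comm]
    exact mul_le_mul' hv3 le_rfl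

lemma F65_le (H : Core γ ρ u S dG) {R : ℝ} (hR : 0 < R) (i j : Fin 3) :
    ENNReal.ofReal R⁻¹ * nr (6/5) (fun x => cut R x * (S i j x - ρ x * u i x * u j x)) ≤
      ENNReal.ofReal (2 * cB) * nr 2 (fun x => cut R x * (S i j x - ρ x * u i x * u j x)) := by
  set f := fun x => cut R x * (S i j x - ρ x * u i x * u j x) with hf
  have fm : Measurable f := (cutm R).mul (H.Fm i j)
  have hcB := one_le_cB
  have h0 : nr (6/5) f ≤ nr (6/5) (ind (2 * R) f) := by
    apply nr_mono; intro x
    by_cases hx : ‖x‖ ≤ 2 * R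
    · rw [ind_of_le hx]
    · have := cut_eq_zero hR (x := x) (by linarith [not_le.mp hx])
      simp only [hf, this, zero_mul, abs_zero]; positivity
  have h2 := nr_ind_holder fm (r := 2 * R) (s := 6/5) (t := 2) (by positivity) (by norm_num) (by norm_num)
  have e : (3:ℝ)/(6/5) - 3/2 = 1 := by norm_num
  rw [e, Real.rpow_one] at h2
  refine (mul_le_mul_right (h0.trans (h2.trans (mul_le_mul' le_rfl (nr_ind_mono _ _ _)))) _).trans ?_
  rw [← mul_assoc, ← ENNReal.ofReal_mul (by positivity)]
  apply mul_le_mul' _ le_rfl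
  apply le_of_eq; congr 1
  field_simp

lemma X_step (H : Core γ ρ u S dG) (D : Gr γ ρ α E K) : ∃ c1 : ℝ, 0 ≤ c1 ∧ ∀ δ > 0,
    ∃ A : ℝ → ℝ≥0∞, SmallE E A ∧ ∀ R ≥ 1,
    nr 2 (fun x => cut R x ^ 3 * ρ x ^ γ) ≤ ENNReal.ofReal (1/3) * nr 2 (fun x => cut R x ^ 3 * ρ x ^ γ)
      + ENNReal.ofReal (c1 * δ) * nr 6 (fun x => cut R x * ρ x) + A R := by
  obtain ⟨C, hC⟩ := press
  have hcB := one_le_cB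
  refine ⟨C * (2 * cB + 1) * 9, by positivity, fun δ hδ => ?_⟩
  obtain ⟨c, hc, hT⟩ := H.T2_le hδ
  set A : ℝ → ℝ≥0∞ := fun R => ENNReal.ofReal ((C:ℝ) ^ (3/2 : ℝ)) *
      (ENNReal.ofReal (R ^ (-(3/2) : ℝ)) * nr 1 (ind (2 * R) (fun x => ρ x ^ γ)))
      + (C : ℝ≥0∞) * (∑ i, nr (6/5) (ind (2 * R) (fun x => ρ x * dG i x)))
      + ENNReal.ofReal (C * (2 * cB + 1)) * (9 * c) with hA
  refine ⟨A, ?_, fun R hR => ?_⟩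
  · refine (((H.N_small D).const_mul ENNReal.ofReal_ne_top).add
      ((SmallE.sum _ fun i => H.h_small D (by norm_num) i).const_mul ENNReal.coe_ne_top)).add
      (SmallE.const ?_)
    exact ENNReal.mul_ne_top ENNReal.ofReal_ne_top (ENNReal.mul_ne_top (by norm_num) hc)
  have hR0 : 0 < R := by linarith
  have key := hC _ _ _ H.pm H.Fm H.hm H.pl H.Fl H.hl H.weq R hR0
    ⟨(((cutm R).pow_const 3).mul H.pm).aestronglyMeasurable, by
      rw [← nr_two]; exact (H.X_fin hR0).lt_top⟩
  set X := nr 2 (fun x => cut R x ^ 3 * ρ x ^ γ) with hX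
  set Q := nr 6 (fun x => cut R x * ρ x) with hQ
  set N := nr 1 (ind (2 * R) (fun x => ρ x ^ γ)) with hN
  have k1 : (C : ℝ≥0∞) * (ENNReal.ofReal R⁻¹ * nr (6/5) (fun x => cut R x * ρ x ^ γ)) ≤
      ENNReal.ofReal (1/3) * X + ENNReal.ofReal ((C:ℝ) ^ (3/2 : ℝ)) *
      (ENNReal.ofReal (R ^ (-(3/2) : ℝ)) * N) := by
    have h1 := interp65 H.pm hR0
    have h2 := amgm_e (H.X_fin hR0) (ind_of_li H.pl (2 * R)) (A := C * R⁻¹) (by positivity)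
    refine le_trans ?_ (h2.trans (le_of_eq ?_))
    · rw [← mul_assoc, ENNReal.ofReal_mul (by positivity), ENNReal.ofReal_coe_nnreal]
      exact mul_le_mul' le_rfl h1
    · congr 1
      rw [← mul_assoc, ← ENNReal.ofReal_mul (by positivity), Real.mul_rpow (by positivity) (by positivity),
        Real.inv_rpow hR0.le, Real.rpow_neg hR0.le]
  have k2 : ∀ i j, ENNReal.ofReal R⁻¹ * nr (6/5) (fun x => cut R x * (S i j x - ρ x * u i x * u j x)) +
      nr 2 (fun x => cut R x ^ 3 * (S i j x - ρ x * u i x * u j x)) ≤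
      ENNReal.ofReal (2 * cB + 1) * (c + ENNReal.ofReal δ * Q) := by
    intro i j
    have h3 : nr 2 (fun x => cut R x ^ 3 * (S i j x - ρ x * u i x * u j x)) ≤
        nr 2 (fun x => cut R x * (S i j x - ρ x * u i x * u j x)) := by
      apply nr_mono; intro x
      rw [abs_mul, abs_mul, abs_of_nonneg (pow_nonneg (cut_nonneg R x) 3), abs_of_nonneg (cut_nonneg R x)]
      apply mul_le_mul_of_nonneg_right _ (abs_nonneg _)
      exact pow_le_of_le_one (cut_nonneg R x) (cut_le_one R x) (by norm_num)
    refine (add_le_add (H.F65_le hR0 i j) h3).trans ?_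
    have : ENNReal.ofReal (2 * cB + 1) = ENNReal.ofReal (2 * cB) + 1 := by
      rw [ENNReal.ofReal_add (by positivity) (by norm_num), ENNReal.ofReal_one]
    rw [this, ← add_one_mul]
    exact mul_le_mul' le_rfl (hT R hR0 i j)
  have k3 : ENNReal.ofReal R⁻¹ * (∑ i, ∑ j, nr (6/5) (fun x => cut R x * (S i j x - ρ x * u i x * u j x))) +
      (∑ i, ∑ j, nr 2 (fun x => cut R x ^ 3 * (S i j x - ρ x * u i x * u j x))) ≤
      9 * (ENNReal.ofReal (2 * cB + 1) * (c + ENNReal.ofReal δ * Q)) := by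
    simp only [Finset.mul_sum]
    rw [← Finset.sum_add_distrib]
    simp only [← Finset.sum_add_distrib]
    refine (Finset.sum_le_sum fun i _ => Finset.sum_le_sum fun j _ => k2 i j).trans (le_of_eq ?_)
    simp only [Finset.sum_const, Finset.card_univ, Fintype.card_fin, nsmul_eq_mul]
    push_cast
    ring
  have k4 : ∑ i, nr (6/5) (fun x => cut R x ^ 3 * (ρ x * dG i x)) ≤
      ∑ i, nr (6/5) (ind (2 * R) (fun x => ρ x * dG i x)) :=
    Finset.sum_le_sum fun i _ => nr_cut_le hR0 3 (by norm_num)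
  have e9 : ENNReal.ofReal (C * (2 * cB + 1) * 9 * δ) =
      (C : ℝ≥0∞) * ENNReal.ofReal (2 * cB + 1) * 9 * ENNReal.ofReal δ := by
    rw [ENNReal.ofReal_mul (by positivity), ENNReal.ofReal_mul (by positivity),
      ENNReal.ofReal_mul (by positivity), ENNReal.ofReal_coe_nnreal]
    norm_num
  have e8 : ENNReal.ofReal (C * (2 * cB + 1)) = (C : ℝ≥0∞) * ENNReal.ofReal (2 * cB + 1) := by
    rw [ENNReal.ofReal_mul (by positivity), ENNReal.ofReal_coe_nnreal]
  refine key.trans ?_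
  rw [add_assoc (ENNReal.ofReal R⁻¹ * _), mul_add, mul_add, e9]
  refine (add_le_add (add_le_add k1 (mul_le_mul' le_rfl k3)) (mul_le_mul' le_rfl k4)).trans (le_of_eq ?_)
  simp only [hA]
  rw [e8]
  ring

/-- Step B. -/
lemma X_small (H : Core γ ρ u S dG) (D : Gr γ ρ α E K) :
    SmallE E (fun R => nr 2 (fun x => cut R x ^ 3 * ρ x ^ γ)) := by
  obtain ⟨c1, hc1, hs⟩ := H.X_step D
  obtain ⟨B, hB, hQ⟩ := H.Q_le D
  intro ε hε
  set δ : ℝ := min (1 / (6 * (c1 + 1))) (ε / (4 * (c1 + 1) * (B + 1))) with hδ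
  have hδ0 : 0 < δ := by positivity
  have d1 : c1 * δ ≤ 1/6 := by
    have : δ ≤ 1 / (6 * (c1 + 1)) := min_le_left _ _
    rw [le_div_iff₀ (by positivity)] at this
    nlinarith
  have d2 : c1 * δ * B ≤ ε / 4 := by
    have : δ ≤ ε / (4 * (c1 + 1) * (B + 1)) := min_le_right _ _
    rw [le_div_iff₀ (by positivity)] at this
    have : 0 ≤ δ * c1 + δ * B + δ := by positivity
    nlinarith
  obtain ⟨A, hA, hX⟩ := hs δ hδ0
  obtain ⟨C, hC, hA2⟩ := hA (ε / 4) (by positivity)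
  refine ⟨2 * (1/3 + C), by positivity, fun R hR => ?_⟩
  have hR0 : 0 < R := by linarith
  have h1 := hX R hR
  have h2 := hQ R hR
  have h3 := hA2 R hR
  beta_reduce
  set X := nr 2 (fun x => cut R x ^ 3 * ρ x ^ γ) with hXd
  have h4 : X ≤ ENNReal.ofReal (1/2) * X + ENNReal.ofReal (1/3 + ε / 4 * R ^ E + (ε / 4 * R ^ E + C)) := by
    calc X ≤ _ := h1
      _ ≤ ENNReal.ofReal (1/3) * X + ENNReal.ofReal (c1 * δ) * (X + 2 + ENNReal.ofReal (B * R ^ E))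
          + ENNReal.ofReal (ε / 4 * R ^ E + C) := by gcongr
      _ = (ENNReal.ofReal (1/3) + ENNReal.ofReal (c1 * δ)) * X + (ENNReal.ofReal (c1 * δ) * 2 +
          ENNReal.ofReal (c1 * δ) * ENNReal.ofReal (B * R ^ E) + ENNReal.ofReal (ε / 4 * R ^ E + C)) := by ring
      _ ≤ _ := by
        have e2 : (2 : ℝ≥0∞) = ENNReal.ofReal 2 := by norm_num
        rw [e2, ← ENNReal.ofReal_add (by norm_num) (by positivity), ← ENNReal.ofReal_mul (by positivity),
          ← ENNReal.ofReal_mul (by positivity), ← ENNReal.ofReal_add (by positivity) (by positivity),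
          ← ENNReal.ofReal_add (by positivity) (by positivity)]
        refine add_le_add (mul_le_mul' (ENNReal.ofReal_le_ofReal (by linarith)) le_rfl)
          (ENNReal.ofReal_le_ofReal ?_)
        have : c1 * δ * (B * R ^ E) ≤ ε / 4 * R ^ E := by
          rw [← mul_assoc]; gcongr
        linarith
  refine (half_absorb (H.X_fin hR0) h4).trans ?_
  have e2 : (2 : ℝ≥0∞) = ENNReal.ofReal 2 := by norm_num
  rw [e2, ← ENNReal.ofReal_mul (by norm_num)]
  apply ENNReal.ofReal_le_ofReal
  linarith

end Core

end

noncomputable section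

open MeasureTheory Metric Filter Topology Set
open scoped ENNReal NNReal

/-! ### A small calculus of strong convergence -/

structure Cvg (q : ℝ) (fn : ℕ → E3 → ℝ) (f : E3 → ℝ) : Prop where
  mn : ∀ n, Measurable (fn n)
  m : Measurable f
  fin : nr q f ≠ ⊤
  lim : Tendsto (fun n => nr q (fun x => fn n x - f x)) atTop (𝓝 0)

lemma nr_neg {q : ℝ} (f : E3 → ℝ) : nr q (fun x => - f x) = nr q f :=
  le_antisymm (nr_mono fun x => by simp) (nr_mono fun x => by simp)

lemma Cvg.const {q : ℝ} {f : E3 → ℝ} (hf : Measurable f) (h : nr q f ≠ ⊤) :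
    Cvg q (fun _ => f) f := by
  refine ⟨fun _ => hf, hf, h, ?_⟩
  have : nr q (fun x => f x - f x) = 0 := by simp [nr]
  simp only [this]
  exact tendsto_const_nhds

lemma Cvg.congr {q : ℝ} {fn fn' : ℕ → E3 → ℝ} {f f' : E3 → ℝ} (h : Cvg q fn f)
    (e : ∀ n x, fn n x = fn' n x) (e' : ∀ x, f x = f' x) : Cvg q fn' f' := by
  have : fn = fn' := by funext n x; exact e n x
  have h2 : f = f' := funext e'
  rw [← this, ← h2]; exact h

lemma Cvg.nr_le {q : ℝ} (hq : 1 ≤ q) {fn : ℕ → E3 → ℝ} {f : E3 → ℝ} (h : Cvg q fn f) (n : ℕ) :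
    nr q (fn n) ≤ nr q (fun x => fn n x - f x) + nr q f := by
  refine le_trans (le_of_eq ?_) (nr_add hq ((h.mn n).sub h.m) h.m)
  congr 1; funext x; simp

lemma Cvg.tendsto_of_le {q : ℝ} {fn : ℕ → E3 → ℝ} {f : E3 → ℝ} (mn : ∀ n, Measurable (fn n))
    (m : Measurable f) (fin : nr q f ≠ ⊤) {b : ℕ → ℝ≥0∞} (hb : Tendsto b atTop (𝓝 0))
    (hle : ∀ n, nr q (fun x => fn n x - f x) ≤ b n) : Cvg q fn f :=
  ⟨mn, m, fin, tendsto_of_tendsto_of_tendsto_of_le_of_le tendsto_const_nhds hb (fun _ => zero_le) hle⟩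

lemma Cvg.mul {a b c : ℝ} (ha : 1 ≤ a) (hb : 1 ≤ b) (hc : 1 ≤ c) (habc : a⁻¹ + b⁻¹ = c⁻¹)
    {fn gn : ℕ → E3 → ℝ} {f g : E3 → ℝ} (hf : Cvg a fn f) (hg : Cvg b gn g) :
    Cvg c (fun n x => fn n x * gn n x) (fun x => f x * g x) := by
  have ha0 : 0 < a := by linarith
  have hb0 : 0 < b := by linarith
  have hc0 : 0 < c := by linarith
  have lim : Tendsto (fun n => nr a (fun x => fn n x - f x) * (nr b (fun x => gn n x - g x) + nr b g)
      + nr a f * nr b (fun x => gn n x - g x)) atTop (𝓝 (0 * (0 + nr b g) + nr a f * 0)) := by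
    refine Tendsto.add (ENNReal.Tendsto.mul hf.lim (Or.inr ?_) (hg.lim.add_const _) (Or.inr (by simp)))
      (ENNReal.Tendsto.const_mul hg.lim (Or.inr hf.fin))
    simpa using hg.fin
  rw [zero_mul, mul_zero, add_zero] at lim
  refine Cvg.tendsto_of_le (fun n => (hf.mn n).mul (hg.mn n)) (hf.m.mul hg.m) ?_ lim fun n => ?_
  · exact ne_top_of_le_ne_top (ENNReal.mul_ne_top hf.fin hg.fin) (nr_mul ha0 hb0 hc0 habc hf.m hg.m)
  have e : (fun x => fn n x * gn n x - f x * g x) =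
      fun x => (fn n x - f x) * gn n x + f x * (gn n x - g x) := by funext x; ring
  rw [e]
  have m1 := (hf.mn n).sub hf.m
  have m2 := (hg.mn n).sub hg.m
  refine (nr_add hc (m1.mul (hg.mn n)) (hf.m.mul m2)).trans (add_le_add ?_ ?_)
  · exact (nr_mul ha0 hb0 hc0 habc m1 (hg.mn n)).trans (mul_le_mul' le_rfl (hg.nr_le hb n))
  · exact nr_mul ha0 hb0 hc0 habc hf.m m2

lemma Cvg.add {q : ℝ} (hq : 1 ≤ q) {fn gn : ℕ → E3 → ℝ} {f g : E3 → ℝ} (hf : Cvg q fn f)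
    (hg : Cvg q gn g) : Cvg q (fun n x => fn n x + gn n x) (fun x => f x + g x) := by
  have lim := hf.lim.add hg.lim
  rw [add_zero] at lim
  refine Cvg.tendsto_of_le (fun n => (hf.mn n).add (hg.mn n)) (hf.m.add hg.m) ?_ lim fun n => ?_
  · exact ne_top_of_le_ne_top (ENNReal.add_ne_top.mpr ⟨hf.fin, hg.fin⟩) (nr_add hq hf.m hg.m)
  · refine le_trans (le_of_eq ?_) (nr_add hq ((hf.mn n).sub hf.m) ((hg.mn n).sub hg.m))
    congr 1; funext x; ring

lemma Cvg.bmul {q : ℝ} {fn : ℕ → E3 → ℝ} {f : E3 → ℝ} (hf : Cvg q fn f) {φ : E3 → ℝ}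
    (hφ : Measurable φ) {C : ℝ} (hC : ∀ x, |φ x| ≤ C) :
    Cvg q (fun n x => φ x * fn n x) (fun x => φ x * f x) := by
  have lim := ENNReal.Tendsto.const_mul (a := ENNReal.ofReal C) hf.lim (Or.inr ENNReal.ofReal_ne_top)
  rw [mul_zero] at lim
  have key : ∀ g : E3 → ℝ, nr q (fun x => φ x * g x) ≤ ENNReal.ofReal C * nr q g := fun g =>
    nr_le_mul fun x => by rw [abs_mul]; exact mul_le_mul_of_nonneg_right (hC x) (abs_nonneg _)
  refine Cvg.tendsto_of_le (fun n => hφ.mul (hf.mn n)) (hφ.mul hf.m) ?_ lim fun n => ?_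
  · exact ne_top_of_le_ne_top (ENNReal.mul_ne_top ENNReal.ofReal_ne_top hf.fin) (key f)
  · refine le_trans (le_of_eq ?_) (key _)
    congr 1; funext x; ring

lemma nr1_integrable {f : E3 → ℝ} (hf : Measurable f) (h : nr 1 f ≠ ⊤) : Integrable f volume := by
  rw [← memLp_one_iff_integrable, ← ENNReal.ofReal_one]
  exact ⟨hf.aestronglyMeasurable, h.lt_top⟩

lemma Cvg.intn {fn : ℕ → E3 → ℝ} {f : E3 → ℝ} (h : Cvg 1 fn f) :
    Tendsto (fun n => ∫ x, fn n x) atTop (𝓝 (∫ x, f x)) := by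
  refine tendsto_integral_of_L1' f (nr1_integrable h.m h.fin).aestronglyMeasurable ?_ ?_
  · have : ∀ᶠ n in atTop, nr 1 (fun x => fn n x - f x) < 1 :=
      h.lim.eventually_lt_const (by norm_num)
    filter_upwards [this] with n hn
    exact nr1_integrable (h.mn n) (ne_top_of_le_ne_top
      (ENNReal.add_ne_top.mpr ⟨(hn.trans ENNReal.one_lt_top).ne, h.fin⟩) (h.nr_le le_rfl n))
  · have := h.lim
    unfold nr at this
    rw [ENNReal.ofReal_one] at this
    exact this

lemma Cvg.int2 {a b : ℝ} (ha : 1 ≤ a) (hb : 1 ≤ b) (hab : a⁻¹ + b⁻¹ = 1)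
    {fn gn : ℕ → E3 → ℝ} {f g : E3 → ℝ} (hf : Cvg a fn f) (hg : Cvg b gn g) :
    Tendsto (fun n => ∫ x, fn n x * gn n x) atTop (𝓝 (∫ x, f x * g x)) :=
  (hf.mul ha hb le_rfl (by rw [hab, inv_one]) hg).intn

lemma nr_rp {f : E3 → ℝ} (hf : ∀ x, 0 ≤ f x) {q θ : ℝ} (hq : 0 < q) (hθ : 0 < θ) :
    nr (q / θ) (fun x => f x ^ θ) = nr q f ^ θ := by
  rw [nr_eq (by positivity), nr_eq hq, ← ENNReal.rpow_mul]
  have : ∀ x, ‖f x ^ θ‖ₑ ^ (q / θ) = ‖f x‖ₑ ^ q := by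
    intro x
    rw [Real.enorm_rpow_of_nonneg (hf x) hθ.le, ← ENNReal.rpow_mul]
    congr 1; field_simp
  simp only [this]
  congr 1; field_simp

lemma rpow_sub_le {a b θ : ℝ} (ha : 0 ≤ a) (hb : 0 ≤ b) (hθ : 1 < θ) :
    |a ^ θ - b ^ θ| ≤ θ * (|a - b| * (a + b) ^ (θ - 1)) := by
  wlog hab : b ≤ a generalizing a b
  · have := this hb ha (le_of_not_ge hab)
    rwa [abs_sub_comm, abs_sub_comm b a, add_comm b a] at this
  rcases eq_or_lt_of_le hab with h | h
  · rw [h]; simp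
  obtain ⟨c, hc, hce⟩ := exists_hasDerivAt_eq_slope (fun x => x ^ θ) (fun x => θ * x ^ (θ - 1)) h
    (Real.continuous_rpow_const (by linarith)).continuousOn
    (fun x _ => Real.hasDerivAt_rpow_const (Or.inr hθ.le))
  rw [eq_div_iff (by linarith)] at hce
  rw [← hce, abs_mul, abs_of_nonneg (show 0 ≤ θ * c ^ (θ - 1) from
    mul_nonneg (by linarith) (Real.rpow_nonneg (hb.trans hc.1.le) _)), mul_assoc, mul_comm (c ^ (θ-1))]
  have : c ^ (θ - 1) ≤ (a + b) ^ (θ - 1) :=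
    Real.rpow_le_rpow (hb.trans hc.1.le) (by linarith [hc.2]) (by linarith)
  gcongr

lemma Cvg.rp {q θ : ℝ} (hθ : 1 < θ) (hq : θ ≤ q) {fn : ℕ → E3 → ℝ} {f : E3 → ℝ} (h : Cvg q fn f)
    (pn : ∀ n x, 0 ≤ fn n x) (p : ∀ x, 0 ≤ f x) :
    Cvg (q / θ) (fun n x => fn n x ^ θ) (fun x => f x ^ θ) := by
  have hθ0 : 0 < θ := by linarith
  have hq0 : 0 < q := by linarith
  have hθ1 : 0 < θ - 1 := by linarith
  have hq1 : 1 ≤ q := by linarith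
  have lim : Tendsto (fun n => ENNReal.ofReal θ * (nr q (fun x => fn n x - f x) *
      (nr q (fun x => fn n x - f x) + nr q f + nr q f) ^ (θ - 1))) atTop
      (𝓝 (ENNReal.ofReal θ * (0 * (0 + nr q f + nr q f) ^ (θ - 1)))) := by
    refine ENNReal.Tendsto.const_mul (ENNReal.Tendsto.mul h.lim (Or.inr ?_)
      (((h.lim.add_const _).add_const _).ennrpow_const _) (Or.inr (by simp)))
      (Or.inr ENNReal.ofReal_ne_top)
    exact ENNReal.rpow_ne_top_of_nonneg hθ1.le (by simp [h.fin])
  rw [zero_mul, mul_zero] at lim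
  refine Cvg.tendsto_of_le (fun n => (h.mn n).pow_const θ) (h.m.pow_const θ) ?_ lim fun n => ?_
  · rw [nr_rp p hq0 hθ0]
    exact ENNReal.rpow_ne_top_of_nonneg hθ0.le h.fin
  have m1 := (h.mn n).sub h.m
  have m2 := ((h.mn n).add h.m).pow_const (θ - 1)
  refine (nr_le_mul (g := fun x => (fn n x - f x) * (fn n x + f x) ^ (θ - 1)) fun x => ?_).trans
    (mul_le_mul' le_rfl ?_)
  · refine (rpow_sub_le (pn n x) (p x) hθ).trans (le_of_eq ?_)
    rw [abs_mul, abs_of_nonneg (Real.rpow_nonneg (add_nonneg (pn n x) (p x)) _)]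
  refine (nr_mul (a := q) (b := q / (θ - 1)) hq0 (by positivity) (by positivity) ?_ m1 m2).trans
    (mul_le_mul' le_rfl ?_)
  · field_simp; ring
  · have := nr_rp (f := fun x => fn n x + f x) (fun x => add_nonneg (pn n x) (p x)) hq0 hθ1
    refine (le_of_eq this).trans (ENNReal.rpow_le_rpow ?_ hθ1.le)
    exact (nr_add hq1 (h.mn n) h.m).trans (add_le_add (h.nr_le hq1 n) le_rfl)

lemma cts_bdd {φ : E3 → ℝ} (h : Continuous φ) (hc : HasCompactSupport φ) : ∃ C, ∀ x, |φ x| ≤ C :=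
  h.bounded_above_of_compact_support hc

lemma cts_fin {φ : E3 → ℝ} (h : Continuous φ) (hc : HasCompactSupport φ) (q : ℝ) : nr q φ ≠ ⊤ :=
  (h.memLp_of_hasCompactSupport hc).2.ne

lemma loc_fin {q : ℝ} {f : E3 → ℝ} (hf : ∀ r, nr q (ind r f) ≠ ⊤) {φ : E3 → ℝ} (h : Continuous φ)
    (hc : HasCompactSupport φ) : nr q (fun x => φ x * f x) ≠ ⊤ := by
  obtain ⟨C, hC⟩ := cts_bdd h hc
  obtain ⟨r, hr⟩ := hc.isCompact.isBounded.subset_closedBall (0 : E3)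
  refine ne_top_of_le_ne_top (ENNReal.mul_ne_top ENNReal.ofReal_ne_top (hf r))
    (nr_le_mul (c := C) fun x => ?_)
  by_cases hx : ‖x‖ ≤ r
  · rw [ind_of_le hx, abs_mul]; exact mul_le_mul_of_nonneg_right (hC x) (abs_nonneg _)
  · have : φ x = 0 := by
      by_contra h0
      have := hr (subset_tsupport φ h0)
      simp only [mem_closedBall, dist_zero_right] at this
      exact hx this
    rw [this, ind_of_lt (not_le.mp hx)]; simp

end

noncomputable section

open MeasureTheory Metric Filter Topology Set
open scoped ENNReal NNReal

/-! ### Difference quotients, mollification and the commutator -/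

/-- Derivative of a mollification. -/
lemma pd_cv {K f : E3 → ℝ} (hK : Sm K) (hKc : HasCompactSupport K)
    (hf : LocallyIntegrable f volume) {ε : ℝ} (hε : 0 < ε) (i : Fin 3) (x : E3) :
    pd (cv K f ε) i x = ε⁻¹ * cv (pd K i) f ε x := by
  have e : cv K f ε = fun x => (ε ^ 3)⁻¹ *
      (MeasureTheory.convolution f (fun y => K (ε⁻¹ • y)) (ContinuousLinearMap.mul ℝ ℝ) volume) x := by
    funext x
    rw [cv_eq_conv K f hε x]
    rfl
  set k : E3 → ℝ := fun y => K (ε⁻¹ • y) with hk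
  have ks : Sm k := hK.comp (contDiff_const_smul _)
  have kc : HasCompactSupport k := hKc.comp_smul (inv_ne_zero hε.ne')
  have hd := kc.hasFDerivAt_convolution_right (ContinuousLinearMap.mul ℝ ℝ) hf ks.one x
  rw [e]
  change fderiv ℝ _ x _ = _
  rw [fderiv_const_mul hd.differentiableAt, hd.fderiv]
  rw [_root_.smul_apply, smul_eq_mul,
    convolution_precompR_apply (ContinuousLinearMap.mul ℝ ℝ) hf (kc.fderiv ℝ) (ks.one.continuous_fderiv one_ne_zero)]
  rw [cv_eq_conv _ f hε x]
  have : ∀ y, fderiv ℝ k y (EuclideanSpace.single i 1) = ε⁻¹ * pd K i (ε⁻¹ • y) := fun y =>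
    pd_comp_smul (hK.one.differentiable one_ne_zero) _ _ _
  unfold MeasureTheory.convolution
  simp only [this, ContinuousLinearMap.mul_apply']
  rw [mul_left_comm ε⁻¹]
  congr 1
  rw [← integral_const_mul]
  congr 1; funext t
  ring

/-- mean value theorem for translations -/
lemma translate_mvt {b w : E3 → ℝ} (hb : Integrable b volume) (hw : Sm w) (hwc : HasCompactSupport w)
    (h : E3) : ∃ t ∈ Ioo (0:ℝ) 1, ∫ x, b x * (w x - w (x - h)) =
      ∫ x, b x * ∑ k, h k * pd w k (x - t • h) := by
  have wd : Differentiable ℝ w := hw.one.differentiable one_ne_zero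
  obtain ⟨C0, hC0⟩ := cts_bdd hw.continuous hwc
  have hder : ∀ x t, HasDerivAt (fun t : ℝ => w (x - t • h)) (- ∑ k, h k * pd w k (x - t • h)) t := by
    intro x t
    have h1 : HasDerivAt (fun t : ℝ => x - t • h) (-h) t := by
      simpa using ((hasDerivAt_id t).smul_const h).const_sub x
    have h2 := (wd (x - t • h)).hasFDerivAt.comp_hasDerivAt t h1
    suffices e3 : - ∑ k, h k * pd w k (x - t • h) = fderiv ℝ w (x - t • h) (-h) by
      rw [e3]; exact h2
    rw [map_neg]
    congr 1
    have hh : h = ∑ k, h k • EuclideanSpace.single k (1:ℝ) := by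
      ext j
      simp [Pi.single_apply]
    have hh' : fderiv ℝ w (x - t • h) h = fderiv ℝ w (x - t • h) (∑ k, h k • EuclideanSpace.single k (1:ℝ)) :=
      congrArg _ hh
    rw [hh']
    rw [map_sum]
    refine Finset.sum_congr rfl fun k _ => ?_
    rw [map_smul, smul_eq_mul]
    rfl
  choose Cp hCp using fun k => cts_bdd (continuous_pd hw.one k) (hcs_pd hwc k)
  have bdd : ∀ y, |∑ k, h k * pd w k y| ≤ ∑ k, |h k| * Cp k := fun y => by
    refine (Finset.abs_sum_le_sum_abs _ _).trans (Finset.sum_le_sum fun k _ => ?_)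
    rw [abs_mul]; exact mul_le_mul_of_nonneg_left (hCp k y) (abs_nonneg _)
  have csum : Continuous fun y => ∑ k, h k * pd w k y :=
    continuous_finsetSum _ fun k _ => continuous_const.mul (continuous_pd hw.one k)
  have hIntg : ∀ t : ℝ, Integrable (fun x => b x * w (x - t • h)) volume := fun t => by
    refine hb.mul_bdd (c := C0) (hw.continuous.comp (by fun_prop)).aestronglyMeasurable (ae_of_all _ fun x => hC0 _)
  have hg : ∀ t : ℝ, HasDerivAt (fun t : ℝ => ∫ x, b x * w (x - t • h))
      (∫ x, b x * (- ∑ k, h k * pd w k (x - t • h))) t := by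
    intro t
    refine (hasDerivAt_integral_of_dominated_loc_of_deriv_le (μ := volume)
      (F := fun t x => b x * w (x - t • h)) (F' := fun t x => b x * (- ∑ k, h k * pd w k (x - t • h)))
      (bound := fun x => |b x| * ∑ k, |h k| * Cp k) (s := univ)
      (x₀ := t) Filter.univ_mem ?_ ?_ ?_ ?_ ?_ ?_).2
    · exact Eventually.of_forall fun t => (hIntg t).aestronglyMeasurable
    · exact hIntg t
    · exact hb.aestronglyMeasurable.mul (csum.comp (by fun_prop)).neg.aestronglyMeasurable
    · refine ae_of_all _ fun x t _ => ?_
      rw [norm_mul, norm_neg]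
      exact mul_le_mul_of_nonneg_left (bdd _) (norm_nonneg _)
    · exact hb.abs.mul_const _
    · exact ae_of_all _ fun x t _ => (hder x t).const_mul (b x)
  obtain ⟨t, ht, hte⟩ := exists_hasDerivAt_eq_slope (fun t : ℝ => ∫ x, b x * w (x - t • h)) _ one_pos
    (fun t _ => (hg t).continuousAt.continuousWithinAt) (fun t _ => hg t)
  refine ⟨t, ht, ?_⟩
  simp only [one_smul, zero_smul, sub_zero, div_one, mul_neg] at hte
  rw [integral_neg] at hte
  have h0 : Integrable (fun x => b x * w x) volume := by simpa using hIntg 0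
  have h1 : Integrable (fun x => b x * w (x - h)) volume := by simpa using hIntg 1
  have : ∫ x, b x * (w x - w (x - h)) = (∫ x, b x * w x) - ∫ x, b x * w (x - h) := by
    rw [← integral_sub h0 h1]; congr 1; funext x; ring
  rw [this]; linarith

lemma nr_translate {q : ℝ} (hq : 0 < q) (f : E3 → ℝ) (h : E3) : nr q (fun x => f (x - h)) = nr q f := by
  rw [nr_eq hq, nr_eq hq]
  congr 1
  exact lintegral_sub_right_eq_self (fun x => ‖f x‖ₑ ^ q) h

lemma holder2r {a b : ℝ} (hab : a.HolderConjugate b) {f g : E3 → ℝ} (hf : Measurable f)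
    (hg : Measurable g) (h1 : nr a f ≠ ⊤) (h2 : nr b g ≠ ⊤) :
    |∫ x, f x * g x| ≤ (nr a f).toReal * (nr b g).toReal := by
  have := holder2 hab hf hg
  rw [← ENNReal.toReal_mul, ← Real.norm_eq_abs, ← toReal_enorm]
  exact ENNReal.toReal_mono (ENNReal.mul_ne_top h1 h2) this

/-- a Sobolev function with its approximating sequence -/
structure Sob (u : E3 → ℝ) (du : Fin 3 → E3 → ℝ) (un : ℕ → E3 → ℝ) : Prop where
  sm : ∀ n, Sm (un n)
  hcs : ∀ n, HasCompactSupport (un n)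
  c6 : Cvg 6 un u
  c2 : ∀ k, Cvg 2 (fun n => pd (un n) k) (du k)

lemma Sob.diff {u : E3 → ℝ} {du : Fin 3 → E3 → ℝ} {un : ℕ → E3 → ℝ} (H : Sob u du un)
    {b : E3 → ℝ} (bm : Measurable b) (b1 : nr 1 b ≠ ⊤) (b65 : nr (6/5) b ≠ ⊤) (b2 : nr 2 b ≠ ⊤)
    (h : E3) {M : ℝ} (hM0 : 0 ≤ M)
    (hM : ∀ t ∈ Ioo (0:ℝ) 1, ∀ k, nr 2 (fun x => du k (x - t • h) - du k x) ≤ ENNReal.ofReal M) :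
    |(∫ x, b x * (u x - u (x - h))) - ∑ k, h k * ∫ x, b x * du k x| ≤
      (nr 2 b).toReal * (∑ k, |h k|) * M := by
  have l1 : Tendsto (fun n => ∫ x, b x * (un n x - un n (x - h))) atTop
      (𝓝 (∫ x, b x * (u x - u (x - h)))) := by
    have ms : Measurable fun x : E3 => x - h := by fun_prop
    have c6' : Cvg 6 (fun n x => -un n (x - h)) (fun x => -u (x - h)) := by
      refine Cvg.tendsto_of_le (fun n => ((H.c6.mn n).comp ms).neg) (H.c6.m.comp ms).neg ?_ H.c6.lim fun n => ?_
      · rw [nr_neg, nr_translate (by norm_num)]; exact H.c6.fin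
      · rw [← nr_translate (by norm_num) (fun x => un n x - u x) h]
        exact nr_mono fun x => by rw [abs_sub_comm]; apply le_of_eq; congr 1; ring
    refine (Cvg.int2 (a := 6/5) (b := 6) (by norm_num) (by norm_num) (by norm_num) (Cvg.const bm b65)
      (H.c6.add (by norm_num) c6')).congr' ?_ |>.trans ?_
    · exact Eventually.of_forall fun n => by simp only [sub_eq_add_neg]
    · simp only [sub_eq_add_neg]; exact le_rfl
  have l2 : Tendsto (fun n => ∑ k, h k * ∫ x, b x * pd (un n) k x) atTop
      (𝓝 (∑ k, h k * ∫ x, b x * du k x)) :=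
    tendsto_finsetSum _ fun k _ => (Cvg.int2 (by norm_num) (by norm_num) (by norm_num)
      (Cvg.const bm b2) (H.c2 k)).const_mul _
  have l3 : Tendsto (fun n => (nr 2 b * ∑ k, ENNReal.ofReal |h k| *
      (nr 2 (fun x => pd (un n) k x - du k x) + (ENNReal.ofReal M +
        nr 2 (fun x => pd (un n) k x - du k x)))).toReal) atTop
      (𝓝 ((nr 2 b).toReal * (∑ k, |h k|) * M)) := by
    have e : (nr 2 b).toReal * (∑ k, |h k|) * M = (nr 2 b * ∑ k : Fin 3, ENNReal.ofReal |h k| *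
      (0 + (ENNReal.ofReal M + 0))).toReal := by
      rw [ENNReal.toReal_mul, ENNReal.toReal_sum fun k _ => by finiteness, mul_assoc, Finset.sum_mul]
      congr 2; funext k
      rw [zero_add, add_zero, ENNReal.toReal_mul, ENNReal.toReal_ofReal (abs_nonneg _), ENNReal.toReal_ofReal hM0]
    rw [e]
    refine (ENNReal.tendsto_toReal ?_).comp ?_
    · refine ENNReal.mul_ne_top b2 (ENNReal.sum_ne_top.mpr fun k _ => by finiteness)
    · refine ENNReal.Tendsto.const_mul (tendsto_finsetSum _ fun k _ => ?_) (Or.inr b2)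
      refine ENNReal.Tendsto.const_mul ?_ (Or.inr ENNReal.ofReal_ne_top)
      exact (H.c2 k).lim.add (tendsto_const_nhds.add (H.c2 k).lim)
  have ev : ∀ᶠ n in atTop, ∀ k, nr 2 (fun x => pd (un n) k x - du k x) < ⊤ := by
    rw [eventually_all]
    exact fun k => (H.c2 k).lim.eventually_lt_const (by simp)
  refine le_of_tendsto_of_tendsto (l1.sub l2).abs l3 ?_
  filter_upwards [ev] with n hn
  have bi : Integrable b volume := nr1_integrable bm b1
  obtain ⟨t, ht, hte⟩ := translate_mvt bi (H.sm n) (H.hcs n) h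
  have ms : Measurable fun x : E3 => x - t • h := by fun_prop
  rw [hte]
  have pm : ∀ k, Measurable (pd (un n) k) := fun k => (continuous_pd (H.sm n).one k).measurable
  have i1 : ∀ k, Integrable (fun x => b x * (h k * pd (un n) k (x - t • h))) volume := fun k => by
    obtain ⟨C, hC⟩ := cts_bdd (continuous_pd (H.sm n).one k) (hcs_pd (H.hcs n) k)
    refine bi.mul_bdd (c := |h k| * C) ((pm k).comp ms |>.const_mul _).aestronglyMeasurable
      (ae_of_all _ fun x => ?_)
    rw [norm_mul]; exact mul_le_mul_of_nonneg_left (hC _) (norm_nonneg _)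
  have i2 : ∀ k, Integrable (fun x => b x * pd (un n) k x) volume := fun k => by
    obtain ⟨C, hC⟩ := cts_bdd (continuous_pd (H.sm n).one k) (hcs_pd (H.hcs n) k)
    exact bi.mul_bdd (c := C) (pm k).aestronglyMeasurable (ae_of_all _ fun x => hC x)
  have i1' : ∀ k, Integrable (fun x => b x * pd (un n) k (x - t • h)) volume := fun k => by
    obtain ⟨C, hC⟩ := cts_bdd (continuous_pd (H.sm n).one k) (hcs_pd (H.hcs n) k)
    exact bi.mul_bdd (c := C) ((pm k).comp ms).aestronglyMeasurable (ae_of_all _ fun x => hC _)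
  have e2 : (∫ x, b x * ∑ k, h k * pd (un n) k (x - t • h)) - ∑ k, h k * ∫ x, b x * pd (un n) k x =
      ∑ k, h k * ∫ x, b x * (pd (un n) k (x - t • h) - pd (un n) k x) := by
    simp only [Finset.mul_sum]
    rw [integral_finsetSum _ fun k _ => i1 k, ← Finset.sum_sub_distrib]
    refine Finset.sum_congr rfl fun k _ => ?_
    simp only [mul_sub]
    rw [integral_sub (i1' k) (i2 k), mul_sub]
    congr 1
    rw [← integral_const_mul]
    congr 1; funext x; ring
  rw [e2]
  have dm := fun k => (H.c2 k).m
  have key : ∀ k, nr 2 (fun x => pd (un n) k (x - t • h) - pd (un n) k x) ≤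
      nr 2 (fun x => pd (un n) k x - du k x) + (ENNReal.ofReal M +
        nr 2 (fun x => pd (un n) k x - du k x)) := fun k => by
    have a1 := nr_add (r := 2) (by norm_num)
      (f := fun x => pd (un n) k (x - t • h) - du k (x - t • h))
      (g := fun x => (du k (x - t • h) - du k x) + (du k x - pd (un n) k x))
      (((pm k).comp ms).sub ((dm k).comp ms)) ((((dm k).comp ms).sub (dm k)).add ((dm k).sub (pm k)))
    have a2 := nr_add (r := 2) (by norm_num)
      (f := fun x => du k (x - t • h) - du k x) (g := fun x => du k x - pd (un n) k x)
      (((dm k).comp ms).sub (dm k)) ((dm k).sub (pm k))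
    have a3 : nr 2 (fun x => du k x - pd (un n) k x) = nr 2 (fun x => pd (un n) k x - du k x) := by
      rw [← nr_neg]; congr 1; funext x; ring
    have a4 := nr_translate (q := 2) (by norm_num) (fun x => pd (un n) k x - du k x) (t • h)
    rw [a3] at a2
    rw [a4] at a1
    refine le_trans (le_of_eq ?_) (a1.trans (add_le_add le_rfl (a2.trans (add_le_add (hM t ht k) le_rfl))))
    congr 1; funext x; ring
  have fin : ∀ k, ENNReal.ofReal |h k| * (nr 2 (fun x => pd (un n) k x - du k x) + (ENNReal.ofReal M +
        nr 2 (fun x => pd (un n) k x - du k x))) ≠ ⊤ := fun k => by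
    have := (hn k).ne
    finiteness
  rw [ENNReal.toReal_mul, ENNReal.toReal_sum fun k _ => fin k, Finset.mul_sum]
  refine (Finset.abs_sum_le_sum_abs _ _).trans (Finset.sum_le_sum fun k _ => ?_)
  rw [abs_mul, ENNReal.toReal_mul, ENNReal.toReal_ofReal (abs_nonneg _), mul_left_comm]
  refine mul_le_mul_of_nonneg_left ?_ (abs_nonneg _)
  have hfk : nr 2 (fun x => pd (un n) k x - du k x) + (ENNReal.ofReal M +
        nr 2 (fun x => pd (un n) k x - du k x)) ≠ ⊤ := by
    have := (hn k).ne
    finiteness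
  refine (holder2r conj22 bm (((pm k).comp ms).sub (pm k)) b2 (ne_top_of_le_ne_top hfk (key k))).trans ?_
  exact mul_le_mul_of_nonneg_left (ENNReal.toReal_mono hfk (key k)) ENNReal.toReal_nonneg

end

noncomputable section

open MeasureTheory Metric Filter Topology Set
open scoped ENNReal NNReal

/-! ### Renormalization of the continuity equation -/

section Renorm

variable {u : E3 → ℝ} {du : Fin 3 → E3 → ℝ} {un : ℕ → E3 → ℝ}

lemma Sob.diff_bdd (H : Sob u du un)
    {b : E3 → ℝ} (bm : Measurable b) (b1 : nr 1 b ≠ ⊤) (b65 : nr (6/5) b ≠ ⊤) (b2 : nr 2 b ≠ ⊤)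
    (z : E3) {e : ℝ} (he : 0 < e) :
    |e⁻¹ * ∫ x, b x * (u x - u (x - e • z))| ≤
      (nr 2 b).toReal * (∑ k, |z k|) * (3 * ∑ k, (nr 2 (du k)).toReal) := by
  set N : ℝ := ∑ k, (nr 2 (du k)).toReal with hN
  have Nk : ∀ k, (nr 2 (du k)).toReal ≤ N := fun k =>
    Finset.single_le_sum (f := fun k => (nr 2 (du k)).toReal) (fun k _ => ENNReal.toReal_nonneg) (Finset.mem_univ k)
  have N0 : 0 ≤ N := Finset.sum_nonneg fun k _ => ENNReal.toReal_nonneg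
  have nk : ∀ k, nr 2 (du k) ≤ ENNReal.ofReal N := fun k =>
    (ENNReal.le_ofReal_iff_toReal_le (H.c2 k).fin N0).mpr (Nk k)
  have h1 := H.diff bm b1 b65 b2 (e • z) (M := 2 * N) (by positivity) fun t _ k => by
    have ms : Measurable fun x : E3 => x - t • (e • z) := by fun_prop
    have := nr_add (r := 2) (by norm_num) ((H.c2 k).m.comp ms) (H.c2 k).m.neg
    have e1 : nr 2 (du k ∘ fun x : E3 => x - t • (e • z)) = nr 2 (du k) := nr_translate (by norm_num) _ _
    have e2 : nr 2 (-du k) = nr 2 (du k) := nr_neg _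
    rw [e1, e2] at this
    refine le_trans (le_of_eq ?_) (this.trans ((add_le_add (nk k) (nk k)).trans (le_of_eq ?_)))
    · congr 1
    · rw [← ENNReal.ofReal_add N0 N0, two_mul]
  have h2 : |∑ k, (e • z) k * ∫ x, b x * du k x| ≤ (nr 2 b).toReal * (∑ k, |(e • z) k|) * N := by
    clear_value N
    rw [Finset.mul_sum, Finset.sum_mul]
    refine (Finset.abs_sum_le_sum_abs _ _).trans (Finset.sum_le_sum fun k _ => ?_)
    rw [abs_mul, mul_comm (nr 2 b).toReal, mul_assoc]
    refine mul_le_mul_of_nonneg_left ?_ (abs_nonneg _)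
    refine (holder2r conj22 bm (H.c2 k).m b2 (H.c2 k).fin).trans ?_
    exact mul_le_mul_of_nonneg_left (Nk k) ENNReal.toReal_nonneg
  have h3 : ∑ k, |(e • z) k| = e * ∑ k, |z k| := by
    rw [Finset.mul_sum]
    refine Finset.sum_congr rfl fun k _ => ?_
    rw [PiLp.smul_apply, smul_eq_mul, abs_mul, abs_of_pos he]
  rw [h3] at h1 h2
  rw [abs_mul, abs_of_pos (inv_pos.mpr he), inv_mul_le_iff₀ he]
  have h4 := abs_sub_abs_le_abs_sub (∫ x, b x * (u x - u (x - e • z))) (∑ k, (e • z) k * ∫ x, b x * du k x)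
  calc |∫ x, b x * (u x - u (x - e • z))| ≤ (nr 2 b).toReal * (e * ∑ k, |z k|) * (2 * N) +
        (nr 2 b).toReal * (e * ∑ k, |z k|) * N := by linarith [h4.trans h1]
    _ = _ := by ring

lemma Sob.diff_lim (H : Sob u du un)
    {bn : ℕ → E3 → ℝ} {b : E3 → ℝ} (B : Cvg 2 bn b) (b1 : ∀ n, nr 1 (bn n) ≠ ⊤)
    (b65 : ∀ n, nr (6/5) (bn n) ≠ ⊤) (b2 : ∀ n, nr 2 (bn n) ≠ ⊤)
    (z : E3) {e : ℕ → ℝ} (he : ∀ n, 0 < e n) (he0 : Tendsto e atTop (𝓝 0)) :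
    Tendsto (fun n => (e n)⁻¹ * ∫ x, bn n x * (u x - u (x - e n • z))) atTop
      (𝓝 (∑ k, z k * ∫ x, b x * du k x)) := by
  have l2 : Tendsto (fun n => ∑ k, z k * ∫ x, bn n x * du k x) atTop
      (𝓝 (∑ k, z k * ∫ x, b x * du k x)) :=
    tendsto_finsetSum _ fun k _ => (Cvg.int2 (by norm_num) (by norm_num) (by norm_num)
      B (Cvg.const (H.c2 k).m (H.c2 k).fin)).const_mul _
  suffices l3 : Tendsto (fun n => (e n)⁻¹ * (∫ x, bn n x * (u x - u (x - e n • z))) -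
      ∑ k, z k * ∫ x, bn n x * du k x) atTop (𝓝 0) by
    have := l3.add l2
    simpa using this
  set Z : ℝ := ∑ k, |z k| with hZ
  have Z0 : 0 ≤ Z := Finset.sum_nonneg fun k _ => abs_nonneg _
  set L : ℝ := (1 + nr 2 b).toReal with hL
  have L0 : 0 ≤ L := ENNReal.toReal_nonneg
  have evb : ∀ᶠ n in atTop, (nr 2 (bn n)).toReal ≤ L := by
    have : ∀ᶠ n in atTop, nr 2 (fun x => bn n x - b x) < 1 := B.lim.eventually_lt_const (by norm_num)
    filter_upwards [this] with n hn
    refine ENNReal.toReal_mono (ENNReal.add_ne_top.mpr ⟨by simp, B.fin⟩) ?_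
    exact (B.nr_le (by norm_num) n).trans (add_le_add hn.le le_rfl)
  rw [Metric.tendsto_atTop']
  intro δ hδ
  have hδ' : 0 < δ / (L * Z + 1) := by positivity
  set M := δ / (L * Z + 1) with hM
  have tr : ∀ᶠ w : E3 in 𝓝 0, ∀ k, nr 2 (fun x => du k (x - w) - du k x) < ENNReal.ofReal M := by
    rw [eventually_all]
    intro k
    have := tendsto_translate (p := ENNReal.ofReal 2) (by simp) ENNReal.ofReal_ne_top
      (f := du k) ⟨(H.c2 k).m.aestronglyMeasurable, (H.c2 k).fin.lt_top⟩
    exact this.eventually_lt_const (by simpa using hδ')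
  obtain ⟨d, hd, hdw⟩ := Metric.eventually_nhds_iff.mp tr
  have eve : ∀ᶠ n in atTop, e n * ‖z‖ < d := by
    have := he0.mul_const ‖z‖
    rw [zero_mul] at this
    exact this.eventually_lt_const hd
  obtain ⟨n0, hn0⟩ := eventually_atTop.mp (evb.and eve)
  refine ⟨n0, fun n hn => ?_⟩
  obtain ⟨h1, h2⟩ := hn0 n hn.le
  have key := H.diff (B.mn n) (b1 n) (b65 n) (b2 n) (e n • z) hδ'.le fun t ht k => by
    refine (hdw ?_ k).le
    rw [dist_zero_right, norm_smul, norm_smul, Real.norm_of_nonneg ht.1.le, Real.norm_of_nonneg (he n).le]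
    calc t * (e n * ‖z‖) ≤ 1 * (e n * ‖z‖) := mul_le_mul_of_nonneg_right ht.2.le (mul_nonneg (he n).le (norm_nonneg _))
      _ < d := by rw [one_mul]; exact h2
  have h3 : ∑ k, |(e n • z) k| = e n * Z := by
    rw [hZ, Finset.mul_sum]
    refine Finset.sum_congr rfl fun k _ => ?_
    rw [PiLp.smul_apply, smul_eq_mul, abs_mul, abs_of_pos (he n)]
  have h4 : ∑ k, (e n • z) k * ∫ x, bn n x * du k x = e n * ∑ k, z k * ∫ x, bn n x * du k x := by
    rw [Finset.mul_sum]
    refine Finset.sum_congr rfl fun k _ => ?_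
    rw [PiLp.smul_apply, smul_eq_mul, mul_assoc]
  rw [h3, h4] at key
  rw [dist_zero_right, Real.norm_eq_abs]
  set I := ∫ x, bn n x * (u x - u (x - e n • z))
  set S := ∑ k, z k * ∫ x, bn n x * du k x
  have e1 : (e n)⁻¹ * I - S = (e n)⁻¹ * (I - e n * S) := by
    have := (he n).ne'
    field_simp
  rw [e1, abs_mul, abs_of_pos (inv_pos.mpr (he n)), inv_mul_lt_iff₀ (he n)]
  refine key.trans_lt ?_
  have e2 : M * (L * Z + 1) = δ := by rw [hM]; field_simp
  have hp := he n
  calc (nr 2 (bn n)).toReal * (e n * Z) * M ≤ L * (e n * Z) * M := by gcongr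
    _ = e n * (M * (L * Z)) := by ring
    _ < e n * δ := by
      apply mul_lt_mul_of_pos_left _ hp
      rw [← e2]; nlinarith

lemma Sob.ibp (H : Sob u du un) {g : E3 → ℝ} (hg : ContDiff ℝ 1 g) (hc : HasCompactSupport g) (i : Fin 3) :
    ∫ x, pd g i x * u x = - ∫ x, g x * du i x := by
  have l1 : Tendsto (fun n => ∫ x, pd g i x * un n x) atTop (𝓝 (∫ x, pd g i x * u x)) :=
    Cvg.int2 (a := 6/5) (b := 6) (by norm_num) (by norm_num) (by norm_num)
      (Cvg.const (continuous_pd hg i).measurable (cts_fin (continuous_pd hg i) (hcs_pd hc i) _)) H.c6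
  have l2 : Tendsto (fun n => - ∫ x, g x * pd (un n) i x) atTop (𝓝 (- ∫ x, g x * du i x)) :=
    (Cvg.int2 (a := 2) (b := 2) (by norm_num) (by norm_num) (by norm_num)
      (Cvg.const hg.continuous.measurable (cts_fin hg.continuous hc _)) (H.c2 i)).neg
  refine tendsto_nhds_unique l1 (l2.congr fun n => ?_)
  have := _root_.ibp hg (H.sm n).one (H.hcs n) i
  linarith

/-- Fubini, with L² densities -/
lemma fub {K f g : E3 → ℝ} (hK : Continuous K) (hKc : HasCompactSupport K)
    (hf : Measurable f) (hg : Measurable g) (f2 : nr 2 f ≠ ⊤) (g2 : nr 2 g ≠ ⊤) (ε : ℝ) :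
    Integrable (Function.uncurry fun (x z : E3) => K z * f (x - ε • z) * g x)
      (volume.prod volume) := by
  have hm : Measurable (Function.uncurry fun (x z : E3) => K z * f (x - ε • z) * g x) :=
    ((hK.measurable.comp measurable_snd).mul (measurable_shift hf ε)).mul
      (hg.comp measurable_fst)
  refine ⟨hm.aestronglyMeasurable, ?_⟩
  unfold HasFiniteIntegral
  rw [lintegral_prod_symm _ hm.enorm.aemeasurable]
  have hle : ∀ z : E3, ∫⁻ x, ‖Function.uncurry (fun (x z : E3) => K z * f (x - ε • z) * g x) (x, z)‖ₑ ≤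
      ‖K z‖ₑ * (nr 2 f * nr 2 g) := fun z => by
    simp only [Function.uncurry, enorm_mul, mul_assoc]
    have ms : Measurable fun x : E3 => x - ε • z := by fun_prop
    have e0 := lintegral_const_mul (μ := volume) ‖K z‖ₑ (((hf.comp ms).enorm).mul hg.enorm)
    refine (le_of_eq e0).trans (mul_le_mul_right ?_ _)
    refine (holder2_lint conj22 (hf.comp ms) hg).trans (le_of_eq ?_)
    congr 1
    exact nr_translate (by norm_num) f _
  refine (lintegral_mono hle).trans_lt ?_
  rw [lintegral_mul_const _ hK.measurable.enorm]
  refine ENNReal.mul_lt_top ?_ (ENNReal.mul_lt_top f2.lt_top g2.lt_top)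
  exact (hK.integrable_of_hasCompactSupport hKc).2

lemma pd_eta_ne {i : Fin 3} {z : E3} (h : pd eta i z ≠ 0) : ‖z‖ ≤ 2 := by
  by_contra hz
  push Not at hz
  apply h
  have : eta =ᶠ[𝓝 z] fun _ => 0 := by
    filter_upwards [(isOpen_lt continuous_const continuous_norm).mem_nhds hz] with y hy
    exact eta_zero (le_of_lt hy)
  unfold pd
  rw [this.fderiv_eq]
  simp

lemma div_cv {ρ : E3 → ℝ} {u : Fin 3 → E3 → ℝ} 
    (mass : ∀ φ, Sm φ → HasCompactSupport φ → ∑ i, ∫ x, ρ x * u i x * pd φ i x = 0)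
    {r ε : ℝ} (hε : 0 < ε) {x : E3} (hx : ‖x‖ + 2 * ε ≤ r) :
    ∑ i, cv (pd eta i) (fun y => ind r ρ y * u i y) ε x = 0 := by
  set φ : E3 → ℝ := fun t => eta (ε⁻¹ • (x - t)) with hφ
  have φs : Sm φ := eta_smooth.comp (by fun_prop)
  have φc : HasCompactSupport φ := by
    refine HasCompactSupport.of_support_subset_isCompact (isCompact_closedBall x (2 * ε)) fun t ht => ?_
    rw [mem_closedBall, dist_eq_norm]
    by_contra h
    push Not at h
    apply ht
    apply eta_zero
    rw [norm_smul, norm_inv, Real.norm_of_nonneg hε.le, le_inv_mul_iff₀ hε, norm_sub_rev]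
    linarith
  have hpd : ∀ i t, pd φ i t = - (ε⁻¹ * pd eta i (ε⁻¹ • (x - t))) := fun i t => by
    unfold pd
    have h1 : HasFDerivAt (fun t : E3 => ε⁻¹ • (x - t)) (ε⁻¹ • (- ContinuousLinearMap.id ℝ E3)) t :=
      ((hasFDerivAt_id t).const_sub x).const_smul ε⁻¹
    have h2 := (eta_smooth.one.differentiable one_ne_zero (ε⁻¹ • (x - t))).hasFDerivAt.comp t h1
    have h3 : fderiv ℝ φ t = _ := h2.fderiv
    rw [h3]
    simp
  have := mass φ φs φc
  simp only [hpd] at this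
  have e : ∀ i, cv (pd eta i) (fun y => ind r ρ y * u i y) ε x =
      - (ε * (ε ^ 3)⁻¹) * ∫ t, ρ t * u i t * -(ε⁻¹ * pd eta i (ε⁻¹ • (x - t))) := fun i => by
    rw [cv_eq_conv _ _ hε, neg_mul, mul_assoc, mul_left_comm, ← mul_neg]
    congr 1
    rw [← integral_const_mul, ← integral_neg]
    congr 1; funext t
    by_cases h : pd eta i (ε⁻¹ • (x - t)) = 0
    · simp [h]
    · have h2 := pd_eta_ne h
      rw [norm_smul, norm_inv, Real.norm_of_nonneg hε.le, inv_mul_le_iff₀ hε] at h2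
      have h3 : ‖t‖ ≤ r := by
        have := norm_sub_norm_le t x
        rw [norm_sub_rev] at this
        linarith
      rw [ind_of_le h3]
      field_simp
  simp only [e]
  rw [← Finset.mul_sum, this, mul_zero]

end Renorm

end

noncomputable section

open MeasureTheory Metric Filter Topology Set
open scoped ENNReal NNReal

/-! ### Renormalization: the limit -/

lemma avg_nonneg {f : E3 → ℝ} (hf : ∀ x, 0 ≤ f x) (ε : ℝ) (x : E3) : 0 ≤ avg f ε x :=
  integral_nonneg fun z => mul_nonneg (eta_nonneg z) (hf _)

lemma pd_rpow {s : E3 → ℝ} {x : E3} (hs : DifferentiableAt ℝ s x) {θ : ℝ} (hθ : 1 ≤ θ) (i : Fin 3) :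
    pd (fun y => s y ^ θ) i x = θ * s x ^ (θ - 1) * pd s i x := by
  unfold pd
  rw [(hs.hasFDerivAt.rpow_const (Or.inr hθ)).fderiv]
  simp

lemma comm_eps {u : E3 → ℝ} {du : Fin 3 → E3 → ℝ} {un : ℕ → E3 → ℝ} (H : Sob u du un)
    {a σ : E3 → ℝ} (ac : Continuous a) (acs : HasCompactSupport a) (σm : Measurable σ)
    (σ2 : nr 2 σ ≠ ⊤) (σ3 : nr 3 σ ≠ ⊤) (i : Fin 3) (ε : ℝ) :
    (∫ x, a x * (ε⁻¹ * cv (pd eta i) σ ε x) * u x =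
      ε⁻¹ * (∫ x, a x * cv (pd eta i) (fun y => σ y * u y) ε x) +
      ∫ z, pd eta i z * (ε⁻¹ * ∫ x, (a x * σ (x - ε • z)) * (u x - u (x - ε • z)))) ∧
    AEStronglyMeasurable (fun z => pd eta i z *
      (ε⁻¹ * ∫ x, (a x * σ (x - ε • z)) * (u x - u (x - ε • z)))) volume ∧
    Integrable (fun x => a x * cv (pd eta i) (fun y => σ y * u y) ε x) volume := by
  have um := H.c6.m
  have hK := continuous_pd eta_smooth.one i
  have hKc := hcs_pd eta_hcs i
  have au2 : nr 2 (fun x => a x * u x) ≠ ⊤ :=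
    ne_top_of_le_ne_top (ENNReal.mul_ne_top (cts_fin ac acs 3) H.c6.fin)
      (nr_mul (by norm_num) (by norm_num) (by norm_num) (by norm_num) ac.measurable um)
  have su2 : nr 2 (fun x => σ x * u x) ≠ ⊤ :=
    ne_top_of_le_ne_top (ENNReal.mul_ne_top σ3 H.c6.fin)
      (nr_mul (by norm_num) (by norm_num) (by norm_num) (by norm_num) σm um)
  have i1 : Integrable (Function.uncurry fun (x z : E3) => pd eta i z * σ (x - ε • z) * (a x * u x))
      (volume.prod volume) := fub hK hKc σm (ac.measurable.mul um) σ2 au2 ε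
  have i2 : Integrable (Function.uncurry fun (x z : E3) => pd eta i z * (σ (x - ε • z) * u (x - ε • z)) * a x)
      (volume.prod volume) := fub hK hKc (σm.mul um) ac.measurable su2 (cts_fin ac acs 2) ε
  have e1 : ∫ x, a x * (ε⁻¹ * cv (pd eta i) σ ε x) * u x =
      ε⁻¹ * ∫ x, ∫ z, pd eta i z * σ (x - ε • z) * (a x * u x) := by
    rw [← integral_const_mul]
    congr 1; funext x
    rw [integral_mul_const]
    unfold cv
    ring
  have e2 : ∀ x, a x * cv (pd eta i) (fun y => σ y * u y) ε x =
      ∫ z, pd eta i z * (σ (x - ε • z) * u (x - ε • z)) * a x := fun x => by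
    rw [integral_mul_const]
    unfold cv
    ring
  have i12 := (i1.sub i2)
  have e3 : ∀ z, ∫ x, (pd eta i z * σ (x - ε • z) * (a x * u x) -
      pd eta i z * (σ (x - ε • z) * u (x - ε • z)) * a x) = 
      pd eta i z * ∫ x, (a x * σ (x - ε • z)) * (u x - u (x - ε • z)) := fun z => by
    rw [← integral_const_mul]
    congr 1; funext x; ring
  refine ⟨?_, ?_, ?_⟩
  · rw [e1]
    simp only [e2, mul_left_comm _ ε⁻¹]
    rw [integral_const_mul, ← mul_add]
    congr 1
    simp only [← e3]
    rw [← sub_eq_iff_eq_add']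
    refine (integral_sub i1.integral_prod_left i2.integral_prod_left).symm.trans ?_
    have := integral_integral_swap (f := fun x z => pd eta i z * σ (x - ε • z) * (a x * u x) -
      pd eta i z * (σ (x - ε • z) * u (x - ε • z)) * a x) i12
    rw [← this]
    refine integral_congr_ae ?_
    filter_upwards [i1.prod_right_ae, i2.prod_right_ae] with x h1 h2
    exact (integral_sub h1 h2).symm
  · have := i12.integral_prod_right.aestronglyMeasurable.const_mul ε⁻¹
    refine this.congr (ae_of_all _ fun z => ?_)
    have := e3 z
    simp only [Pi.sub_apply, Function.uncurry]
    rw [this]; ring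
  · simp only [e2]
    exact i2.integral_prod_left

lemma Sob.int {u : E3 → ℝ} {du : Fin 3 → E3 → ℝ} {un : ℕ → E3 → ℝ} (H : Sob u du un)
    {φ : E3 → ℝ} (hc : Continuous φ) (hcs : HasCompactSupport φ) : Integrable (fun x => φ x * u x) volume :=
  nr1_integrable (hc.measurable.mul H.c6.m)
    (ne_top_of_le_ne_top (ENNReal.mul_ne_top (cts_fin hc hcs (6/5)) H.c6.fin)
      (nr_mul (by norm_num) (by norm_num) (by norm_num) (by norm_num) hc.measurable H.c6.m))

section
variable {γ : ℝ} {ρ : E3 → ℝ} {u : Fin 3 → E3 → ℝ} {du : Fin 3 → Fin 3 → E3 → ℝ}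
  {un : Fin 3 → ℕ → E3 → ℝ} {χ : E3 → ℝ} {r : ℝ}

lemma renorm_eps (hγ : 3 ≤ γ) (ρm : Measurable ρ) (ρ0 : ∀ x, 0 ≤ ρ x)
    (H : ∀ i, Sob (u i) (du i) (un i))
    (mass : ∀ φ, Sm φ → HasCompactSupport φ → ∑ i, ∫ x, ρ x * u i x * pd φ i x = 0)
    (σf : nr (2 * γ) (ind r ρ) ≠ ⊤) (χs : Sm χ) (χc : HasCompactSupport χ)
    (hχ : ∀ x, r - 2 < ‖x‖ → χ x = 0) {ε : ℝ} (hε : 0 < ε) (hε1 : ε ≤ 1) :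
    (∑ i, ∫ x, avg (ind r ρ) ε x ^ γ * (pd χ i x * u i x)) + γ * (∑ i, ∫ z, pd eta i z *
      (ε⁻¹ * ∫ x, ((χ x * avg (ind r ρ) ε x ^ (γ - 1)) * ind r ρ (x - ε • z)) * (u i x - u i (x - ε • z)))) =
    - ∑ i, ∫ x, avg (ind r ρ) ε x ^ γ * (χ x * du i i x) := by
  set σ := ind r ρ with hσ
  have σm : Measurable σ := ind_meas ρm r
  have σ1 : nr 1 σ ≠ ⊤ := nr_ind_finite_of_le ρm (by linarith) σf
  have σ2 : nr 2 σ ≠ ⊤ := nr_ind_finite_of_le ρm (by linarith) σf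
  have σ3 : nr 3 σ ≠ ⊤ := nr_ind_finite_of_le ρm (by linarith) σf
  have σ0 : ∀ x, 0 ≤ σ x := fun x => indicator_nonneg (fun x _ => ρ0 x) x
  have σl : LocallyIntegrable σ volume := (nr1_integrable σm σ1).locallyIntegrable
  set s := avg σ ε with hs
  have ss : Sm s := avg_smooth σl hε
  have s0 : ∀ x, 0 ≤ s x := avg_nonneg σ0 ε
  have sd := ss.one.differentiable one_ne_zero
  have χd := χs.one.differentiable one_ne_zero
  have sγ : ContDiff ℝ 1 fun x => s x ^ γ := ss.one.rpow_const_of_le (by push_cast; linarith)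
  have sγ' : Continuous fun x => s x ^ (γ - 1) := ss.continuous.rpow_const fun x => Or.inr (by linarith)
  have ac : Continuous fun x => χ x * s x ^ (γ - 1) := χs.continuous.mul sγ'
  have acs : HasCompactSupport fun x => χ x * s x ^ (γ - 1) := hcs_mul_left χc
  have pds : ∀ i x, pd s i x = ε⁻¹ * cv (pd eta i) σ ε x := fun i x =>
    pd_cv eta_smooth eta_hcs σl hε i x
  have A : ∀ i, (∫ x, s x ^ γ * (pd χ i x * u i x)) + γ * (∫ x, (χ x * s x ^ (γ - 1)) *
      (ε⁻¹ * cv (pd eta i) σ ε x) * u i x) = - ∫ x, s x ^ γ * (χ x * du i i x) := fun i => by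
    have h1 := (H i).ibp (g := fun x => s x ^ γ * χ x) (sγ.mul χs.one) (hcs_mul_right χc) i
    have h2 : ∀ x, pd (fun x => s x ^ γ * χ x) i x * u i x = s x ^ γ * (pd χ i x * u i x) +
        γ * ((χ x * s x ^ (γ - 1)) * (ε⁻¹ * cv (pd eta i) σ ε x) * u i x) := fun x => by
      rw [pd_mul (sγ.differentiable one_ne_zero x) (χd x), pd_rpow (sd x) (by linarith), ← pds]
      ring
    simp only [h2] at h1
    rw [integral_add, integral_const_mul] at h1
    · rw [h1]; simp only [mul_assoc]
    · have := (H i).int (φ := fun x => s x ^ γ * pd χ i x) (sγ.continuous.mul (continuous_pd χs.one i))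
        (hcs_mul_right (hcs_pd χc i))
      simpa only [mul_assoc] using this
    · refine Integrable.const_mul ?_ γ
      simp only [← pds]
      exact (H i).int (φ := fun x => (χ x * s x ^ (γ - 1)) * pd s i x) (ac.mul (continuous_pd ss.one i))
        (hcs_mul_left acs)
  have B : ∑ i, ∫ x, (χ x * s x ^ (γ - 1)) * cv (pd eta i) (fun y => σ y * u i y) ε x = 0 := by
    rw [← integral_finsetSum _ fun i _ => (comm_eps (H i) ac acs σm σ2 σ3 i ε).2.2]
    rw [← integral_zero E3 ℝ]
    congr 1; funext x
    rw [← Finset.mul_sum]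
    by_cases hx : r - 2 < ‖x‖
    · rw [hχ x hx]; simp
    · rw [div_cv mass hε (by linarith), mul_zero]
  have C : ∀ i, _ := fun i => (comm_eps (H i) ac acs σm σ2 σ3 i ε).1
  simp only [C, mul_add] at A
  have D := Finset.sum_congr rfl fun i (_ : i ∈ Finset.univ) => A i
  rw [Finset.sum_add_distrib, Finset.sum_add_distrib, Finset.sum_neg_distrib, ← Finset.mul_sum,
    ← Finset.mul_sum, ← Finset.mul_sum, B] at D
  rw [← D]; ring


lemma int_pd_eta_coord (i k : Fin 3) : ∫ z, pd eta i z * z k = if k = i then -1 else 0 := by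
  have := ibp (coord_smooth k).one eta_smooth.one eta_hcs i
  simp only [pd_coord] at this
  simp only [mul_comm (pd eta i _)]
  rw [this]
  split_ifs
  · simp [integral_eta]
  · simp

lemma rpow_sub_one_mul {x γ : ℝ} (hx : 0 ≤ x) (hγ : 3 ≤ γ) : x ^ (γ - 1) * x = x ^ γ := by
  rcases hx.eq_or_lt with h | h
  · rw [← h, mul_zero, Real.zero_rpow (by linarith)]
  · rw [← Real.rpow_add_one h.ne']; congr 1; ring

lemma renorm (hγ : 3 ≤ γ) (ρm : Measurable ρ) (ρ0 : ∀ x, 0 ≤ ρ x)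
    (H : ∀ i, Sob (u i) (du i) (un i))
    (mass : ∀ φ, Sm φ → HasCompactSupport φ → ∑ i, ∫ x, ρ x * u i x * pd φ i x = 0)
    (σf : nr (2 * γ) (ind r ρ) ≠ ⊤) (χs : Sm χ) (χc : HasCompactSupport χ)
    (hχ : ∀ x, r - 2 < ‖x‖ → χ x = 0) :
    ∑ i, ∫ x, ind r ρ x ^ γ * (pd χ i x * u i x) =
      (γ - 1) * ∑ i, ∫ x, ind r ρ x ^ γ * (χ x * du i i x) := by
  set σ := ind r ρ with hσ
  have hγ0 : 0 < γ := by linarith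
  have σm : Measurable σ := ind_meas ρm r
  have σ1 : nr 1 σ ≠ ⊤ := nr_ind_finite_of_le ρm (by linarith) σf
  have σ2 : nr 2 σ ≠ ⊤ := nr_ind_finite_of_le ρm (by linarith) σf
  have σ0 : ∀ x, 0 ≤ σ x := fun x => indicator_nonneg (fun x _ => ρ0 x) x
  have σl : LocallyIntegrable σ volume := (nr1_integrable σm σ1).locallyIntegrable
  have ss : ∀ n, Sm (avg σ (eseq n)) := fun n => avg_smooth σl (eseq_pos n)
  have s0 : ∀ n x, 0 ≤ avg σ (eseq n) x := fun n => avg_nonneg σ0 _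
  have c0 : Cvg (2 * γ) (fun n => avg σ (eseq n)) σ :=
    ⟨fun n => (ss n).continuous.measurable, σm, σf, avg_tendsto σm σl (by linarith)
      ⟨σm.aestronglyMeasurable, σf.lt_top⟩ eseq_pos eseq_tendsto⟩
  have cγ : Cvg 2 (fun n x => avg σ (eseq n) x ^ γ) (fun x => σ x ^ γ) := by
    have := c0.rp (θ := γ) (by linarith) (by linarith) s0 σ0
    rwa [mul_div_assoc, div_self hγ0.ne', mul_one] at this
  obtain ⟨Cχ, hCχ⟩ := cts_bdd χs.continuous χc
  have cγ1 : Cvg (2 * γ / (γ - 1)) (fun n x => χ x * avg σ (eseq n) x ^ (γ - 1)) (fun x => χ x * σ x ^ (γ - 1)) :=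
    (c0.rp (θ := γ - 1) (by linarith) (by linarith) s0 σ0).bmul χs.continuous.measurable hCχ
  have ms : ∀ w : E3, Measurable fun x : E3 => x - w := fun w => by fun_prop
  have ctr : ∀ z : E3, Cvg (2 * γ) (fun n x => σ (x - eseq n • z)) σ := fun z => by
    refine ⟨fun n => σm.comp (ms _), σm, σf, ?_⟩
    have h1 := tendsto_translate (p := ENNReal.ofReal (2 * γ)) (ENNReal.one_le_ofReal.mpr (by linarith)) ENNReal.ofReal_ne_top
      (f := σ) ⟨σm.aestronglyMeasurable, σf.lt_top⟩
    have h2 : Tendsto (fun n => eseq n • z) atTop (𝓝 0) := by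
      have := eseq_tendsto.smul_const z
      rwa [zero_smul] at this
    exact h1.comp h2
  have hexp : (2 * γ / (γ - 1))⁻¹ + (2 * γ)⁻¹ = (2:ℝ)⁻¹ := by
    have : γ - 1 ≠ 0 := by linarith
    field_simp; ring
  have hexp1 : 1 ≤ 2 * γ / (γ - 1) := by rw [le_div_iff₀ (by linarith)]; linarith
  have cb : ∀ z : E3, Cvg 2 (fun n x => (χ x * avg σ (eseq n) x ^ (γ - 1)) * σ (x - eseq n • z))
      (fun x => σ x ^ γ * χ x) := fun z => by
    refine (cγ1.mul hexp1 (by linarith) (by norm_num) hexp (ctr z)).congr (fun _ _ => rfl) fun x => ?_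
    rw [← rpow_sub_one_mul (σ0 x) hγ]; ring
  have ac : ∀ n, Continuous fun x => χ x * avg σ (eseq n) x ^ (γ - 1) := fun n =>
    χs.continuous.mul ((ss n).continuous.rpow_const fun x => Or.inr (by linarith))
  have acs : ∀ n, HasCompactSupport fun x => χ x * avg σ (eseq n) x ^ (γ - 1) := fun n => hcs_mul_left χc
  have b1 : ∀ z n, nr 1 (fun x => (χ x * avg σ (eseq n) x ^ (γ - 1)) * σ (x - eseq n • z)) ≠ ⊤ := fun z n => by
    refine ne_top_of_le_ne_top (ENNReal.mul_ne_top (cts_fin (ac n) (acs n) 2) σ2)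
      ((nr_mul (a := 2) (b := 2) (by norm_num) (by norm_num) (by norm_num) (by norm_num) (ac n).measurable
        (σm.comp (ms _))).trans (le_of_eq ?_))
    congr 1; exact nr_translate (by norm_num) σ _
  have b65 : ∀ z n, nr (6/5) (fun x => (χ x * avg σ (eseq n) x ^ (γ - 1)) * σ (x - eseq n • z)) ≠ ⊤ := fun z n => by
    refine ne_top_of_le_ne_top (ENNReal.mul_ne_top (cts_fin (ac n) (acs n) 3) σ2)
      ((nr_mul (a := 3) (b := 2) (by norm_num) (by norm_num) (by norm_num) (by norm_num) (ac n).measurable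
        (σm.comp (ms _))).trans (le_of_eq ?_))
    congr 1; exact nr_translate (by norm_num) σ _
  -- uniform bound
  set B : ℝ≥0∞ := ENNReal.ofReal Cχ * nr (2 * γ) σ ^ (γ - 1) * nr (2 * γ) σ with hB
  have Bt : B ≠ ⊤ := ENNReal.mul_ne_top (ENNReal.mul_ne_top ENNReal.ofReal_ne_top
    (ENNReal.rpow_ne_top_of_nonneg (by linarith) σf)) σf
  have bB : ∀ z n, nr 2 (fun x => (χ x * avg σ (eseq n) x ^ (γ - 1)) * σ (x - eseq n • z)) ≤ B := fun z n => by
    refine (nr_mul (a := 2 * γ / (γ - 1)) (b := 2 * γ) (by linarith) (by linarith) (by norm_num) hexp (ac n).measurable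
        (σm.comp (ms _))).trans ?_
    refine mul_le_mul' ?_ (le_of_eq (nr_translate (by linarith) σ _))
    refine (nr_le_mul (c := Cχ) (g := fun x => avg σ (eseq n) x ^ (γ - 1)) fun x => ?_).trans ?_
    · rw [abs_mul]; exact mul_le_mul_of_nonneg_right (hCχ x) (abs_nonneg _)
    · refine mul_le_mul_right ?_ _
      rw [nr_rp (s0 n) (by linarith) (by linarith)]
      exact ENNReal.rpow_le_rpow (avg_eLpNorm_le σm _ (by linarith)) (by linarith)
  have b2 : ∀ z n, nr 2 (fun x => (χ x * avg σ (eseq n) x ^ (γ - 1)) * σ (x - eseq n • z)) ≠ ⊤ := fun z n =>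
    ne_top_of_le_ne_top Bt (bB z n)
  have L : ∀ i, Tendsto (fun n => ∫ z, pd eta i z * ((eseq n)⁻¹ *
      ∫ x, ((χ x * avg σ (eseq n) x ^ (γ - 1)) * σ (x - eseq n • z)) * (u i x - u i (x - eseq n • z)))) atTop
      (𝓝 (∫ z, pd eta i z * ∑ k, z k * ∫ x, (σ x ^ γ * χ x) * du i k x)) := fun i => by
    refine tendsto_integral_of_dominated_convergence
      (fun z => |pd eta i z| * (B.toReal * (3 * 2) * (3 * ∑ k, (nr 2 (du i k)).toReal))) (fun n => ?_) ?_ (fun n => ?_) ?_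
    · exact (comm_eps (H i) (ac n) (acs n) σm σ2 (nr_ind_finite_of_le ρm (by linarith) σf) i (eseq n)).2.1
    · exact (((continuous_pd eta_smooth.one i).integrable_of_hasCompactSupport (hcs_pd eta_hcs i)).abs).mul_const _
    · refine ae_of_all _ fun z => ?_
      rw [Real.norm_eq_abs, abs_mul]
      by_cases hz : pd eta i z = 0
      · rw [hz]; simp
      refine mul_le_mul_of_nonneg_left ?_ (abs_nonneg _)
      refine ((H i).diff_bdd ((cb z).mn n) (b1 z n) (b65 z n) (b2 z n) z (eseq_pos n)).trans ?_
      have hz2 := pd_eta_ne hz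
      have hs : ∑ k, |z k| ≤ 3 * 2 := by
        refine (Finset.sum_le_sum fun k _ => (abs_coord_le k z).trans hz2).trans (le_of_eq ?_)
        simp
      have hN : 0 ≤ ∑ k, (nr 2 (du i k)).toReal := Finset.sum_nonneg fun k _ => ENNReal.toReal_nonneg
      have hb := ENNReal.toReal_mono Bt (bB z n)
      have hs0 : 0 ≤ ∑ k, |z k| := Finset.sum_nonneg fun k _ => abs_nonneg _
      gcongr
    · exact ae_of_all _ fun z => ((H i).diff_lim (cb z) (b1 z) (b65 z) (b2 z) z eseq_pos eseq_tendsto).const_mul _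
  have E : ∀ i, ∫ z, pd eta i z * ∑ k, z k * ∫ x, (σ x ^ γ * χ x) * du i k x =
      - ∫ x, σ x ^ γ * (χ x * du i i x) := fun i => by
    simp only [Finset.mul_sum, ← mul_assoc]
    rw [integral_finsetSum]
    · simp only [integral_mul_const, int_pd_eta_coord]
      simp
    · intro k _
      refine Integrable.mul_const ?_ _
      exact ((continuous_pd eta_smooth.one i).mul (coord_smooth k).continuous).integrable_of_hasCompactSupport
        (hcs_mul_left (hcs_pd eta_hcs i))
  have l1 : Tendsto (fun n => ∑ i, ∫ x, avg σ (eseq n) x ^ γ * (pd χ i x * u i x)) atTop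
      (𝓝 (∑ i, ∫ x, σ x ^ γ * (pd χ i x * u i x))) := by
    refine tendsto_finsetSum _ fun i _ => ?_
    have pc := continuous_pd χs.one i
    refine Cvg.int2 (a := 2) (b := 2) (by norm_num) (by norm_num) (by norm_num) cγ
      (Cvg.const (pc.measurable.mul (H i).c6.m) ?_)
    exact ne_top_of_le_ne_top (ENNReal.mul_ne_top (cts_fin pc (hcs_pd χc i) 3) (H i).c6.fin)
      (nr_mul (by norm_num) (by norm_num) (by norm_num) (by norm_num) pc.measurable (H i).c6.m)
  have l2 : Tendsto (fun n => ∑ i, ∫ x, avg σ (eseq n) x ^ γ * (χ x * du i i x)) atTop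
      (𝓝 (∑ i, ∫ x, σ x ^ γ * (χ x * du i i x))) := by
    refine tendsto_finsetSum _ fun i _ => ?_
    exact Cvg.int2 (a := 2) (b := 2) (by norm_num) (by norm_num) (by norm_num) cγ
      ((Cvg.const ((H i).c2 i).m ((H i).c2 i).fin).bmul χs.continuous.measurable hCχ)
  have l3 := l1.add ((tendsto_finsetSum Finset.univ fun i _ => L i).const_mul γ)
  have l4 := tendsto_nhds_unique l3 (l2.neg.congr fun n =>
    (renorm_eps hγ ρm ρ0 H mass σf χs χc hχ (eseq_pos n) (eseq_le n)).symm)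
  simp only [E, Finset.sum_neg_distrib] at l4
  linarith

end

end

noncomputable section
open MeasureTheory Metric Filter Topology Set
open scoped ENNReal NNReal

/-! ### The energy identity -/

lemma pair_lim {a b : ℝ} (ha : 1 ≤ a) (hb : 1 ≤ b) (hab : a⁻¹ + b⁻¹ = 1) {f : E3 → ℝ}
    (fm : Measurable f) (hf : ∀ r, nr a (ind r f) ≠ ⊤) {φ : E3 → ℝ} (φc : Continuous φ)
    (φh : HasCompactSupport φ) {gn : ℕ → E3 → ℝ} {g : E3 → ℝ} (hg : Cvg b gn g) :
    Tendsto (fun n => ∫ x, f x * (φ x * gn n x)) atTop (𝓝 (∫ x, f x * (φ x * g x))) := by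
  have h1 : Cvg a (fun _ => fun x => φ x * f x) (fun x => φ x * f x) :=
    Cvg.const (φc.measurable.mul fm) (loc_fin hf φc φh)
  have h2 := h1.int2 ha hb hab hg
  have e : ∀ k : E3 → ℝ, ∫ x, φ x * f x * k x = ∫ x, f x * (φ x * k x) := fun k => by
    congr 1; funext x; ring
  simpa only [e] using h2

lemma pair_int {a b : ℝ} (ha : 1 ≤ a) (hb : 1 ≤ b) (hab : a⁻¹ + b⁻¹ = 1) {f : E3 → ℝ}
    (fm : Measurable f) (hf : ∀ r, nr a (ind r f) ≠ ⊤) {φ : E3 → ℝ} (φc : Continuous φ)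
    (φh : HasCompactSupport φ) {g : E3 → ℝ} (gm : Measurable g) (hg : nr b g ≠ ⊤) :
    Integrable (fun x => f x * (φ x * g x)) volume := by
  have := nr1_integrable ((φc.measurable.mul fm).mul gm) (ne_top_of_le_ne_top
    (ENNReal.mul_ne_top (loc_fin hf φc φh) hg) (nr_mul (by linarith) (by linarith) one_pos
      (by rw [hab, inv_one]) (φc.measurable.mul fm) gm))
  refine this.congr (ae_of_all _ fun x => ?_)
  simp only [Pi.mul_apply]; ring

structure NSFlow (γ : ℝ) (ρ : E3 → ℝ) (u : Fin 3 → E3 → ℝ) (S : Fin 3 → Fin 3 → E3 → ℝ)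
    (dG : Fin 3 → E3 → ℝ) (du : Fin 3 → Fin 3 → E3 → ℝ) (un : Fin 3 → ℕ → E3 → ℝ)
    (Gn : ℕ → E3 → ℝ) : Prop where
  core : Core γ ρ u S dG
  sob : ∀ i, Sob (u i) (du i) (un i)
  mass : ∀ φ, Sm φ → HasCompactSupport φ → ∑ i, ∫ x, ρ x * u i x * pd φ i x = 0
  Gsm : ∀ n, Sm (Gn n)
  Ghc : ∀ n, HasCompactSupport (Gn n)
  Gc : ∀ i, Cvg (qG γ) (fun n => pd (Gn n) i) (dG i)

namespace NSFlow

variable {γ : ℝ} {ρ : E3 → ℝ} {u : Fin 3 → E3 → ℝ} {S : Fin 3 → Fin 3 → E3 → ℝ}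
    {dG : Fin 3 → E3 → ℝ} {du : Fin 3 → Fin 3 → E3 → ℝ} {un : Fin 3 → ℕ → E3 → ℝ}
    {Gn : ℕ → E3 → ℝ} {χ : E3 → ℝ}

lemma pd_prod {f g : E3 → ℝ} (hf : Sm f) (hg : Sm g) (i : Fin 3) (x : E3) :
    pd (fun y => f y * g y) i x = pd f i x * g x + f x * pd g i x :=
  pd_mul (hf.one.differentiable one_ne_zero x) (hg.one.differentiable one_ne_zero x) i

lemma F2 (H : NSFlow γ ρ u S dG du un Gn) (i j : Fin 3) (r : ℝ) :
    nr 2 (ind r (fun x => S i j x - ρ x * u i x * u j x)) ≠ ⊤ := by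
  have h := ENNReal.add_ne_top.mpr ⟨ne_top_of_le_ne_top (H.core.S2 i j) (nr_ind_mono r _ _),
    H.core.T2_fin i j r⟩
  rw [← nr_neg (q := 2) (ind r (fun x => ρ x * u i x * u j x))] at h
  refine ne_top_of_le_ne_top h (le_trans (le_of_eq ?_) (nr_add (by norm_num)
    (ind_meas (H.core.Sm' i j) r) (ind_meas (H.core.Tm i j) r).neg))
  congr 1; funext x
  by_cases hx : ‖x‖ ≤ r
  · simp only [ind_of_le hx]; ring
  · simp only [ind_of_lt (not_le.mp hx)]; ring

lemma u6 (H : NSFlow γ ρ u S dG du un Gn) (i : Fin 3) : nr 6 (u i) ≠ ⊤ := H.core.u6 i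

lemma ρ2γ (H : NSFlow γ ρ u S dG du un Gn) (r : ℝ) : nr (2 * γ) (ind r ρ) ≠ ⊤ := by
  have h := H.core.p2_fin r
  have hγ := H.core.γpos
  have e := nr_rp (f := ind r ρ) (fun x => indicator_nonneg (fun x _ => H.core.ρ0 x) x)
    (q := 2 * γ) (θ := γ) (by linarith) hγ
  rw [mul_div_assoc, div_self hγ.ne', mul_one] at e
  have e2 : (fun x => ind r ρ x ^ γ) = ind r (fun x => ρ x ^ γ) := by
    funext x
    by_cases hx : ‖x‖ ≤ r
    · simp only [ind_of_le hx]
    · simp only [ind_of_lt (not_le.mp hx)]; exact Real.zero_rpow hγ.ne'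
  rw [e2] at e
  intro ht
  rw [ht, ENNReal.top_rpow_of_pos hγ] at e
  exact h e

lemma ρu_fin (H : NSFlow γ ρ u S dG du un Gn) (i : Fin 3) {a c : ℝ} (hc : 0 < c) (ha : 0 < a) (ha2 : a ≤ 2 * γ)
    (hac : a⁻¹ + (6:ℝ)⁻¹ = c⁻¹) (r : ℝ) :
    nr c (ind r (fun x => ρ x * u i x)) ≠ ⊤ := by
  have e : ind r (fun x => ρ x * u i x) = fun x => ind r ρ x * u i x := by
    funext x
    by_cases hx : ‖x‖ ≤ r
    · simp only [ind_of_le hx]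
    · simp only [ind_of_lt (not_le.mp hx)]; ring
  rw [e]
  exact ne_top_of_le_ne_top (ENNReal.mul_ne_top
    (nr_ind_finite_of_le H.core.ρm ha2 (H.ρ2γ r)) (H.u6 i))
    (nr_mul ha (by norm_num) hc hac (ind_meas H.core.ρm r) (H.core.um i))

lemma ρum (H : NSFlow γ ρ u S dG du un Gn) (i : Fin 3) : Measurable (fun x => ρ x * u i x) :=
  H.core.ρm.mul (H.core.um i)

/-- momentum equation tested with `χ u` -/
lemma E1 (H : NSFlow γ ρ u S dG du un Gn) (χs : Sm χ) (χc : HasCompactSupport χ) :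
    ∑ i, ((∫ x, ρ x ^ γ * (pd χ i x * u i x)) + ∫ x, ρ x ^ γ * (χ x * du i i x)) =
      (∑ i, ∑ j, ((∫ x, (S i j x - ρ x * u i x * u j x) * (pd χ j x * u i x)) +
        ∫ x, (S i j x - ρ x * u i x * u j x) * (χ x * du i j x))) -
      ∑ i, ∫ x, ρ x * dG i x * (χ x * u i x) := by
  have K : ∀ (f : E3 → ℝ), Measurable f → (∀ r, nr 2 (ind r f) ≠ ⊤) → ∀ i j : Fin 3,
      Tendsto (fun n => ∫ x, f x * pd (fun y => χ y * un i n y) j x) atTop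
        (𝓝 ((∫ x, f x * (pd χ j x * u i x)) + ∫ x, f x * (χ x * du i j x))) := by
    intro f fm hf i j
    have f65 : ∀ r, nr (6/5) (ind r f) ≠ ⊤ := fun r => nr_ind_finite_of_le fm (by norm_num) (hf r)
    have c1 := continuous_pd χs.one j
    have h1 := hcs_pd χc j
    have l1 := pair_lim (by norm_num) (by norm_num) (by norm_num) fm f65 c1 h1 (H.sob i).c6
    have l2 := pair_lim (by norm_num) (by norm_num) (by norm_num) fm hf χs.continuous χc ((H.sob i).c2 j)
    refine (l1.add l2).congr fun n => ?_
    rw [← integral_add]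
    · congr 1; funext x; rw [pd_prod χs ((H.sob i).sm n)]; ring
    · exact pair_int (by norm_num) (by norm_num) (by norm_num) fm f65 c1 h1 ((H.sob i).c6.mn n)
        (cts_fin ((H.sob i).sm n).continuous ((H.sob i).hcs n) 6)
    · exact pair_int (by norm_num) (by norm_num) (by norm_num) fm hf χs.continuous χc (((H.sob i).c2 j).mn n)
        (cts_fin (continuous_pd ((H.sob i).sm n).one j) (hcs_pd ((H.sob i).hcs n) j) 2)
  have W : ∀ n, _ := fun n => H.core.weq (fun i x => χ x * un i n x) (fun i => χs.mul ((H.sob i).sm n))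
    (fun i => hcs_mul_left χc)
  have L1 : Tendsto (fun n => ∑ i, ∫ x, ρ x ^ γ * pd (fun y => χ y * un i n y) i x) atTop
      (𝓝 (∑ i, ((∫ x, ρ x ^ γ * (pd χ i x * u i x)) + ∫ x, ρ x ^ γ * (χ x * du i i x)))) :=
    tendsto_finsetSum _ fun i _ => K _ H.core.pm H.core.p2_fin i i
  have L2 := tendsto_finsetSum (Finset.univ : Finset (Fin 3)) fun i _ =>
    tendsto_finsetSum (Finset.univ : Finset (Fin 3)) fun j _ => K _ (H.core.Fm i j) (H.F2 i j) i j
  have L3 := tendsto_finsetSum (Finset.univ : Finset (Fin 3)) fun i _ =>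
    pair_lim (by norm_num) (by norm_num) (by norm_num) (H.core.hm i) (H.core.h65 i) χs.continuous χc
      (H.sob i).c6
  exact tendsto_nhds_unique L1 ((L2.sub L3).congr fun n => (W n).symm)

/-- continuity equation tested with `χ u_i²` -/
lemma E2 (H : NSFlow γ ρ u S dG du un Gn) (χs : Sm χ) (χc : HasCompactSupport χ) (i : Fin 3) :
    ∑ j, ((∫ x, ρ x * u j x * (pd χ j x * (u i x * u i x))) +
      2 * ∫ x, ρ x * u j x * (χ x * (u i x * du i j x))) = 0 := by
  have hγ := H.core.hγ
  have f3 : ∀ j r, nr 3 (ind r (fun x => ρ x * u j x)) ≠ ⊤ := fun j r =>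
    H.ρu_fin j (a := 6) (by norm_num) (by norm_num) (by linarith) (by norm_num) r
  have f32 : ∀ j r, nr (3/2) (ind r (fun x => ρ x * u j x)) ≠ ⊤ := fun j r =>
    nr_ind_finite_of_le (H.ρum j) (by norm_num) (f3 j r)
  have C1 : Cvg 3 (fun n x => un i n x * un i n x) (fun x => u i x * u i x) :=
    (H.sob i).c6.mul (by norm_num) (by norm_num) (by norm_num) (by norm_num) (H.sob i).c6
  have C2 : ∀ j, Cvg (3/2) (fun n x => un i n x * pd (un i n) j x) (fun x => u i x * du i j x) := fun j =>
    (H.sob i).c6.mul (by norm_num) (by norm_num) (by norm_num) (by norm_num) ((H.sob i).c2 j)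
  have L : Tendsto (fun n => ∑ j, ∫ x, ρ x * u j x * pd (fun y => χ y * (un i n y * un i n y)) j x) atTop
      (𝓝 (∑ j, ((∫ x, ρ x * u j x * (pd χ j x * (u i x * u i x))) +
      2 * ∫ x, ρ x * u j x * (χ x * (u i x * du i j x))))) := by
    refine tendsto_finsetSum _ fun j _ => ?_
    have c1 := continuous_pd χs.one j
    have h1 := hcs_pd χc j
    have l1 := pair_lim (by norm_num) (by norm_num) (by norm_num) (H.ρum j) (f32 j) c1 h1 C1
    have l2 := pair_lim (by norm_num) (by norm_num) (by norm_num) (H.ρum j) (f3 j) χs.continuous χc (C2 j)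
    refine (l1.add (l2.const_mul 2)).congr fun n => ?_
    rw [← integral_const_mul, ← integral_add]
    · congr 1; funext x
      rw [pd_prod χs (((H.sob i).sm n).mul ((H.sob i).sm n)), pd_prod ((H.sob i).sm n) ((H.sob i).sm n)]; ring
    · exact pair_int (by norm_num) (by norm_num) (by norm_num) (H.ρum j) (f32 j) c1 h1 (C1.mn n)
        (cts_fin (((H.sob i).sm n).mul ((H.sob i).sm n)).continuous (hcs_mul_left ((H.sob i).hcs n)) 3)
    · exact (pair_int (by norm_num) (by norm_num) (by norm_num) (H.ρum j) (f3 j) χs.continuous χc ((C2 j).mn n)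
        (cts_fin (((H.sob i).sm n).continuous.mul (continuous_pd ((H.sob i).sm n).one j))
          (hcs_mul_left ((H.sob i).hcs n)) (3/2))).const_mul 2
  have Z : ∀ n, ∑ j, ∫ x, ρ x * u j x * pd (fun y => χ y * (un i n y * un i n y)) j x = 0 := fun n =>
    H.mass _ (χs.mul (((H.sob i).sm n).mul ((H.sob i).sm n))) (hcs_mul_left χc)
  simp only [Z] at L
  exact tendsto_nhds_unique L tendsto_const_nhds

/-- continuity equation tested with `χ G_n` -/
lemma E4 (H : NSFlow γ ρ u S dG du un Gn) (χs : Sm χ) (χc : HasCompactSupport χ) :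
    Tendsto (fun n => - ∑ j, ∫ x, ρ x * u j x * (pd χ j x * Gn n x)) atTop
      (𝓝 (∑ j, ∫ x, ρ x * u j x * (χ x * dG j x))) := by
  have hγ := H.core.hγ
  set q' : ℝ := 6 * γ / (γ + 6) with hq'
  have hq1 : 1 ≤ q' := by rw [hq', le_div_iff₀ (by linarith)]; linarith
  have hqG : 1 ≤ qG γ := by unfold qG; rw [le_div_iff₀ (by linarith)]; linarith
  have hqq : q'⁻¹ + (qG γ)⁻¹ = 1 := by
    rw [hq']; unfold qG
    have h1 : γ + 6 ≠ 0 := by linarith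
    have h2 : 5 * γ - 6 ≠ 0 := by linarith
    field_simp; ring
  have f : ∀ j r, nr q' (ind r (fun x => ρ x * u j x)) ≠ ⊤ := fun j r =>
    H.ρu_fin j (a := γ) (by linarith) (by linarith) (by linarith) (by
      rw [hq']; have h1 : γ + 6 ≠ 0 := by linarith
      field_simp; ring) r
  have f1 : ∀ j r, nr 1 (ind r (fun x => ρ x * u j x)) ≠ ⊤ := fun j r =>
    nr_ind_finite_of_le (H.ρum j) hq1 (f j r)
  refine (tendsto_finsetSum (Finset.univ : Finset (Fin 3)) fun j _ =>
    pair_lim hq1 hqG hqq (H.ρum j) (f j) χs.continuous χc (H.Gc j)).congr fun n => ?_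
  have Z := H.mass (fun y => χ y * Gn n y) (χs.mul (H.Gsm n)) (hcs_mul_left χc)
  rw [eq_neg_iff_add_eq_zero, ← Finset.sum_add_distrib, ← Z]
  refine Finset.sum_congr rfl fun j _ => ?_
  rw [← integral_add]
  · congr 1; funext x; rw [pd_prod χs (H.Gsm n)]; ring
  · exact pair_int hq1 hqG hqq (H.ρum j) (f j) χs.continuous χc ((H.Gc j).mn n)
      (cts_fin (continuous_pd (H.Gsm n).one j) (hcs_pd (H.Ghc n) j) _)
  · exact li_mul (li_of_ind (f1 j) (H.ρum j)) ((continuous_pd χs.one j).mul (H.Gsm n).continuous)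
      (hcs_mul_left (hcs_pd χc j))

lemma E3' (H : NSFlow γ ρ u S dG du un Gn) (χs : Sm χ) (χc : HasCompactSupport χ) :
    ∑ i, ∫ x, ρ x ^ γ * (pd χ i x * u i x) = (γ - 1) * ∑ i, ∫ x, ρ x ^ γ * (χ x * du i i x) := by
  obtain ⟨r, hr⟩ := χc.isCompact.isBounded.subset_closedBall (0 : E3)
  have z : ∀ x : E3, r < ‖x‖ → x ∉ tsupport χ := fun x hx hxs => by
    have := hr hxs; simp at this; linarith
  have h := renorm H.core.hγ H.core.ρm H.core.ρ0 H.sob H.mass (H.ρ2γ (r + 2)) χs χc (fun x hx =>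
    image_eq_zero_of_notMem_tsupport (z x (by linarith)))
  have e : ∀ (φ v : E3 → ℝ), (∀ x, r < ‖x‖ → φ x = 0) →
      ∫ x, ind (r + 2) ρ x ^ γ * (φ x * v x) = ∫ x, ρ x ^ γ * (φ x * v x) := fun φ v hφ => by
    congr 1; funext x
    by_cases hx : ‖x‖ ≤ r + 2
    · rw [ind_of_le hx]
    · rw [hφ x (by linarith [not_le.mp hx])]; ring
  have z1 : ∀ i x, r < ‖x‖ → pd χ i x = 0 := fun i x hx => by
    have := z x hx
    unfold pd
    rw [fderiv_of_notMem_tsupport ℝ this]; rfl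
  rw [Finset.sum_congr rfl fun i _ => e (pd χ i) (u i) (z1 i),
    Finset.sum_congr rfl fun i _ => e χ (du i i) (fun x hx => image_eq_zero_of_notMem_tsupport (z x hx))] at h
  exact h

/-- the energy identity -/
lemma energy (H : NSFlow γ ρ u S dG du un Gn) (χs : Sm χ) (χc : HasCompactSupport χ) :
    ∑ i, ∑ j, ∫ x, S i j x * (χ x * du i j x) =
      γ / (γ - 1) * (∑ i, ∫ x, ρ x ^ γ * (pd χ i x * u i x))
      - (∑ i, ∑ j, ∫ x, S i j x * (pd χ j x * u i x))
      + (1/2) * (∑ i, ∑ j, ∫ x, ρ x * u j x * (pd χ j x * (u i x * u i x)))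
      + ∑ j, ∫ x, ρ x * u j x * (χ x * dG j x) := by
  have hγ := H.core.hγ
  have e1 := H.E1 χs χc
  have e3 := H.E3' χs χc
  have S65 : ∀ i j r, nr (6/5) (ind r (S i j)) ≠ ⊤ := fun i j r => nr_ind_finite_of_le (H.core.Sm' i j)
    (by norm_num) (ne_top_of_le_ne_top (H.core.S2 i j) (nr_ind_mono r _ _))
  have S2 : ∀ i j r, nr 2 (ind r (S i j)) ≠ ⊤ := fun i j r =>
    ne_top_of_le_ne_top (H.core.S2 i j) (nr_ind_mono r _ _)
  have T65 : ∀ i j r, nr (6/5) (ind r (fun x => ρ x * u i x * u j x)) ≠ ⊤ := fun i j r =>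
    nr_ind_finite_of_le (H.core.Tm i j) (by norm_num) (H.core.T2_fin i j r)
  have s1 : ∀ i j, ∫ x, (S i j x - ρ x * u i x * u j x) * (pd χ j x * u i x) =
      (∫ x, S i j x * (pd χ j x * u i x)) - ∫ x, ρ x * u j x * (pd χ j x * (u i x * u i x)) := fun i j => by
    have i2 := pair_int (by norm_num) (by norm_num) (by norm_num) (H.core.Tm i j) (T65 i j)
      (continuous_pd χs.one j) (hcs_pd χc j) (H.core.um i) (H.u6 i)
    have e : (fun x => ρ x * u j x * (pd χ j x * (u i x * u i x))) =
        fun x => ρ x * u i x * u j x * (pd χ j x * u i x) := by funext x; ring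
    rw [e, ← integral_sub _ i2]
    · congr 1; funext x; ring
    · exact pair_int (by norm_num) (by norm_num) (by norm_num) (H.core.Sm' i j) (S65 i j)
        (continuous_pd χs.one j) (hcs_pd χc j) (H.core.um i) (H.u6 i)
  have s2 : ∀ i j, ∫ x, (S i j x - ρ x * u i x * u j x) * (χ x * du i j x) =
      (∫ x, S i j x * (χ x * du i j x)) - ∫ x, ρ x * u j x * (χ x * (u i x * du i j x)) := fun i j => by
    have i2 := pair_int (by norm_num) (by norm_num) (by norm_num) (H.core.Tm i j) (H.core.T2_fin i j)
      χs.continuous χc ((H.sob i).c2 j).m ((H.sob i).c2 j).fin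
    have e : (fun x => ρ x * u j x * (χ x * (u i x * du i j x))) =
        fun x => ρ x * u i x * u j x * (χ x * du i j x) := by funext x; ring
    rw [e, ← integral_sub _ i2]
    · congr 1; funext x; ring
    · exact pair_int (by norm_num) (by norm_num) (by norm_num) (H.core.Sm' i j) (S2 i j)
        χs.continuous χc ((H.sob i).c2 j).m ((H.sob i).c2 j).fin
  have s3 : ∀ i, ∫ x, ρ x * dG i x * (χ x * u i x) = ∫ x, ρ x * u i x * (χ x * dG i x) := fun i => by
    congr 1; funext x; ring
  have e2 : ∑ i, ∑ j, ∫ x, ρ x * u j x * (χ x * (u i x * du i j x)) =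
      - (1/2) * ∑ i, ∑ j, ∫ x, ρ x * u j x * (pd χ j x * (u i x * u i x)) := by
    rw [Finset.mul_sum]
    refine Finset.sum_congr rfl fun i _ => ?_
    have := H.E2 χs χc i
    rw [Finset.sum_add_distrib, ← Finset.mul_sum] at this
    linarith
  simp only [s1, s2, s3, Finset.sum_add_distrib, Finset.sum_sub_distrib] at e1
  set a := ∑ i, ∫ x, ρ x ^ γ * (pd χ i x * u i x)
  set d := ∑ i, ∫ x, ρ x ^ γ * (χ x * du i i x)
  have ha : γ / (γ - 1) * a = a + d := by
    rw [e3]; have : γ - 1 ≠ 0 := by linarith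
    field_simp; ring
  rw [ha]
  linarith

end NSFlow

end

noncomputable section
open MeasureTheory Metric Filter Topology Set
open scoped ENNReal NNReal

/-! ### Estimates on annuli -/

def ann (R : ℝ) (f : E3 → ℝ) : E3 → ℝ := (Ann R).indicator f

lemma ann_of_mem {R : ℝ} {x : E3} (h : x ∈ Ann R) (f : E3 → ℝ) : ann R f x = f x := indicator_of_mem h f
lemma ann_of_notMem {R : ℝ} {x : E3} (h : x ∉ Ann R) (f : E3 → ℝ) : ann R f x = 0 := indicator_of_notMem h f
lemma ann_meas {f : E3 → ℝ} (hf : Measurable f) (R : ℝ) : Measurable (ann R f) :=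
  hf.indicator (measurableSet_Ann R)

lemma mem_Ann {R : ℝ} {x : E3} : x ∈ Ann R ↔ ‖x‖ < 2 * R ∧ R ≤ ‖x‖ := by
  unfold Ann; rw [Set.mem_sdiff]; simp

lemma nr_ann_le (R : ℝ) (f : E3 → ℝ) (q : ℝ) : nr q (ann R f) ≤ nr q f := nr_mono fun x => by
  by_cases h : x ∈ Ann R
  · rw [ann_of_mem h]
  · rw [ann_of_notMem h, abs_zero]; positivity

lemma nr_ann_le_ind (R : ℝ) (f : E3 → ℝ) (q : ℝ) : nr q (ann R f) ≤ nr q (ind (2 * R) f) := nr_mono fun x => by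
  by_cases h : x ∈ Ann R
  · rw [ann_of_mem h, ind_of_le (mem_Ann.mp h).1.le]
  · rw [ann_of_notMem h, abs_zero]; positivity

lemma nr_ann_le_out {R M : ℝ} (hM : M < R) (f : E3 → ℝ) (q : ℝ) : nr q (ann R f) ≤ nr q (out M f) :=
  nr_mono fun x => by
    by_cases h : x ∈ Ann R
    · rw [ann_of_mem h, out_of_lt (hM.trans_le (mem_Ann.mp h).2)]
    · rw [ann_of_notMem h, abs_zero]; positivity

lemma ann_small {f : E3 → ℝ} (hf : Measurable f) {s : ℝ} (h : nr s f ≠ ⊤) {δ : ℝ} (hδ : 0 < δ) :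
    ∃ R₀ : ℝ, ∀ R ≥ R₀, nr s (ann R f) ≤ ENNReal.ofReal δ := by
  obtain ⟨M, hM⟩ := tail_small hf h hδ
  exact ⟨M + 1, fun R hR => (nr_ann_le_out (by linarith) f s).trans (hM M le_rfl)⟩

lemma ann_bound {a b : ℝ} (hab : a.HolderConjugate b) {f g : E3 → ℝ} (hf : Measurable f)
    (hg : Measurable g) {R A B : ℝ} (hR : 0 < R) (hA : 0 ≤ A) (hB : 0 ≤ B)
    (h1 : nr a (ann R f) ≤ ENNReal.ofReal A) (h2 : nr b (ann R g) ≤ ENNReal.ofReal B) (j : Fin 3) :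
    |∫ x, f x * (pd (cut R) j x * g x)| ≤ Cθ / R * (A * B) := by
  have hC : 0 ≤ Cθ := by linarith [one_le_Cθ]
  have e : ∀ x, f x * (pd (cut R) j x * g x) = ann R f x * (pd (cut R) j x * ann R g x) := fun x => by
    by_cases h : x ∈ Ann R
    · rw [ann_of_mem h, ann_of_mem h]
    · rw [pd_cut_eq_zero hR h]; ring
  simp only [e]
  have gm : Measurable (fun x => pd (cut R) j x * ann R g x) :=
    (continuous_pd (cut_smooth R).one j).measurable.mul (ann_meas hg R)
  have hg2 : nr b (fun x => pd (cut R) j x * ann R g x) ≤ ENNReal.ofReal (Cθ / R * B) := by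
    rw [ENNReal.ofReal_mul (by positivity)]
    refine (nr_le_mul (g := ann R g) fun x => ?_).trans (mul_le_mul_right h2 _)
    rw [abs_mul]; exact mul_le_mul_of_nonneg_right (pd_cut_le hR j x) (abs_nonneg _)
  refine (holder2r hab (ann_meas hf R) gm (ne_top_of_le_ne_top ENNReal.ofReal_ne_top h1)
    (ne_top_of_le_ne_top ENNReal.ofReal_ne_top hg2)).trans ?_
  have t1 := ENNReal.toReal_le_of_le_ofReal hA h1
  have t2 := ENNReal.toReal_le_of_le_ofReal (by positivity) hg2
  calc _ ≤ A * (Cθ / R * B) := by gcongr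
    _ = _ := by ring

lemma interp {β s : ℝ} (hβ : 0 < β) (hβs : β ≤ s) (hs : s ≤ 6) (hβ6 : β < 6) {f : E3 → ℝ}
    (hf : Measurable f) : nr s f ≤ nr β f ^ (β * ((6 - s) / (6 - β)) / s) *
      nr 6 f ^ (6 * ((s - β) / (6 - β)) / s) := by
  have h6 : 0 < 6 - β := by linarith
  have hs0 : 0 < s := by linarith
  set a := (6 - s) / (6 - β) with ha
  set b := (s - β) / (6 - β) with hb
  have ha0 : 0 ≤ a := div_nonneg (by linarith) h6.le
  have hb0 : 0 ≤ b := div_nonneg (by linarith) h6.le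
  have hab : a + b = 1 := by rw [ha, hb]; field_simp; ring
  have hs' : s = β * a + 6 * b := by rw [ha, hb]; field_simp; ring
  have key := ENNReal.lintegral_mul_norm_pow_le (μ := (volume : Measure E3))
    (f := fun x => ‖f x‖ₑ ^ β) (g := fun x => ‖f x‖ₑ ^ (6:ℝ)) (hf.enorm.pow_const _).aemeasurable
    (hf.enorm.pow_const _).aemeasurable ha0 hb0 hab
  have e : ∀ x, (‖f x‖ₑ ^ β) ^ a * (‖f x‖ₑ ^ (6:ℝ)) ^ b = ‖f x‖ₑ ^ s := fun x => by
    rw [← ENNReal.rpow_mul, ← ENNReal.rpow_mul, ← ENNReal.rpow_add_of_nonneg _ _ (by positivity) (by positivity),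
      ← hs']
  simp only [e] at key
  rw [← nr_rpow hβ, ← nr_rpow (by norm_num : (0:ℝ) < 6), ← nr_rpow hs0, ← ENNReal.rpow_mul,
    ← ENNReal.rpow_mul] at key
  have k2 := ENNReal.rpow_le_rpow key (z := 1 / s) (by positivity)
  rw [ENNReal.mul_rpow_of_nonneg _ _ (by positivity), ← ENNReal.rpow_mul, ← ENNReal.rpow_mul,
    ← ENNReal.rpow_mul, mul_one_div_cancel hs0.ne', ENNReal.rpow_one] at k2
  rw [div_eq_mul_one_div (β * a), div_eq_mul_one_div (6 * b)]
  exact k2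

/-- interpolation for a function with L^β growth and global L⁶ bound -/
lemma interp_gr {β s : ℝ} (hβ : 0 < β) (hβs : β ≤ s) (hs : s ≤ 6) (hβ6 : β < 6) {f : E3 → ℝ}
    (hf : Measurable f) (h6 : nr 6 f ≠ ⊤) {K g e : ℝ} (hK : 0 ≤ K)
    (he : β * ((6 - s) / (6 - β)) / s * g ≤ e) :
    ∃ K' : ℝ, 0 ≤ K' ∧ ∀ R ≥ 1, nr β (ann R f) ≤ ENNReal.ofReal (K * R ^ g) →
      nr s (ann R f) ≤ ENNReal.ofReal (K' * R ^ e) := by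
  have hs0 : 0 < s := by linarith
  set θ := β * ((6 - s) / (6 - β)) / s with hθ
  set τ := 6 * ((s - β) / (6 - β)) / s with hτ
  have hθ0 : 0 ≤ θ := div_nonneg (mul_nonneg hβ.le (div_nonneg (by linarith) (by linarith))) hs0.le
  have hτ0 : 0 ≤ τ := div_nonneg (mul_nonneg (by norm_num) (div_nonneg (by linarith) (by linarith))) hs0.le
  refine ⟨K ^ θ * (nr 6 f).toReal ^ τ, by positivity, fun R hR h => ?_⟩
  have hR0 : 0 < R := by linarith
  refine (interp hβ hβs hs hβ6 (ann_meas hf R)).trans ?_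
  have h1 := ENNReal.rpow_le_rpow h hθ0
  rw [ENNReal.ofReal_rpow_of_nonneg (by positivity) hθ0, Real.mul_rpow hK (by positivity),
    ← Real.rpow_mul hR0.le] at h1
  have h2 := ENNReal.rpow_le_rpow (nr_ann_le R f 6) hτ0
  rw [← ENNReal.ofReal_toReal h6, ENNReal.ofReal_rpow_of_nonneg ENNReal.toReal_nonneg hτ0] at h2
  refine (mul_le_mul' h1 h2).trans ?_
  rw [← ENNReal.ofReal_mul (by positivity)]
  apply ENNReal.ofReal_le_ofReal
  have h3 : R ^ (g * θ) ≤ R ^ e := Rpow_le hR (by linarith)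
  have : 0 ≤ K ^ θ * (nr 6 f).toReal ^ τ := by positivity
  calc _ = (K ^ θ * (nr 6 f).toReal ^ τ) * R ^ (g * θ) := by ring
    _ ≤ _ := by gcongr

lemma nr2_of_bdd {f : E3 → ℝ} {C : ℝ≥0∞} (h : ∀ n : ℕ, nr 2 (ind n f) ≤ C) : nr 2 f ≤ C := by
  have e : nr 2 f ^ (2:ℝ) = ⨆ n : ℕ, nr 2 (ind n f) ^ (2:ℝ) := by
    rw [nr_rpow two_pos]
    have : (⋃ n : ℕ, closedBall (0 : E3) n) = univ := iUnion_closedBall_nat 0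
    rw [← setLIntegral_univ, ← this, setLIntegral_iUnion_of_directed]
    · congr 1; funext n
      rw [nr_rpow two_pos, ← lintegral_indicator measurableSet_closedBall]
      congr 1; funext x
      by_cases hx : ‖x‖ ≤ n
      · rw [ind_of_le hx, indicator_of_mem (by simpa using hx)]
      · rw [ind_of_lt (not_le.mp hx), indicator_of_notMem (by simpa using hx)]; simp
    · refine directed_of_isDirected_le fun m n hmn => closedBall_subset_closedBall (by exact_mod_cast hmn)
  have h2 : nr 2 f ^ (2:ℝ) ≤ C ^ (2:ℝ) := by
    rw [e]; exact iSup_le fun n => ENNReal.rpow_le_rpow (h n) (by norm_num)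
  exact (ENNReal.rpow_le_rpow_iff two_pos).mp h2

namespace NSFlow

variable {γ : ℝ} {ρ : E3 → ℝ} {u : Fin 3 → E3 → ℝ} {S : Fin 3 → Fin 3 → E3 → ℝ}
    {dG : Fin 3 → E3 → ℝ} {du : Fin 3 → Fin 3 → E3 → ℝ} {un : Fin 3 → ℕ → E3 → ℝ}
    {Gn : ℕ → E3 → ℝ} {α E K : ℝ}

lemma p_ann (H : NSFlow γ ρ u S dG du un Gn) (D : Core.Gr γ ρ α E K) {δ : ℝ} (hδ : 0 < δ) :
    ∃ R₀ : ℝ, ∀ R ≥ R₀, nr 2 (ann R (fun x => ρ x ^ γ)) ≤ ENNReal.ofReal (δ * R ^ E) := by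
  have hX := H.core.X_small D
  have hE : 0 ≤ E := D.α0.trans D.αE
  rcases hE.eq_or_lt with hE | hE
  · obtain ⟨C, hC, h⟩ := hX 1 one_pos
    have hp : nr 2 (fun x => ρ x ^ γ) ≠ ⊤ := by
      refine ne_top_of_le_ne_top (b := ENNReal.ofReal (1 + C)) ENNReal.ofReal_ne_top (nr2_of_bdd fun n => ?_)
      have hn : (0:ℝ) < n + 1 := by positivity
      have := h (n + 1) (by linarith [(Nat.cast_nonneg n : (0:ℝ) ≤ n)])
      rw [← hE, Real.rpow_zero, one_mul] at this
      refine le_trans (nr_mono fun x => ?_) this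
      by_cases hx : ‖x‖ ≤ n
      · rw [ind_of_le hx, cut_eq_one hn (by linarith)]; simp
      · rw [ind_of_lt (not_le.mp hx), abs_zero]; positivity
    obtain ⟨R₀, h0⟩ := ann_small H.core.pm hp hδ
    refine ⟨R₀, fun R hR => ?_⟩
    rw [← hE, Real.rpow_zero, mul_one]
    exact h0 R hR
  · obtain ⟨C, hC, h⟩ := hX (δ / 2 / 2 ^ E) (by positivity)
    have ev : ∀ᶠ R : ℝ in atTop, C / (δ / 2) ≤ R ^ E := (tendsto_rpow_atTop hE).eventually_ge_atTop _
    obtain ⟨R₀, h0⟩ := eventually_atTop.mp ev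
    refine ⟨max 1 R₀, fun R hR => ?_⟩
    have hR1 : 1 ≤ R := (le_max_left _ _).trans hR
    have hR2 := h0 R ((le_max_right _ _).trans hR)
    have h3 := h (2 * R) (by linarith)
    refine le_trans (nr_mono fun x => ?_) (h3.trans (ENNReal.ofReal_le_ofReal ?_))
    · by_cases hx : x ∈ Ann R
      · rw [ann_of_mem hx, cut_eq_one (by linarith) (mem_Ann.mp hx).1.le]; simp
      · rw [ann_of_notMem hx, abs_zero]; positivity
    · rw [Real.mul_rpow (by norm_num) (by linarith)]
      rw [div_le_iff₀ (by positivity)] at hR2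
      have : δ / 2 / 2 ^ E * (2 ^ E * R ^ E) = δ / 2 * R ^ E := by field_simp
      linarith

lemma ρ_ann (H : NSFlow γ ρ u S dG du un Gn) (D : Core.Gr γ ρ α E K) {δ : ℝ} (hδ : 0 < δ) :
    ∃ R₀ : ℝ, ∀ R ≥ R₀, nr (2 * γ) (ann R ρ) ≤ ENNReal.ofReal (δ * R ^ (E / γ)) := by
  have hγ := H.core.γpos
  obtain ⟨R₀, h⟩ := H.p_ann D (δ := δ ^ γ) (by positivity)
  refine ⟨max 1 R₀, fun R hR => ?_⟩
  have hR1 : 1 ≤ R := (le_max_left _ _).trans hR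
  have hR0 : 0 < R := by linarith
  have h2 := h R ((le_max_right _ _).trans hR)
  have e := nr_rp (f := ann R ρ) (fun x => indicator_nonneg (fun x _ => H.core.ρ0 x) x)
    (q := 2 * γ) (θ := γ) (by linarith) hγ
  rw [mul_div_assoc, div_self hγ.ne', mul_one] at e
  have e2 : (fun x => ann R ρ x ^ γ) = ann R (fun x => ρ x ^ γ) := by
    funext x
    by_cases hx : x ∈ Ann R
    · simp only [ann_of_mem hx]
    · simp only [ann_of_notMem hx]; exact Real.zero_rpow hγ.ne'
  rw [e2] at e
  rw [e] at h2
  refine (ENNReal.rpow_le_rpow_iff hγ).mp (h2.trans (le_of_eq ?_))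
  rw [ENNReal.ofReal_rpow_of_nonneg (by positivity) hγ.le, Real.mul_rpow hδ.le (by positivity),
    ← Real.rpow_mul hR0.le]
  congr 3; field_simp

/-- the Sobolev conjugate exponent for `G` -/
def qS (γ : ℝ) : ℝ := 2 * γ / (γ - 2)

lemma G_ann (H : NSFlow γ ρ u S dG du un Gn) {δ : ℝ} (hδ : 0 < δ) :
    ∃ (R₀ : ℝ) (N : ℕ), ∀ R ≥ R₀, ∀ n ≥ N, nr (qS γ) (ann R (Gn n)) ≤ ENNReal.ofReal δ := by
  have hγ := H.core.hγ
  have hqG : 1 ≤ qG γ := by unfold qG; rw [le_div_iff₀ (by linarith)]; linarith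
  have hqS : 1 ≤ qS γ := by unfold qS; rw [le_div_iff₀ (by linarith)]; linarith
  obtain ⟨C, hC⟩ := sobolev_q (q := (qG γ).toNNReal) (q' := (qS γ).toNNReal)
    (by rw [← NNReal.coe_le_coe, Real.coe_toNNReal _ (by linarith)]; simpa using hqG)
    (by
      rw [Real.coe_toNNReal _ (by linarith), Real.coe_toNNReal _ (by linarith)]
      unfold qS qG
      have h1 : γ - 2 ≠ 0 := by linarith
      have h2 : 5 * γ - 6 ≠ 0 := by linarith
      have h3 : γ ≠ 0 := by linarith
      field_simp; ring)
  have L : Tendsto (fun n => (C : ℝ≥0∞) * ∑ i, nr (qG γ) (fun x => pd (Gn n) i x - dG i x)) atTop (𝓝 0) := by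
    have := ENNReal.Tendsto.const_mul (a := (C : ℝ≥0∞)) (tendsto_finsetSum (Finset.univ : Finset (Fin 3))
      fun i _ => (H.Gc i).lim) (Or.inr ENNReal.coe_ne_top)
    simpa using this
  have hd2 : (0 : ℝ≥0∞) < ENNReal.ofReal (δ / 2) := by rw [ENNReal.ofReal_pos]; positivity
  obtain ⟨N, hN⟩ := eventually_atTop.mp (L.eventually_le_const hd2)
  have cau : ∀ n ≥ N, nr (qS γ) (fun x => Gn n x - Gn N x) ≤ ENNReal.ofReal δ := by
    intro n hn
    have h1 := hC (fun x => Gn n x - Gn N x) ((H.Gsm n).one.sub (H.Gsm N).one) ((H.Ghc n).sub (H.Ghc N))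
    have h2 : ∀ i, nr (qG γ) (pd (fun x => Gn n x - Gn N x) i) ≤
        nr (qG γ) (fun x => pd (Gn n) i x - dG i x) + nr (qG γ) (fun x => pd (Gn N) i x - dG i x) := fun i => by
      rw [← nr_neg (fun x => pd (Gn N) i x - dG i x)]
      refine le_trans (le_of_eq ?_) (nr_add hqG (((H.Gc i).mn n).sub (H.Gc i).m)
        (((H.Gc i).mn N).sub (H.Gc i).m).neg)
      congr 1; funext x
      rw [pd_sub ((H.Gsm n).one.differentiable one_ne_zero x) ((H.Gsm N).one.differentiable one_ne_zero x)]
      ring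
    have h3 : nr (qS γ) (fun x => Gn n x - Gn N x) ≤ C * ∑ i, nr (qG γ) (pd (fun x => Gn n x - Gn N x) i) := h1
    refine h3.trans ((mul_le_mul_right (Finset.sum_le_sum fun i _ => h2 i) _).trans ?_)
    rw [Finset.sum_add_distrib, mul_add]
    refine (add_le_add (hN n hn) (hN N le_rfl)).trans (le_of_eq ?_)
    rw [← ENNReal.ofReal_add (by positivity) (by positivity)]; congr 1; ring
  obtain ⟨r, hr⟩ := (H.Ghc N).isCompact.isBounded.subset_closedBall (0 : E3)
  refine ⟨r + 1, N, fun R hR n hn => le_trans (nr_mono fun x => ?_) (cau n hn)⟩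
  by_cases hx : x ∈ Ann R
  · have : x ∉ tsupport (Gn N) := fun hxs => by
      have := hr hxs; simp at this; linarith [(mem_Ann.mp hx).2]
    rw [ann_of_mem hx, image_eq_zero_of_notMem_tsupport this, sub_zero]
  · rw [ann_of_notMem hx, abs_zero]; positivity

end NSFlow
end

noncomputable section
open MeasureTheory Metric Filter Topology Set
open scoped ENNReal NNReal

/-! ### Vanishing of the dissipation -/

lemma ann_mul (R : ℝ) (f g : E3 → ℝ) : ann R (fun x => f x * g x) = fun x => ann R f x * ann R g x := by
  funext x
  by_cases hx : x ∈ Ann R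
  · simp only [ann_of_mem hx]
  · simp only [ann_of_notMem hx]; ring

lemma abs_sum3_le {f : Fin 3 → ℝ} {c : ℝ} (h : ∀ i, |f i| ≤ c) : |∑ i, f i| ≤ 3 * c := by
  refine (Finset.abs_sum_le_sum_abs _ _).trans ((Finset.sum_le_sum fun i _ => h i).trans (le_of_eq ?_))
  simp

namespace NSFlow

variable {γ : ℝ} {ρ : E3 → ℝ} {u : Fin 3 → E3 → ℝ} {S : Fin 3 → Fin 3 → E3 → ℝ}
    {dG : Fin 3 → E3 → ℝ} {du : Fin 3 → Fin 3 → E3 → ℝ} {un : Fin 3 → ℕ → E3 → ℝ}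
    {Gn : ℕ → E3 → ℝ} {α E K β g Ku : ℝ}

def Good (β g Ku : ℝ) (u : Fin 3 → E3 → ℝ) (R : ℝ) : Prop :=
  ∀ i, nr β (ann R (u i)) ≤ ENNReal.ofReal (Ku * R ^ g)

lemma vs (H : NSFlow γ ρ u S dG du un Gn) {s e : ℝ} (hβ : 1 ≤ β) (hβs : β ≤ s) (hs : s ≤ 6) (hβ6 : β < 6)
    (hK : 0 ≤ Ku) (he : β * ((6 - s) / (6 - β)) / s * g ≤ e) :
    ∃ K' : ℝ, 0 ≤ K' ∧ ∀ R ≥ 1, Good β g Ku u R → ∀ i, nr s (ann R (u i)) ≤ ENNReal.ofReal (K' * R ^ e) := by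
  choose K' hK' h using fun i => interp_gr (by linarith) hβs hs hβ6 (H.core.um i) (H.u6 i) hK he
  refine ⟨∑ i, K' i, Finset.sum_nonneg fun i _ => hK' i, fun R hR hG i => (h i R hR (hG i)).trans ?_⟩
  have hR0 : 0 < R := by linarith
  apply ENNReal.ofReal_le_ofReal
  gcongr
  exact Finset.single_le_sum (f := K') (fun i _ => hK' i) (Finset.mem_univ i)

lemma v2 (H : NSFlow γ ρ u S dG du un Gn) (hβ : 1 ≤ β) (hβ2 : β ≤ 2) (hK : 0 ≤ Ku)
    (g1 : g ≤ (1 - E) * (6 - β) / (2 * β)) :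
    ∃ K' : ℝ, 0 ≤ K' ∧ ∀ R ≥ 1, Good β g Ku u R → ∀ i, nr 2 (ann R (u i)) ≤ ENNReal.ofReal (K' * R ^ (1 - E)) := by
  refine H.vs hβ hβ2 (by norm_num) (by linarith) hK ?_
  rw [le_div_iff₀ (by linarith)] at g1
  have h6 : 0 < 6 - β := by linarith
  have : β * ((6 - 2) / (6 - β)) / 2 * g = g * (2 * β) / (6 - β) := by field_simp; ring
  rw [this, div_le_iff₀ h6]; exact g1

lemma Rcancel {R E : ℝ} (hR : 0 < R) (c A B : ℝ) : c / R * ((A * R ^ E) * (B * R ^ (1 - E))) = c * A * B := by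
  have : R ^ E * R ^ (1 - E) = R := by rw [← Real.rpow_add hR]; simp
  calc _ = c * A * B * (R ^ E * R ^ (1 - E)) / R := by ring
    _ = _ := by rw [this]; field_simp

lemma ta (H : NSFlow γ ρ u S dG du un Gn) (D : Core.Gr γ ρ α E K) (hβ : 1 ≤ β) (hβ2 : β ≤ 2) (hK : 0 ≤ Ku)
    (g1 : g ≤ (1 - E) * (6 - β) / (2 * β)) {ε : ℝ} (hε : 0 < ε) :
    ∃ R₀ : ℝ, ∀ R ≥ R₀, Good β g Ku u R → |∑ i, ∫ x, ρ x ^ γ * (pd (cut R) i x * u i x)| ≤ ε := by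
  have hC := one_le_Cθ
  obtain ⟨K', hK', hv⟩ := H.v2 hβ hβ2 hK g1
  set δ := ε / (3 * Cθ * (K' + 1)) with hδ
  have hδ0 : 0 < δ := by positivity
  obtain ⟨R₀, h0⟩ := H.p_ann D hδ0
  refine ⟨max 1 R₀, fun R hR hG => ?_⟩
  have hR1 : 1 ≤ R := (le_max_left _ _).trans hR
  have hR0 : 0 < R := by linarith
  have hp := h0 R ((le_max_right _ _).trans hR)
  refine (abs_sum3_le fun i => ann_bound conj22 H.core.pm (H.core.um i) hR0 (by positivity) (by positivity)
    hp (hv R hR1 hG i) i).trans ?_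
  rw [Rcancel hR0]
  have : ε = 3 * (Cθ * δ * (K' + 1)) := by rw [hδ]; field_simp
  nlinarith [mul_pos (by linarith : (0:ℝ) < Cθ) hδ0]

lemma tc (H : NSFlow γ ρ u S dG du un Gn) (D : Core.Gr γ ρ α E K) (hβ : 1 ≤ β) (hβ2 : β ≤ 2) (hK : 0 ≤ Ku)
    (g1 : g ≤ (1 - E) * (6 - β) / (2 * β)) {ε : ℝ} (hε : 0 < ε) :
    ∃ R₀ : ℝ, ∀ R ≥ R₀, Good β g Ku u R → |∑ i, ∑ j, ∫ x, S i j x * (pd (cut R) j x * u i x)| ≤ ε := by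
  have hC := one_le_Cθ
  have hE : 0 ≤ E := D.α0.trans D.αE
  obtain ⟨K', hK', hv⟩ := H.v2 hβ hβ2 hK g1
  set δ := ε / (9 * Cθ * (K' + 1)) with hδ
  have hδ0 : 0 < δ := by positivity
  choose R₀ h0 using fun i j => ann_small (H.core.Sm' i j) (H.core.S2 i j) hδ0
  refine ⟨max 1 (∑ i, ∑ j, |R₀ i j|), fun R hR hG => ?_⟩
  have hR1 : 1 ≤ R := (le_max_left _ _).trans hR
  have hR0 : 0 < R := by linarith
  have hS : ∀ i j, nr 2 (ann R (S i j)) ≤ ENNReal.ofReal (δ * R ^ E) := fun i j => by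
    refine (h0 i j R ?_).trans (ENNReal.ofReal_le_ofReal ?_)
    · refine le_trans ?_ ((le_max_right _ _).trans hR)
      exact (le_abs_self _).trans ((Finset.single_le_sum (f := fun j => |R₀ i j|) (fun _ _ => abs_nonneg _)
        (Finset.mem_univ j)).trans (Finset.single_le_sum (f := fun i => ∑ j, |R₀ i j|)
        (fun _ _ => Finset.sum_nonneg fun _ _ => abs_nonneg _) (Finset.mem_univ i)))
    · have := Real.one_le_rpow hR1 hE
      nlinarith
  refine (abs_sum3_le fun i => abs_sum3_le fun j => ann_bound conj22 (H.core.Sm' i j) (H.core.um i) hR0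
    (by positivity) (by positivity) (hS i j) (hv R hR1 hG i) j).trans ?_
  rw [Rcancel hR0]
  have : ε = 9 * (Cθ * δ * (K' + 1)) := by rw [hδ]; field_simp
  nlinarith [mul_pos (by linarith : (0:ℝ) < Cθ) hδ0]

lemma tg (H : NSFlow γ ρ u S dG du un Gn) (D : Core.Gr γ ρ α E K) (hβ : 1 ≤ β) (hβ2 : β ≤ 2) (hK : 0 ≤ Ku)
    (g1 : g ≤ (1 - E) * (6 - β) / (2 * β)) {ε : ℝ} (hε : 0 < ε) :
    ∃ R₀ : ℝ, ∀ R ≥ R₀, Good β g Ku u R → |∑ j, ∫ x, ρ x * u j x * (cut R x * dG j x)| ≤ ε := by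
  have hC := one_le_Cθ
  have hγ := H.core.hγ
  have hK0 := D.K0
  obtain ⟨K', hK', hv⟩ := H.v2 hβ hβ2 hK g1
  set δ := ε / (3 * Cθ * (K' + 1) * (K * 2 ^ α + 1)) with hδ
  have hδ0 : 0 < δ := by positivity
  obtain ⟨R₀, N, h0⟩ := H.G_ann hδ0
  refine ⟨max 1 R₀, fun R hR hG => ?_⟩
  have hR1 : 1 ≤ R := (le_max_left _ _).trans hR
  have hR0 : 0 < R := by linarith
  have lim := (H.E4 (cut_smooth R) (cut_hcs hR0)).abs
  refine le_of_tendsto lim (eventually_atTop.mpr ⟨N, fun n hn => ?_⟩)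
  have hGn := h0 R ((le_max_right _ _).trans hR) n hn
  have hρ : nr γ (ann R ρ) ≤ ENNReal.ofReal (K * 2 ^ α * R ^ α) :=
    (nr_ann_le_ind R ρ γ).trans (Core.grc D one_le_two hR1)
  have hRα : R ^ α ≤ R ^ E := Rpow_le hR1 D.αE
  have hρG : nr 2 (ann R (fun x => ρ x * Gn n x)) ≤ ENNReal.ofReal (K * 2 ^ α * δ * R ^ E) := by
    rw [ann_mul]
    have hqS : 0 < qS γ := by unfold qS; exact div_pos (by linarith) (by linarith)
    refine (nr_mul (a := γ) (b := qS γ) (by linarith) hqS two_pos (by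
      unfold qS
      have h1 : γ - 2 ≠ 0 := by linarith
      have h3 : γ ≠ 0 := by linarith
      field_simp; ring) (ann_meas H.core.ρm R) (ann_meas (H.Gsm n).continuous.measurable R)).trans ?_
    refine (mul_le_mul' hρ hGn).trans ?_
    rw [← ENNReal.ofReal_mul (by positivity)]
    apply ENNReal.ofReal_le_ofReal
    calc K * 2 ^ α * R ^ α * δ ≤ K * 2 ^ α * R ^ E * δ := by gcongr
      _ = _ := by ring
  have e : ∀ j, ∫ x, ρ x * u j x * (pd (cut R) j x * Gn n x) =
      ∫ x, (ρ x * Gn n x) * (pd (cut R) j x * u j x) := fun j => by congr 1; funext x; ring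
  simp only [e]
  rw [abs_neg]
  refine (abs_sum3_le fun j => ann_bound conj22 (H.core.ρm.mul (H.Gsm n).continuous.measurable)
    (H.core.um j) hR0 (by positivity) (by positivity) hρG (hv R hR1 hG j) j).trans ?_
  rw [Rcancel hR0]
  have : ε = 3 * (Cθ * ((K * 2 ^ α + 1) * δ) * (K' + 1)) := by rw [hδ]; field_simp
  rw [this]
  gcongr <;> linarith

lemma tb (H : NSFlow γ ρ u S dG du un Gn) (D : Core.Gr γ ρ α E K) (hβ : 1 ≤ β) (hβ2 : β ≤ 2) (hK : 0 ≤ Ku)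
    (g2 : g ≤ γ * (1 - E / γ) * (6 - β) / (3 * β * (γ - 1))) {ε : ℝ} (hε : 0 < ε) :
    ∃ R₀ : ℝ, ∀ R ≥ R₀, Good β g Ku u R →
      |∑ i, ∑ j, ∫ x, ρ x * u j x * (pd (cut R) j x * (u i x * u i x))| ≤ ε := by
  have hC := one_le_Cθ
  have hγ := H.core.hγ
  set s : ℝ := 6 * γ / (2 * γ - 1) with hs
  have h2γ : 0 < 2 * γ - 1 := by linarith
  have h6 : 0 < 6 - β := by linarith
  have hβ0 : 0 < β := by linarith
  have hs2 : 2 ≤ s := by rw [hs, le_div_iff₀ h2γ]; linarith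
  have hs6 : s ≤ 6 := by rw [hs, div_le_iff₀ h2γ]; linarith
  obtain ⟨K', hK', hv⟩ := H.vs (s := s) (e := (1 - E / γ) / 3) hβ (hβ2.trans hs2) hs6 (by linarith) hK (by
    rw [le_div_iff₀ (mul_pos (by linarith) (by linarith))] at g2
    have e1 : β * ((6 - s) / (6 - β)) / s * g = g * (3 * β * (γ - 1)) / (3 * γ * (6 - β)) := by
      have h0 : γ ≠ 0 := by linarith
      have h2 : 2 * γ - 1 ≠ 0 := h2γ.ne'
      have h66 : 6 - β ≠ 0 := h6.ne'
      have h3 : (6 - s) / s = (γ - 1) / γ := by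
        have hs' : s * (2 * γ - 1) = 6 * γ := by rw [hs]; exact div_mul_cancel₀ _ h2
        rw [div_eq_div_iff (by linarith) h0]; linarith
      calc β * ((6 - s) / (6 - β)) / s * g = β * ((6 - s) / s) / (6 - β) * g := by ring
        _ = _ := by rw [h3]; field_simp
    rw [e1, div_le_iff₀ (by positivity)]
    linarith)
  set δ := ε / (9 * Cθ * (K' ^ 3 + 1)) with hδ
  have hδ0 : 0 < δ := by positivity
  obtain ⟨R₀, h0⟩ := H.ρ_ann D hδ0
  refine ⟨max 1 R₀, fun R hR hG => ?_⟩
  have hR1 : 1 ≤ R := (le_max_left _ _).trans hR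
  have hR0 : 0 < R := by linarith
  have hρ := h0 R ((le_max_right _ _).trans hR)
  have conj : (2 * γ).HolderConjugate (s / 3) := by
    rw [Real.holderConjugate_iff]
    refine ⟨by linarith, ?_⟩
    rw [hs]
    have : γ ≠ 0 := by linarith
    field_simp; ring
  have hT : ∀ i j, nr (s / 3) (ann R (fun x => u j x * (u i x * u i x))) ≤
      ENNReal.ofReal (K' ^ 3 * R ^ (1 - E / γ)) := fun i j => by
    rw [ann_mul, ann_mul]
    have m := fun i => ann_meas (H.core.um i) R
    have a1 := nr_mul (a := s) (b := s / 2) (c := s / 3) (by linarith) (by linarith) (by linarith)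
      (by field_simp; norm_num) (m j) ((m i).mul (m i))
    have a2 := nr_mul (a := s) (b := s) (c := s / 2) (by linarith) (by linarith) (by linarith)
      (by field_simp; norm_num) (m i) (m i)
    refine (a1.trans (mul_le_mul' (hv R hR1 hG j) (a2.trans (mul_le_mul' (hv R hR1 hG i) (hv R hR1 hG i))))).trans
      (le_of_eq ?_)
    rw [← ENNReal.ofReal_mul (by positivity), ← ENNReal.ofReal_mul (by positivity)]
    congr 1
    have : R ^ (1 - E / γ) = R ^ ((1 - E / γ) / 3) * R ^ ((1 - E / γ) / 3) * R ^ ((1 - E / γ) / 3) := by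
      rw [← Real.rpow_add hR0, ← Real.rpow_add hR0]; congr 1; ring
    rw [this]; ring
  have e : ∀ i j, ∫ x, ρ x * u j x * (pd (cut R) j x * (u i x * u i x)) =
      ∫ x, ρ x * (pd (cut R) j x * (u j x * (u i x * u i x))) := fun i j => by congr 1; funext x; ring
  simp only [e]
  refine (abs_sum3_le fun i => abs_sum3_le fun j => ann_bound conj H.core.ρm ((H.core.um j).mul
    ((H.core.um i).mul (H.core.um i))) hR0
    (by positivity) (by positivity) hρ (hT i j) j).trans ?_
  rw [Rcancel hR0]
  have : ε = 9 * (Cθ * δ * (K' ^ 3 + 1)) := by rw [hδ]; field_simp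
  nlinarith [mul_pos (by linarith : (0:ℝ) < Cθ) hδ0]

lemma diss_zero (H : NSFlow γ ρ u S dG du un Gn) (D : Core.Gr γ ρ α E K) (hβ : 1 ≤ β) (hβ2 : β ≤ 2)
    (hK : 0 ≤ Ku) (g1 : g ≤ (1 - E) * (6 - β) / (2 * β))
    (g2 : g ≤ γ * (1 - E / γ) * (6 - β) / (3 * β * (γ - 1)))
    (hgood : ∀ R₀ : ℝ, ∃ R > R₀, Good β g Ku u R) :
    ∑ i, ∑ j, ∫ x, S i j x * du i j x = 0 := by
  have hγ := H.core.hγ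
  have I : ∀ i j, Integrable (fun x => S i j x * du i j x) volume := fun i j =>
    nr1_integrable ((H.core.Sm' i j).mul ((H.sob i).c2 j).m) (ne_top_of_le_ne_top
      (ENNReal.mul_ne_top (H.core.S2 i j) ((H.sob i).c2 j).fin) (nr_mul two_pos two_pos one_pos (by norm_num)
      (H.core.Sm' i j) ((H.sob i).c2 j).m))
  have L : Tendsto (fun R : ℝ => ∑ i, ∑ j, ∫ x, S i j x * (cut R x * du i j x)) atTop
      (𝓝 (∑ i, ∑ j, ∫ x, S i j x * du i j x)) := by
    refine tendsto_finsetSum _ fun i _ => tendsto_finsetSum _ fun j _ => ?_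
    refine tendsto_integral_filter_of_dominated_convergence (fun x => |S i j x * du i j x|) ?_ ?_ (I i j).abs ?_
    · refine Eventually.of_forall fun R => ?_
      exact ((H.core.Sm' i j).mul ((cut_smooth R).continuous.measurable.mul ((H.sob i).c2 j).m)).aestronglyMeasurable
    · refine Eventually.of_forall fun R => ae_of_all _ fun x => ?_
      rw [Real.norm_eq_abs, abs_mul, abs_mul, abs_mul, abs_of_nonneg (cut_nonneg R x)]
      refine mul_le_mul_of_nonneg_left ?_ (abs_nonneg _)
      exact mul_le_of_le_one_left (abs_nonneg _) (cut_le_one R x)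
    · refine ae_of_all _ fun x => ?_
      refine tendsto_const_nhds.congr' ?_
      filter_upwards [eventually_ge_atTop (max 1 ‖x‖)] with R hR
      rw [cut_eq_one (lt_of_lt_of_le one_pos ((le_max_left _ _).trans hR)) ((le_max_right _ _).trans hR), one_mul]
  by_contra hne
  have hpos := abs_pos.mpr hne
  set d := |∑ i, ∑ j, ∫ x, S i j x * du i j x| with hd
  have ev := (L.abs).eventually_const_lt (show d / 2 < d by linarith)
  obtain ⟨R₁, h1⟩ := eventually_atTop.mp ev
  have hε : 0 < d / 16 := by positivity
  obtain ⟨Ra, ha⟩ := H.ta D hβ hβ2 hK g1 hε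
  obtain ⟨Rb, hb⟩ := H.tb D hβ hβ2 hK g2 hε
  obtain ⟨Rc, hc⟩ := H.tc D hβ hβ2 hK g1 hε
  obtain ⟨Rg, hg⟩ := H.tg D hβ hβ2 hK g1 hε
  obtain ⟨R, hR, hG⟩ := hgood (max 1 (max R₁ (max Ra (max Rb (max Rc Rg)))))
  simp only [gt_iff_lt, max_lt_iff] at hR
  obtain ⟨r1, r2, r3, r4, r5, r6⟩ := hR
  have en := H.energy (cut_smooth R) (cut_hcs (R := R) (by linarith))
  have b1 := h1 R r2.le
  have b2 := ha R r3.le hG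
  have b3 := hb R r4.le hG
  have b4 := hc R r5.le hG
  have b5 := hg R r6.le hG
  rw [en] at b1
  set a := ∑ i, ∫ x, ρ x ^ γ * (pd (cut R) i x * u i x)
  have b6 : |γ / (γ - 1) * a| ≤ 2 * (d / 16) := by
    rw [abs_mul, abs_of_nonneg (div_nonneg (by linarith) (by linarith))]
    have : γ / (γ - 1) ≤ 2 := by rw [div_le_iff₀ (by linarith)]; linarith
    gcongr
  rw [abs_le] at b2 b3 b4 b5 b6
  rcases lt_abs.mp b1 with h | h <;> linarith

end NSFlow
end

noncomputable section
open MeasureTheory Metric Filter Topology Set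
open scoped ENNReal NNReal

/-! ### Korn's inequality and the conclusion -/

namespace NSFlow

variable {γ : ℝ} {ρ : E3 → ℝ} {u : Fin 3 → E3 → ℝ} {S : Fin 3 → Fin 3 → E3 → ℝ}
  {dG : Fin 3 → E3 → ℝ} {du : Fin 3 → Fin 3 → E3 → ℝ} {un : Fin 3 → ℕ → E3 → ℝ}
  {Gn : ℕ → E3 → ℝ} {μ η : ℝ}

lemma dd_int (H : NSFlow γ ρ u S dG du un Gn) (i j k l : Fin 3) :
    Integrable (fun x => du i j x * du k l x) volume :=
  nr1_integrable (((H.sob i).c2 j).m.mul ((H.sob k).c2 l).m) (ne_top_of_le_ne_top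
    (ENNReal.mul_ne_top ((H.sob i).c2 j).fin ((H.sob k).c2 l).fin) (nr_mul two_pos two_pos one_pos (by norm_num)
      ((H.sob i).c2 j).m ((H.sob k).c2 l).m))

lemma dd_swap (H : NSFlow γ ρ u S dG du un Gn) (i j : Fin 3) :
    ∫ x, du i j x * du j i x = ∫ x, du i i x * du j j x := by
  have l1 := ((H.sob i).c2 j).int2 one_le_two one_le_two (by norm_num) ((H.sob j).c2 i)
  have l2 := ((H.sob i).c2 i).int2 one_le_two one_le_two (by norm_num) ((H.sob j).c2 j)
  refine tendsto_nhds_unique l1 (l2.congr fun n => ?_)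
  exact ibp_swap ((H.sob i).sm n) ((H.sob j).sm n) ((H.sob j).hcs n) i j

lemma S_du (H : NSFlow γ ρ u S dG du un Gn)
    (hS : ∀ i j x, S i j x = Smat μ η (fun a b => du a b x) i j) (i j : Fin 3) :
    ∫ x, S i j x * du i j x = μ * (∫ x, du i j x * du i j x) + μ * (∫ x, du i j x * du j i x) +
      ∑ k, ((η - 2 / 3 * μ) * if i = j then (1:ℝ) else 0) * ∫ x, du k k x * du i j x := by
  have e : (fun x => S i j x * du i j x) = fun x => (μ * (du i j x * du i j x) + μ * (du i j x * du j i x)) +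
      ∑ k, ((η - 2 / 3 * μ) * if i = j then (1:ℝ) else 0) * (du k k x * du i j x) := by
    funext x
    rw [hS, ← Finset.mul_sum, ← Finset.sum_mul]
    unfold Smat
    ring
  rw [e, integral_add, integral_add, integral_const_mul, integral_const_mul, integral_finsetSum]
  · simp only [integral_const_mul]
  · exact fun k _ => (H.dd_int k k i j).const_mul _
  · exact (H.dd_int i j i j).const_mul _
  · exact (H.dd_int i j j i).const_mul _
  · exact ((H.dd_int i j i j).const_mul _).add ((H.dd_int i j j i).const_mul _)
  · exact integrable_finsetSum _ fun k _ => (H.dd_int k k i j).const_mul _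

lemma du_zero (H : NSFlow γ ρ u S dG du un Gn) (hμ : 0 < μ) (hη : 0 ≤ η)
    (hS : ∀ i j x, S i j x = Smat μ η (fun a b => du a b x) i j)
    (h0 : ∑ i, ∑ j, ∫ x, S i j x * du i j x = 0) (i j : Fin 3) : ∫ x, du i j x * du i j x = 0 := by
  have hn : ∀ i j, 0 ≤ ∫ x, du i j x * du i j x := fun i j => integral_nonneg fun x => mul_self_nonneg _
  have hdiv : 0 ≤ ∑ i, ∑ k, ∫ x, du k k x * du i i x := by
    have : ∫ x, (∑ k, du k k x) * (∑ k, du k k x) = ∑ i, ∑ k, ∫ x, du k k x * du i i x := by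
      have e : (fun x => (∑ k, du k k x) * (∑ k, du k k x)) = fun x => ∑ i, ∑ k, du k k x * du i i x := by
        funext x
        rw [Finset.mul_sum]
        exact Finset.sum_congr rfl fun i _ => Finset.sum_mul _ _ _
      rw [e, integral_finsetSum _ fun i _ => integrable_finsetSum _ fun k _ => H.dd_int k k i i]
      exact Finset.sum_congr rfl fun i _ => integral_finsetSum _ fun k _ => H.dd_int k k i i
    rw [← this]
    exact integral_nonneg fun x => mul_self_nonneg _
  have h1 : ∑ i, ∑ j, ∫ x, S i j x * du i j x = μ * (∑ i, ∑ j, ∫ x, du i j x * du i j x) +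
      (μ / 3 + η) * ∑ i, ∑ k, ∫ x, du k k x * du i i x := by
    simp only [H.S_du hS, H.dd_swap]
    simp [Fin.sum_univ_three]
    have c : ∀ i j, ∫ x, du i i x * du j j x = ∫ x, du j j x * du i i x := fun i j => by
      congr 1; funext x; ring
    rw [c 1 0, c 2 0, c 2 1]
    ring
  rw [h1] at h0
  have h2 : 0 ≤ (μ / 3 + η) * ∑ i, ∑ k, ∫ x, du k k x * du i i x := by positivity
  have h3 : ∑ i, ∑ j, ∫ x, du i j x * du i j x ≤ 0 := by
    by_contra h
    push Not at h
    have := mul_pos hμ h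
    linarith
  have h4 := Finset.single_le_sum (f := fun i => ∑ j, ∫ x, du i j x * du i j x)
    (fun i _ => Finset.sum_nonneg fun j _ => hn i j) (Finset.mem_univ i)
  have h5 := Finset.single_le_sum (f := fun j => ∫ x, du i j x * du i j x)
    (fun j _ => hn i j) (Finset.mem_univ j)
  have := hn i j
  linarith

lemma u_zero (H : NSFlow γ ρ u S dG du un Gn)
    (h0 : ∀ i j, ∫ x, du i j x * du i j x = 0) (i : Fin 3) : u i =ᵐ[volume] 0 := by
  have d0 : ∀ j, nr 2 (du i j) = 0 := fun j => by
    have := (integral_eq_zero_iff_of_nonneg (fun x => mul_self_nonneg _) (H.dd_int i j i j)).mp (h0 i j)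
    refine (eLpNorm_congr_ae (g := fun _ => 0) ?_).trans eLpNorm_zero'
    filter_upwards [this] with x hx
    simpa using hx
  have d1 : ∀ j, Tendsto (fun n => nr 2 (pd (un i n) j)) atTop (𝓝 0) := fun j => by
    refine tendsto_of_tendsto_of_tendsto_of_le_of_le tendsto_const_nhds ((H.sob i).c2 j).lim (fun _ => zero_le)
      fun n => ?_
    have := ((H.sob i).c2 j).nr_le one_le_two n
    rwa [d0, add_zero] at this
  have d2 : Tendsto (fun n => nr 6 (un i n)) atTop (𝓝 0) := by
    have : Tendsto (fun n => (Cs : ℝ≥0∞) * ∑ j, nr 2 (pd (un i n) j)) atTop (𝓝 (Cs * ∑ _j : Fin 3, 0)) :=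
      ENNReal.Tendsto.const_mul (tendsto_finsetSum _ fun j _ => d1 j) (Or.inr (by simp))
    simp only [Finset.sum_const_zero, mul_zero] at this
    exact tendsto_of_tendsto_of_tendsto_of_le_of_le tendsto_const_nhds this (fun _ => zero_le)
      fun n => Cs_spec ((H.sob i).sm n).one ((H.sob i).hcs n)
  have d3 : nr 6 (u i) ≤ 0 := by
    have := d2.add (H.sob i).c6.lim
    rw [add_zero] at this
    refine ge_of_tendsto' this fun n => ?_
    have m := (H.sob i).c6.mn n
    have := nr_add (r := 6) (by norm_num) m (m.sub (H.sob i).c6.m).neg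
    refine le_trans (le_of_eq ?_) (this.trans (le_of_eq ?_))
    · congr 1; funext x; simp
    · congr 1; exact nr_neg _
  exact (eLpNorm_eq_zero_iff (H.core.um i).aestronglyMeasurable (by simp)).mp (le_antisymm d3 zero_le)

end NSFlow

/-! ### Exponents -/

lemma fExp_spec {α γ : ℝ} (hγ : 3 ≤ γ) (hα : 0 ≤ α) :
    α ≤ γ * fExp α γ ∧ α + 1/2 - 3/γ ≤ γ * fExp α γ ∧ α * γ - 3/2 ≤ γ * fExp α γ := by
  have h0 : 0 < γ := by linarith
  have h1 : 0 < γ - 1 := by linarith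
  have hne := h0.ne'
  unfold fExp
  have q : 3 / γ * γ = 3 := div_mul_cancel₀ _ hne
  split_ifs with a b c d
  · rw [div_le_iff₀ (by positivity)] at b
    have e : γ * (α - 3 / (2 * γ)) = α * γ - 3/2 := by field_simp
    have q2 : 3 / γ ≤ 1/2 := by rw [div_le_iff₀ h0]; linarith
    have b2 : 2 - 3 / γ ≤ α * (γ - 1) := by
      rw [sub_le_iff_le_add, ← mul_le_mul_iff_of_pos_right h0, add_mul, q]; nlinarith
    rw [e]; refine ⟨?_, ?_, le_rfl⟩ <;> nlinarith
  · push Not at b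
    rw [lt_div_iff₀ (by positivity)] at b
    have e : γ * (α / γ + 1 / (2 * γ) - 3 / γ ^ 2) = α + 1/2 - 3/γ := by field_simp
    have q2 : 3 / γ ≤ 1/2 := by rw [div_le_iff₀ h0]; linarith
    have b2 : α * (γ - 1) ≤ 2 - 3 / γ := by
      rw [le_sub_iff_add_le, ← mul_le_mul_iff_of_pos_right h0, add_mul, q]; nlinarith
    rw [e]; refine ⟨?_, le_rfl, ?_⟩ <;> nlinarith
  · rw [div_le_iff₀ (by positivity)] at c
    have e : γ * (α - 3 / (2 * γ)) = α * γ - 3/2 := by field_simp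
    have q2 : 1/2 ≤ 3 / γ := by rw [le_div_iff₀ h0]; linarith
    rw [e]; refine ⟨?_, ?_, le_rfl⟩ <;> nlinarith
  · push Not at c
    rw [lt_div_iff₀ (by positivity)] at c
    have e : γ * (α / γ) = α := by field_simp
    have q2 : 1/2 ≤ 3 / γ := by rw [le_div_iff₀ h0]; linarith
    rw [e]; refine ⟨le_rfl, ?_, ?_⟩ <;> nlinarith
  · push Not at d
    rw [lt_div_iff₀ (by positivity)] at d
    have e : γ * (α / γ ^ 2 + 1 / (2 * γ ^ 2)) = (α + 1/2) / γ := by field_simp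
    have q2 : 1/2 ≤ 3 / γ := by rw [le_div_iff₀ h0]; linarith
    have f : α ≤ (α + 1/2) / γ := by rw [le_div_iff₀ h0]; linarith
    rw [e]; refine ⟨f, ?_, ?_⟩ <;> nlinarith

lemma gExp_spec {α β γ : ℝ} (hγ : 3 ≤ γ) (hβ : 1 ≤ β) (hβ2 : β ≤ 2) :
    gExp α β γ ≤ (1 - γ * fExp α γ) * (6 - β) / (2 * β) ∧
    gExp α β γ ≤ γ * (1 - γ * fExp α γ / γ) * (6 - β) / (3 * β * (γ - 1)) := by
  have h0 : 0 < γ := by linarith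
  have h1 : 0 < γ - 1 := by linarith
  have h5 : 0 < 3 * γ - 5 := by linarith
  have hb : 0 < β := by linarith
  rw [mul_div_cancel_left₀ _ h0.ne']
  unfold gExp
  set f := fExp α γ
  have k : (0:ℝ) ≤ (6 - β) / β := div_nonneg (by linarith) hb.le
  have e1 : (1 - γ * f) * (6 - β) / (2 * β) = (6 - β) / β * ((1 - γ * f) / 2) := by field_simp
  have e2 : γ * (1 - f) * (6 - β) / (3 * β * (γ - 1)) = (6 - β) / β * (γ * (1 - f) / (3 * (γ - 1))) := by
    field_simp
  rw [e1, e2]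
  split_ifs with a
  · rw [le_div_iff₀ (by positivity)] at a
    refine ⟨mul_le_mul_of_nonneg_left ?_ k, le_rfl⟩
    rw [div_le_div_iff₀ (by positivity) two_pos]
    nlinarith
  · push Not at a
    rw [div_lt_iff₀ (by positivity)] at a
    refine ⟨le_rfl, mul_le_mul_of_nonneg_left ?_ k⟩
    rw [div_le_div_iff₀ two_pos (by positivity)]
    nlinarith

end

noncomputable section
open MeasureTheory Metric Filter Topology Set
open scoped ENNReal NNReal

/-! ### From the frozen formulation to the component formulation -/

lemma nr_indicator {f : E3 → ℝ} {r : ℝ} (hr : 0 < r) {s : Set E3} (hs : MeasurableSet s)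
    (hi : IntegrableOn (fun x => |f x| ^ r) s volume) :
    nr r (s.indicator f) = ENNReal.ofReal (lpNormOn f r s) := by
  have h1 : nr r (s.indicator f) = (∫⁻ x in s, ‖f x‖ₑ ^ r) ^ (1 / r) := by
    rw [nr_eq hr, ← lintegral_indicator hs]
    congr 2
    funext x
    by_cases hx : x ∈ s
    · simp [hx]
    · simp [hx, hr]
  unfold lpNormOn
  rw [h1, ← ENNReal.ofReal_rpow_of_nonneg (integral_nonneg fun x => by positivity) (by positivity),
    ofReal_integral_eq_lintegral_ofReal hi (ae_of_all _ fun x => by positivity)]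
  congr 2
  funext x
  rw [← ENNReal.ofReal_rpow_of_nonneg (abs_nonneg _) hr.le, ← Real.norm_eq_abs, ofReal_norm]

lemma nr_comp_le {f : E3 → Fin 3 → ℝ} {g : E3 → ℝ} {r : ℝ} {q : ℝ≥0∞} (hq : ENNReal.ofReal r = q) (i : Fin 3)
    (h : ∀ᵐ x, g x = f x i) : nr r g ≤ eLpNorm f q (volume.restrict univ) := by
  rw [Measure.restrict_univ, ← hq]
  refine eLpNorm_mono_ae ?_
  filter_upwards [h] with x hx
  rw [hx]; exact norm_le_pi_norm _ _

lemma nr_comp_le2 {f : E3 → Fin 3 → Fin 3 → ℝ} {g : E3 → ℝ} {r : ℝ} {q : ℝ≥0∞} (hq : ENNReal.ofReal r = q)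
    (i j : Fin 3) (h : ∀ᵐ x, g x = f x i j) : nr r g ≤ eLpNorm f q (volume.restrict univ) := by
  rw [Measure.restrict_univ, ← hq]
  refine eLpNorm_mono_ae ?_
  filter_upwards [h] with x hx
  rw [hx]; exact (norm_le_pi_norm _ _).trans (norm_le_pi_norm _ _)

lemma li_comp {f : E3 → Fin 3 → ℝ} (hf : LocallyIntegrable f volume) {g : E3 → ℝ} (gm : Measurable g) (i : Fin 3)
    (h : ∀ᵐ x, g x = f x i) : LocallyIntegrable g volume := by
  refine hf.mono gm.aestronglyMeasurable ?_
  filter_upwards [h] with x hx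
  rw [hx]; exact norm_le_pi_norm _ _

lemma comp_sm {φ : E3 → Fin 3 → ℝ} (h : IsTestVec ((⊤ : ℕ∞) : WithTop ℕ∞) univ φ) (i : Fin 3) :
    Sm (fun x => φ x i) := contDiff_pi.mp h.1 i

lemma comp_hcs {φ : E3 → Fin 3 → ℝ} (h : HasCompactSupport φ) (i : Fin 3) :
    HasCompactSupport (fun x => φ x i) := h.comp_left (g := fun v : Fin 3 → ℝ => v i) rfl

lemma pi_test {φ : Fin 3 → E3 → ℝ} (h1 : ∀ i, Sm (φ i)) (h2 : ∀ i, HasCompactSupport (φ i)) :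
    IsTestVec 1 univ (fun x i => φ i x) := by
  refine ⟨contDiff_pi.mpr fun i => (h1 i).of_le (by exact_mod_cast le_top), ?_, subset_univ _⟩
  refine HasCompactSupport.intro (isCompact_iUnion h2) fun x hx => ?_
  funext i
  by_contra h
  exact hx (mem_iUnion.mpr ⟨i, subset_tsupport _ h⟩)

lemma Cvg.mk_of {q : ℝ} {fn : ℕ → E3 → ℝ} {f : E3 → ℝ} (hq : 1 ≤ q) (mn : ∀ n, Continuous (fn n))
    (hc : ∀ n, HasCompactSupport (fn n)) (m : Measurable f)
    {b : ℕ → ℝ≥0∞} (hb : Tendsto b atTop (𝓝 0))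
    (hle : ∀ n, nr q (fun x => fn n x - f x) ≤ b n) : Cvg q fn f := by
  refine Cvg.tendsto_of_le (fun n => (mn n).measurable) m ?_ hb hle
  obtain ⟨n, hn⟩ := (hb.eventually (gt_mem_nhds (zero_lt_one' ℝ≥0∞))).exists
  have h1 := nr_add (r := q) hq (mn n).measurable ((mn n).measurable.sub m).neg
  refine ne_top_of_le_ne_top (ENNReal.add_ne_top.mpr ⟨cts_fin (mn n) (hc n) q, ?_⟩) (le_trans (le_of_eq ?_) h1)
  · refine ne_top_of_le_ne_top (hn.trans ENNReal.one_lt_top).ne (le_trans (le_of_eq ?_) (hle n))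
    exact nr_neg _
  · congr 1; funext x; simp

lemma Smat_memLp {μ η : ℝ} {du : Fin 3 → Fin 3 → E3 → ℝ} (h : ∀ i j, MemLp (du i j) 2 volume) (i j : Fin 3) :
    MemLp (fun x => Smat μ η (fun a b => du a b x) i j) 2 volume := by
  have hs : MemLp (fun x => ∑ k, du k k x) 2 volume := memLp_finsetSum _ fun k _ => h k k
  unfold Smat
  exact ((((h i j).add (h j i)).sub ((hs.const_mul _).mul_const _)).const_mul _).add ((hs.const_mul _).mul_const _)

section conv
variable {μ η γ : ℝ} {G : E3 → ℝ} {dG : E3 → Fin 3 → ℝ} {ρ : E3 → ℝ} {u : E3 → Fin 3 → ℝ}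
  {du : E3 → Fin 3 → Fin 3 → ℝ}
  {r : E3 → ℝ} {v : Fin 3 → E3 → ℝ} {dv : Fin 3 → Fin 3 → E3 → ℝ} {dg : Fin 3 → E3 → ℝ}

lemma conv_pl (hs : IsentropicWeakSolution μ η γ G dG ρ u du) (hr : r =ᵐ[volume] ρ) :
    LocallyIntegrable (fun x => r x ^ γ) volume := by
  have h := locallyIntegrableOn_univ.mp hs.pρ_locInt
  refine h.congr ?_
  filter_upwards [hr] with x hx
  simp only [hx]

lemma conv_ruu (hs : IsentropicWeakSolution μ η γ G dG ρ u du) (hr : r =ᵐ[volume] ρ)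
    (rm : Measurable r) (vm : ∀ i, Measurable (v i)) (hv : ∀ i, ∀ᵐ x, v i x = u x i) (i j : Fin 3) :
    LocallyIntegrable (fun x => r x * v i x * v j x) volume := by
  have h := locallyIntegrableOn_univ.mp hs.ρu2_locInt
  refine h.mono ((rm.mul (vm i)).mul (vm j)).aestronglyMeasurable ?_
  filter_upwards [hr, hv i, hv j] with x h1 h2 h3
  rw [h1, h2, h3, mul_assoc, norm_mul, norm_mul (ρ x) (∑ i, u x i ^ 2)]
  refine mul_le_mul_of_nonneg_left ?_ (norm_nonneg _)
  have hn : ∀ k, 0 ≤ (u x k) ^ 2 := fun k => sq_nonneg _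
  have a := Finset.single_le_sum (f := fun k => (u x k) ^ 2) (fun k _ => hn k) (Finset.mem_univ i)
  have b := Finset.single_le_sum (f := fun k => (u x k) ^ 2) (fun k _ => hn k) (Finset.mem_univ j)
  beta_reduce at a b
  rw [Real.norm_eq_abs, Real.norm_eq_abs, abs_of_nonneg (Finset.sum_nonneg fun k _ => hn k), abs_mul]
  have := two_mul_le_add_sq |u x i| |u x j|
  rw [sq_abs, sq_abs] at this
  linarith

lemma conv_ru (hs : IsentropicWeakSolution μ η γ G dG ρ u du) (hr : r =ᵐ[volume] ρ)
    (rm : Measurable r) (vm : ∀ i, Measurable (v i)) (hv : ∀ i, ∀ᵐ x, v i x = u x i) (i : Fin 3) :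
    LocallyIntegrable (fun x => r x * v i x) volume := by
  have h := hs.ρu_locInt
  rw [closure_univ, locallyIntegrableOn_univ] at h
  refine li_comp h (rm.mul (vm i)) i ?_
  filter_upwards [hr, hv i] with x h1 h2
  rw [h1, h2]

lemma conv_rg (hs : IsentropicWeakSolution μ η γ G dG ρ u du) (hr : r =ᵐ[volume] ρ)
    (rm : Measurable r) (gm : ∀ i, Measurable (dg i)) (hg : ∀ i, ∀ᵐ x, dg i x = dG x i) (i : Fin 3) :
    LocallyIntegrable (fun x => r x * dg i x) volume := by
  refine li_comp (locallyIntegrableOn_univ.mp hs.ρdG_locInt) (rm.mul (gm i)) i ?_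
  filter_upwards [hr, hg i] with x h1 h2
  rw [h1, h2]

lemma conv_mass (hs : IsentropicWeakSolution μ η γ G dG ρ u du) (hr : r =ᵐ[volume] ρ)
    (rm : Measurable r) (vm : ∀ i, Measurable (v i)) (hv : ∀ i, ∀ᵐ x, v i x = u x i)
    (φ : E3 → ℝ) (h1 : Sm φ) (h2 : HasCompactSupport φ) : ∑ i, ∫ x, r x * v i x * pd φ i x = 0 := by
  have h := hs.mass φ h1 h2
  rw [Measure.restrict_univ] at h
  rw [← integral_finsetSum, ← h]
  · refine integral_congr_ae ?_
    filter_upwards [hr, ae_all_iff.mpr hv] with x a b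
    rw [Finset.mul_sum]
    refine Finset.sum_congr rfl fun i _ => ?_
    rw [a, b i]; ring
  · exact fun i _ => li_mul (conv_ru hs hr rm vm hv i) (contDiff_pd h1 i).continuous (hcs_pd h2 i)

lemma conv_weq (hs : IsentropicWeakSolution μ η γ G dG ρ u du) (hr : r =ᵐ[volume] ρ)
    (rm : Measurable r) (vm : ∀ i, Measurable (v i)) (hv : ∀ i, ∀ᵐ x, v i x = u x i)
    (gm : ∀ i, Measurable (dg i)) (hg : ∀ i, ∀ᵐ x, dg i x = dG x i)
    (hd : ∀ i j, ∀ᵐ x, dv i j x = du x i j) (d2 : ∀ i j, MemLp (dv i j) 2 volume) :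
    WEq (fun x => r x ^ γ) (fun i j x => Smat μ η (fun a b => dv a b x) i j - r x * v i x * v j x)
      (fun i x => r x * dg i x) := by
  intro φ h1 h2
  have h := hs.momentum _ (pi_test h1 h2)
  simp only [Measure.restrict_univ] at h
  have pc := fun i j => (contDiff_pd (h1 i) j).continuous
  have ph := fun i j => hcs_pd (h2 i) j
  have iS : ∀ i j, Integrable (fun x => Smat μ η (fun a b => dv a b x) i j * pd (φ i) j x) volume := fun i j =>
    li_mul ((Smat_memLp d2 i j).locallyIntegrable one_le_two) (pc i j) (ph i j)
  have iR : ∀ i j, Integrable (fun x => r x * v i x * v j x * pd (φ i) j x) volume := fun i j =>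
    li_mul (conv_ruu hs hr rm vm hv i j) (pc i j) (ph i j)
  have iP : ∀ i, Integrable (fun x => r x ^ γ * pd (φ i) i x) volume := fun i =>
    li_mul (conv_pl hs hr) (pc i i) (ph i i)
  have iG : ∀ i, Integrable (fun x => r x * dg i x * φ i x) volume := fun i =>
    li_mul (conv_rg hs hr rm gm hg i) (h1 i).continuous (h2 i)
  have L : ∫ x, ((∑ i, ∑ j, ρ x * u x i * u x j * tgrad (fun x i => φ i x) x i j)
        + ρ x ^ γ * (∑ i, tgrad (fun x i => φ i x) x i i)) =
      (∑ i, ∑ j, ∫ x, r x * v i x * v j x * pd (φ i) j x) + ∑ i, ∫ x, r x ^ γ * pd (φ i) i x := by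
    have e : ∫ x, ((∑ i, ∑ j, ρ x * u x i * u x j * tgrad (fun x i => φ i x) x i j)
        + ρ x ^ γ * (∑ i, tgrad (fun x i => φ i x) x i i)) =
        ∫ x, ((∑ i, ∑ j, r x * v i x * v j x * pd (φ i) j x) + ∑ i, r x ^ γ * pd (φ i) i x) := by
      refine integral_congr_ae ?_
      filter_upwards [hr, ae_all_iff.mpr hv] with x a b
      simp only [a, b, Finset.mul_sum]
      rfl
    rw [e, integral_add (integrable_finsetSum _ fun i _ => integrable_finsetSum _ fun j _ => iR i j)
      (integrable_finsetSum _ fun i _ => iP i), integral_finsetSum _ fun i _ => iP i,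
      integral_finsetSum _ fun i _ => integrable_finsetSum _ fun j _ => iR i j]
    congr 1
    exact Finset.sum_congr rfl fun i _ => integral_finsetSum _ fun j _ => iR i j
  have M : ∫ x, ∑ i, ∑ j, Smat μ η (du x) i j * tgrad (fun x i => φ i x) x i j =
      ∑ i, ∑ j, ∫ x, Smat μ η (fun a b => dv a b x) i j * pd (φ i) j x := by
    have e : ∫ x, ∑ i, ∑ j, Smat μ η (du x) i j * tgrad (fun x i => φ i x) x i j =
        ∫ x, ∑ i, ∑ j, Smat μ η (fun a b => dv a b x) i j * pd (φ i) j x := by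
      refine integral_congr_ae ?_
      filter_upwards [ae_all_iff.mpr fun i => ae_all_iff.mpr (hd i)] with x a
      have : (fun a b => dv a b x) = du x := by funext i j; exact a i j
      simp only [this]
      rfl
    rw [e, integral_finsetSum _ fun i _ => integrable_finsetSum _ fun j _ => iS i j]
    exact Finset.sum_congr rfl fun i _ => integral_finsetSum _ fun j _ => iS i j
  have N : ∫ x, ∑ i, ρ x * dG x i * φ i x = ∑ i, ∫ x, r x * dg i x * φ i x := by
    rw [← integral_finsetSum _ fun i _ => iG i]
    refine integral_congr_ae ?_
    filter_upwards [hr, ae_all_iff.mpr hg] with x a b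
    simp only [a, b]
  have h' := h
  rw [L, M, N] at h'
  have Q : ∀ i j, ∫ x, (Smat μ η (fun a b => dv a b x) i j - r x * v i x * v j x) * pd (φ i) j x =
      (∫ x, Smat μ η (fun a b => dv a b x) i j * pd (φ i) j x) - ∫ x, r x * v i x * v j x * pd (φ i) j x :=
    fun i j => by
      rw [← integral_sub (iS i j) (iR i j)]; congr 1; funext x; ring
  simp only [Q, Finset.sum_sub_distrib]
  linarith

end conv
end

noncomputable section
open MeasureTheory Metric Filter Topology Set
open scoped ENNReal NNReal

lemma lpNormOn_congr {f g : E3 → ℝ} (h : f =ᵐ[volume] g) (r : ℝ) (s : Set E3) :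
    lpNormOn f r s = lpNormOn g r s := by
  unfold lpNormOn
  congr 1
  refine integral_congr_ae (ae_restrict_of_ae ?_)
  filter_upwards [h] with x hx
  rw [hx]

lemma conv_gr {γ α C : ℝ} {ρ r : E3 → ℝ} (hγ : 3 ≤ γ) (hα : 0 ≤ α) (r0 : ∀ x, 0 ≤ r x)
    (pl : LocallyIntegrable (fun x => r x ^ γ) volume) (hr : r =ᵐ[volume] ρ)
    (hρ : ∀ R : ℝ, 1 < R → lpNormOn ρ γ (ball (0 : E3) R) ≤ C * R ^ α) :
    ∀ R ≥ 1, nr γ (ind R r) ≤ ENNReal.ofReal ((|C| * 2 ^ α) * R ^ α) := by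
  intro R hR
  have h0 : 0 < R := by linarith
  have h1 := hρ (2 * R) (by linarith)
  rw [← lpNormOn_congr hr] at h1
  have hi : IntegrableOn (fun x => |r x| ^ γ) (ball (0:E3) (2 * R)) volume := by
    have := (pl.integrableOn_isCompact (isCompact_closedBall (0:E3) (2 * R))).mono_set ball_subset_closedBall
    refine this.congr_fun (fun x _ => ?_) measurableSet_ball
    rw [abs_of_nonneg (r0 x)]
  have h2 := nr_indicator (by linarith) measurableSet_ball hi
  have h3 : nr γ (ind R r) ≤ nr γ ((ball (0:E3) (2 * R)).indicator r) := by
    refine nr_mono fun x => ?_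
    by_cases hx : ‖x‖ ≤ R
    · rw [ind_of_le hx, indicator_of_mem]
      rw [mem_ball_zero_iff]; linarith
    · rw [ind_of_lt (not_le.mp hx), abs_zero]; positivity
  refine h3.trans ?_
  rw [h2]
  refine ENNReal.ofReal_le_ofReal (h1.trans ?_)
  rw [Real.mul_rpow zero_le_two h0.le, mul_assoc]
  exact mul_le_mul_of_nonneg_right (le_abs_self C) (by positivity)

lemma abs_le_vnorm (w : Fin 3 → ℝ) (i : Fin 3) : |w i| ≤ vnorm w := by
  unfold vnorm
  refine Real.abs_le_sqrt ?_
  exact Finset.single_le_sum (f := fun k => (w k) ^ 2) (fun k _ => sq_nonneg _) (Finset.mem_univ i)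

lemma vnorm_nonneg (w : Fin 3 → ℝ) : 0 ≤ vnorm w := Real.sqrt_nonneg _

lemma vnorm_le (w : Fin 3 → ℝ) : vnorm w ≤ ∑ i, |w i| := by
  unfold vnorm
  refine Real.sqrt_le_iff.mpr ⟨Finset.sum_nonneg fun i _ => abs_nonneg _, ?_⟩
  simp only [Fin.sum_univ_three]
  have a := abs_nonneg (w 0)
  have b := abs_nonneg (w 1)
  have c := abs_nonneg (w 2)
  rw [← sq_abs (w 0), ← sq_abs (w 1), ← sq_abs (w 2)]
  nlinarith [mul_nonneg a b, mul_nonneg a c, mul_nonneg b c]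

lemma conv_good {β g C R : ℝ} {u : E3 → Fin 3 → ℝ} {v : Fin 3 → E3 → ℝ} (hβ : 1 ≤ β) (hβ2 : β ≤ 2)
    (vm : ∀ i, Measurable (v i)) (v6 : ∀ i, nr 6 (v i) ≠ ⊤) (hv : ∀ i, ∀ᵐ x, v i x = u x i) (hR : 0 < R)
    (h : R ^ (-g) * vecLpNormOn u β (ball (0 : E3) (2 * R) \ ball (0 : E3) R) ≤ C) :
    NSFlow.Good β g |C| v R := by
  intro i
  have hβ0 : 0 < β := by linarith
  set w : E3 → ℝ := fun x => vnorm (fun k => v k x) with hw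
  have wm : Measurable w := by
    unfold vnorm at hw
    rw [hw]
    exact (Finset.measurable_sum _ fun k _ => (vm k).pow_const 2).sqrt
  have mA : MeasurableSet (Ann R) := measurableSet_ball.diff measurableSet_ball
  have fA : volume (Ann R) < ⊤ := (measure_mono Set.sdiff_subset).trans_lt measure_ball_lt_top
  have w6 : MemLp w 6 volume := by
    have hs : MemLp (fun x => ∑ k, |v k x|) 6 volume := memLp_finsetSum _ fun k _ => by
      have : MemLp (v k) 6 volume := ⟨(vm k).aestronglyMeasurable, by
        have := v6 k
        rw [nr, show ENNReal.ofReal 6 = 6 by norm_num] at this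
        exact this.lt_top⟩
      exact this.norm
    refine hs.mono wm.aestronglyMeasurable (ae_of_all _ fun x => ?_)
    rw [Real.norm_eq_abs, Real.norm_eq_abs, abs_of_nonneg (vnorm_nonneg _)]
    exact (vnorm_le _).trans (le_abs_self _)
  have hi : IntegrableOn (fun x => |w x| ^ β) (Ann R) volume := by
    haveI : IsFiniteMeasure (volume.restrict (Ann R)) := ⟨by rwa [Measure.restrict_apply_univ]⟩
    have h1 : MemLp w (ENNReal.ofReal β) (volume.restrict (Ann R)) := (w6.restrict _).mono_exponent (by
      rw [show (6:ℝ≥0∞) = ENNReal.ofReal 6 by norm_num]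
      exact ENNReal.ofReal_le_ofReal (by linarith))
    have h2 := h1.integrable_norm_rpow'
    rw [ENNReal.toReal_ofReal hβ0.le] at h2
    exact h2
  have e : vecLpNormOn u β (Ann R) = lpNormOn w β (Ann R) := by
    unfold vecLpNormOn lpNormOn
    congr 1
    refine integral_congr_ae (ae_restrict_of_ae ?_)
    filter_upwards [ae_all_iff.mpr hv] with x hx
    have : (fun k => v k x) = u x := funext hx
    simp only [hw, this, abs_of_nonneg (vnorm_nonneg _)]
  change R ^ (-g) * vecLpNormOn u β (Ann R) ≤ C at h
  rw [e, Real.rpow_neg hR.le, inv_mul_le_iff₀ (by positivity)] at h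
  have h3 : nr β (ann R (v i)) ≤ nr β ((Ann R).indicator w) := by
    refine nr_mono fun x => ?_
    unfold ann
    by_cases hx : x ∈ Ann R
    · rw [indicator_of_mem hx, indicator_of_mem hx, abs_of_nonneg (vnorm_nonneg _)]
      exact abs_le_vnorm (fun k => v k x) i
    · rw [indicator_of_notMem hx, indicator_of_notMem hx]
  refine h3.trans ?_
  rw [nr_indicator hβ0 mA hi]
  refine ENNReal.ofReal_le_ofReal (h.trans ?_)
  rw [mul_comm]
  exact mul_le_mul_of_nonneg_right (le_abs_self C) (by positivity)

theorem liouville_aux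
    (μ η γ α β : ℝ) (hμ : 0 < μ) (hη : 0 ≤ η) (hγ : 3 ≤ γ)
    (hβ1 : 1 ≤ β) (hβ2 : β ≤ 2) (hα0 : 0 ≤ α) (hα1 : α ≤ 5 / (2 * γ))
    (G : E3 → ℝ) (dG : E3 → Fin 3 → ℝ)
    (ρ : E3 → ℝ) (u : E3 → Fin 3 → ℝ) (du : E3 → Fin 3 → Fin 3 → ℝ)
    (hG : MemD01q univ G dG (6 * γ / (5 * γ - 6)))
    (hsol : IsentropicWeakSolution μ η γ G dG ρ u du)
    (hρ : ∃ C : ℝ, ∀ R : ℝ, 1 < R → lpNormOn ρ γ (ball (0 : E3) R) ≤ C * R ^ α)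
    (hu : ∃ C : ℝ, ∀ R₀ : ℝ, ∃ R : ℝ, R₀ < R ∧
      R ^ (-gExp α β γ) * vecLpNormOn u β (ball (0 : E3) (2 * R) \ ball (0 : E3) R) ≤ C) :
    ∀ᵐ x, u x = 0 := by
  obtain ⟨C1, hρ⟩ := hρ
  obtain ⟨C2, hu⟩ := hu
  obtain ⟨-, -, du2, un, unt, und, un6⟩ := hsol.u_D012
  obtain ⟨-, dGq, Gn, Gnt, Gnd, -⟩ := hG
  rw [Measure.restrict_univ] at du2 dGq
  have hq1 : 1 ≤ qG γ := by
    unfold qG; rw [le_div_iff₀ (by linarith)]; linarith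
  -- measurable versions
  obtain ⟨r1, r1m, hr1⟩ := hsol.aemeas_ρ
  set r : E3 → ℝ := fun x => max (r1 x) 0 with hrdef
  have rm : Measurable r := r1m.max measurable_const
  have r0 : ∀ x, 0 ≤ r x := fun x => le_max_right _ _
  have hρ0 := hsol.ρ_nonneg
  rw [Measure.restrict_univ] at hρ0
  have hr : r =ᵐ[volume] ρ := by
    filter_upwards [hr1, hρ0] with x h1 h2
    rw [hrdef]; simp only [← h1]; exact max_eq_left h2
  obtain ⟨u1, u1m, hu1⟩ := hsol.aemeas_u
  set v : Fin 3 → E3 → ℝ := fun i x => u1 x i with hvdef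
  have vm : ∀ i, Measurable (v i) := fun i => (measurable_pi_apply i).comp u1m
  have hv : ∀ i, ∀ᵐ x, v i x = u x i := fun i => by
    filter_upwards [hu1] with x h; rw [hvdef]; simp only [h]
  obtain ⟨d1, d1m, hd1⟩ := du2.aestronglyMeasurable.aemeasurable
  set dv : Fin 3 → Fin 3 → E3 → ℝ := fun i j x => d1 x i j with hdvdef
  have dvm : ∀ i j, Measurable (dv i j) := fun i j =>
    (measurable_pi_apply j).comp ((measurable_pi_apply i).comp d1m)
  have hd : ∀ i j, ∀ᵐ x, dv i j x = du x i j := fun i j => by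
    filter_upwards [hd1] with x h; rw [hdvdef]; simp only [h]
  obtain ⟨g1, g1m, hg1⟩ := dGq.aestronglyMeasurable.aemeasurable
  set dg : Fin 3 → E3 → ℝ := fun i x => g1 x i with hdgdef
  have dgm : ∀ i, Measurable (dg i) := fun i => (measurable_pi_apply i).comp g1m
  have hg : ∀ i, ∀ᵐ x, dg i x = dG x i := fun i => by
    filter_upwards [hg1] with x h; rw [hdgdef]; simp only [h]
  have sob : ∀ i, Sob (v i) (dv i) (fun n x => un n x i) := fun i => by
    refine ⟨fun n => comp_sm (unt n) i, fun n => comp_hcs (unt n).2.1 i, ?_, fun k => ?_⟩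
    · refine Cvg.mk_of (by norm_num) (fun n => (comp_sm (unt n) i).continuous)
        (fun n => comp_hcs (unt n).2.1 i) (vm i) un6 fun n => ?_
      refine nr_comp_le (by norm_num) i ?_
      filter_upwards [hv i] with x h
      rw [h]; rfl
    · refine Cvg.mk_of (by norm_num) (fun n => (contDiff_pd (comp_sm (unt n) i) k).continuous)
        (fun n => hcs_pd (comp_hcs (unt n).2.1 i) k) (dvm i k) und fun n => ?_
      refine nr_comp_le2 (by norm_num) i k ?_
      filter_upwards [hd i k] with x h
      rw [h]; rfl
  have Gc : ∀ i, Cvg (qG γ) (fun n => pd (Gn n) i) (dg i) := fun i => by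
    refine Cvg.mk_of hq1 (fun n => (contDiff_pd (Gnt n).1 i).continuous)
      (fun n => hcs_pd (Gnt n).2.1 i) (dgm i) Gnd fun n => ?_
    refine nr_comp_le rfl i ?_
    filter_upwards [hg i] with x h
    rw [h]; rfl
  have dv2 : ∀ i j, MemLp (dv i j) 2 volume := fun i j =>
    ⟨(dvm i j).aestronglyMeasurable, by
      have := ((sob i).c2 j).fin
      rw [nr_two] at this
      exact this.lt_top⟩
  have pl := conv_pl hsol hr
  set S : Fin 3 → Fin 3 → E3 → ℝ := fun i j x => Smat μ η (fun a b => dv a b x) i j with hS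
  have core : Core γ r v S dg := by
    refine ⟨hγ, rm, vm, fun i j => ?_, dgm, r0, pl, fun i => (sob i).c6.fin, fun i j => ?_,
      fun i => (Gc i).fin, conv_weq hsol hr rm vm hv dgm hg hd dv2⟩
    · rw [hS]; unfold Smat
      have hs : Measurable fun x => ∑ k, dv k k x := Finset.measurable_sum _ fun k _ => dvm k k
      exact ((((dvm i j).add (dvm j i)).sub ((hs.const_mul _).mul_const _)).const_mul _).add
        ((hs.const_mul _).mul_const _)
    · rw [nr_two]; exact (Smat_memLp dv2 i j).2.ne
  have H : NSFlow γ r v S dg dv (fun i n x => un n x i) Gn :=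
    ⟨core, sob, conv_mass hsol hr rm vm hv, fun n => (Gnt n).1, fun n => (Gnt n).2.1, Gc⟩
  obtain ⟨f1, f2, f3⟩ := fExp_spec hγ hα0
  have D : Core.Gr γ r α (γ * fExp α γ) (|C1| * 2 ^ α) :=
    ⟨hα0, by positivity, f1, f2, f3, by
      rw [le_div_iff₀ (by linarith)] at hα1; linarith,
      conv_gr hγ hα0 r0 pl hr hρ⟩
  obtain ⟨q1, q2⟩ := gExp_spec (α := α) hγ hβ1 hβ2
  have good : ∀ R₀ : ℝ, ∃ R > R₀, NSFlow.Good β (gExp α β γ) |C2| v R := fun R₀ => by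
    obtain ⟨R, hR, hR2⟩ := hu (max R₀ 0)
    exact ⟨R, (le_max_left _ _).trans_lt hR,
      conv_good hβ1 hβ2 vm core.u6 hv ((le_max_right _ _).trans_lt hR) hR2⟩
  have z := H.diss_zero D hβ1 hβ2 (abs_nonneg _) q1 q2 good
  have zz := H.u_zero (H.du_zero hμ hη (fun i j x => rfl) z)
  filter_upwards [ae_all_iff.mpr zz, ae_all_iff.mpr hv] with x h1 h2
  funext i
  rw [← h2 i, h1 i]; rfl

end

/-- **Theorem 4.** Let `(ρ, u)` be a weak solution of the stationary isentropic system on `ℝ³`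
with `γ ≥ 3` and `G ∈ D₀^{1, 6γ/(5γ−6)}(ℝ³)`. Let `1 ≤ β ≤ 2` and `0 ≤ α ≤ 5/(2γ)`.
If `sup_{R>1} R^{−α} ‖ρ‖_{L^γ(B(R))} < ∞` and
`liminf_{R→∞} R^{−g(α,β,γ)} ‖u‖_{L^β(B(2R)∖B(R))} < ∞`, then `u = 0` a.e. -/
theorem liouville_isentropic_growth
    (μ η γ α β : ℝ) (hμ : 0 < μ) (hη : 0 ≤ η) (hγ : 3 ≤ γ)
    (hβ1 : 1 ≤ β) (hβ2 : β ≤ 2) (hα0 : 0 ≤ α) (hα1 : α ≤ 5 / (2 * γ))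
    (G : E3 → ℝ) (dG : E3 → Fin 3 → ℝ)
    (ρ : E3 → ℝ) (u : E3 → Fin 3 → ℝ) (du : E3 → Fin 3 → Fin 3 → ℝ)
    (hG : MemD01q univ G dG (6 * γ / (5 * γ - 6)))
    (hsol : IsentropicWeakSolution μ η γ G dG ρ u du)
    (hρ : ∃ C : ℝ, ∀ R : ℝ, 1 < R → lpNormOn ρ γ (ball (0 : E3) R) ≤ C * R ^ α)
    (hu : ∃ C : ℝ, ∀ R₀ : ℝ, ∃ R : ℝ, R₀ < R ∧
      R ^ (-gExp α β γ) * vecLpNormOn u β (ball (0 : E3) (2 * R) \ ball (0 : E3) R) ≤ C) :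
    ∀ᵐ x, u x = 0 := by
  exact liouville_aux μ η γ α β hμ hη hγ hβ1 hβ2 hα0 hα1 G dG ρ u du hG hsol hρ hu
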